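/- A finite group G is isomorphic to the alternating group A₅ if and only if |G| has at least three distinct prime divisors and every nontrivial element of G has prime order. -/

import Mathlib

namespace EPOA5
open scoped Classical BigOperators

section A
variable {G : Type} [Group G]

def IsChar (f : G → ℂ) : Prop :=
  ∃ (V : Type) (_ : AddCommGroup V) (_ : Module ℂ V) (_ : FiniteDimensional ℂ V)
    (ρ : Representation ℂ G V), ρ.character = f

def IsIrr (f : G → ℂ) : Prop :=
  ∃ (V : Type) (_ : AddCommGroup V) (_ : Module ℂ V) (_ : FiniteDimensional ℂ V)
    (ρ : Representation ℂ G V), ρ.IsIrreducible ∧ ρ.character = f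

lemma IsIrr.isChar {f : G → ℂ} (h : IsIrr f) : IsChar f := by
  obtain ⟨V, _, _, _, ρ, _, h⟩ := h
  exact ⟨V, _, _, ‹_›, ρ, h⟩

noncomputable def ip [Fintype G] (f g : G → ℂ) : ℂ := (Nat.card G : ℂ)⁻¹ * ∑ x, f x * g x⁻¹

lemma irr_ip [Fintype G] {f g : G → ℂ} (hf : IsIrr f) (hg : IsIrr g) :
    ip f g = if f = g then 1 else 0 := by
  obtain ⟨V, _, _, _, ρ, hρ, rfl⟩ := hf
  obtain ⟨W, _, _, _, σ, hσ, rfl⟩ := hg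
  have : Invertible (Nat.card G : ℂ) := invertibleOfNonzero (by simp [Nat.card_eq_fintype_card])
  have h1 := Representation.char_orthonormal ρ σ
  have h0 := Representation.char_orthonormal ρ ρ
  have h00 : Nonempty (ρ.Equiv ρ) := ⟨Representation.Equiv.refl ρ⟩
  rw [if_pos h00] at h0
  unfold ip
  rw [h1]
  by_cases h : Nonempty (σ.Equiv ρ)
  · have : ρ.character = σ.character := by
      obtain ⟨e⟩ := h
      exact (Representation.char_iso e).symm
    rw [if_pos h, if_pos this]
  · have : ρ.character ≠ σ.character := by
      intro h2
      rw [← h2, h0, if_neg h] at h1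
      exact one_ne_zero h1
    rw [if_neg h, if_neg this]

lemma char_split {V : Type} [AddCommGroup V] [Module ℂ V] [FiniteDimensional ℂ V]
    (ρ : Representation ℂ G V) (a b : Subrepresentation ρ) (h : IsCompl a b) :
    ρ.character = a.toRepresentation.character + b.toRepresentation.character := by
  have hc : IsCompl a.toSubmodule b.toSubmodule := by
    constructor
    · rw [disjoint_iff]
      have := congrArg Subrepresentation.toSubmodule (disjoint_iff.1 h.1)
      exact this
    · rw [codisjoint_iff]
      have := congrArg Subrepresentation.toSubmodule (codisjoint_iff.1 h.2)
      exact this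
  funext g
  let N : Bool → Submodule ℂ V := fun i => if i then a.toSubmodule else b.toSubmodule
  have hN : DirectSum.IsInternal N := by
    rw [DirectSum.isInternal_submodule_iff_isCompl N (i := true) (j := false) (by simp)
      (by ext x; cases x <;> simp)]
    simpa [N] using hc
  have hm : ∀ i, Set.MapsTo (ρ g) (N i) (N i) := by
    intro i
    cases i
    · exact fun x hx => b.apply_mem_toSubmodule g hx
    · exact fun x hx => a.apply_mem_toSubmodule g hx
  have := LinearMap.trace_eq_sum_trace_restrict hN hm
  rw [Representation.character, this]
  simp only [Fintype.univ_bool, Finset.mem_singleton, Bool.true_eq_false, not_false_eq_true, Finset.sum_insert, Finset.sum_singleton]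
  rfl

lemma isChar_decomp [Finite G] : ∀ (n : ℕ) (V : Type) [AddCommGroup V] [Module ℂ V] [FiniteDimensional ℂ V]
    (ρ : Representation ℂ G V), Module.finrank ℂ V = n →
    ∃ s : Multiset (G → ℂ), (∀ f ∈ s, IsIrr f) ∧ ρ.character = s.sum := by
  intro n
  induction n using Nat.strong_induction_on with
  | _ n ih =>
  intro V _ _ _ ρ hn
  by_cases h0 : n = 0
  · refine ⟨0, by simp, ?_⟩
    subst h0
    have : Subsingleton V := Module.finrank_zero_iff.1 hn
    funext g
    have : ρ g = 0 := by ext x; exact Subsingleton.elim _ _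
    simp [Representation.character, this]
  by_cases hirr : ρ.IsIrreducible
  · exact ⟨{ρ.character}, by simpa using ⟨V, _, _, ‹_›, ρ, hirr, rfl⟩, by simp⟩
  have hnt : Nontrivial V := Module.finrank_pos_iff (R := ℂ).1 (by omega)
  have hnt' : Nontrivial (Subrepresentation ρ) := by
    refine ⟨⟨⊥, ⊤, fun h => ?_⟩⟩
    have := congrArg Subrepresentation.toSubmodule h
    exact bot_ne_top (α := Submodule ℂ V) this
  have : ∃ a : Subrepresentation ρ, a ≠ ⊥ ∧ a ≠ ⊤ := by
    by_contra hcon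
    push Not at hcon
    exact hirr ⟨fun a => by by_cases h : a = ⊥ <;> [exact Or.inl h; exact Or.inr (hcon a h)]⟩
  obtain ⟨a, ha, ha'⟩ := this
  have hne : NeZero (Nat.card G : ℂ) := ⟨Nat.cast_ne_zero.2 Nat.card_pos.ne'⟩
  have hss : Representation.IsSemisimpleRepresentation ρ := inferInstance
  obtain ⟨b, hb⟩ := exists_isCompl a
  have hlt : ∀ c : Subrepresentation ρ, c ≠ ⊤ → Module.finrank ℂ c.toSubmodule < n := by
    intro c hc
    rw [← hn]
    apply Submodule.finrank_lt
    intro h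
    exact hc (Subrepresentation.toSubmodule_injective h)
  have hb' : b ≠ ⊤ := by
    rintro rfl
    exact ha (by simpa using hb.1)
  obtain ⟨s, hs, hs'⟩ := ih _ (hlt a ha') _ a.toRepresentation rfl
  obtain ⟨t, ht, ht'⟩ := ih _ (hlt b hb') _ b.toRepresentation rfl
  refine ⟨s + t, ?_, ?_⟩
  · intro f hf
    rcases Multiset.mem_add.1 hf with h | h
    exacts [hs f h, ht f h]
  · rw [char_split ρ a b hb, hs', ht', Multiset.sum_add]

lemma IsChar.decomp [Finite G] {f : G → ℂ} (hf : IsChar f) :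
    ∃ s : Multiset (G → ℂ), (∀ f ∈ s, IsIrr f) ∧ f = s.sum := by
  obtain ⟨V, _, _, _, ρ, rfl⟩ := hf
  exact isChar_decomp _ V ρ rfl

end A
end EPOA5

namespace EPOA5
open scoped Classical BigOperators
section A
variable {G : Type} [Group G]

lemma IsChar.one_eq {f : G → ℂ} (hf : IsChar f) : ∃ n : ℕ, f 1 = n := by
  obtain ⟨V, _, _, _, ρ, rfl⟩ := hf
  exact ⟨_, Representation.char_one ρ⟩

lemma IsChar.conj {f : G → ℂ} (hf : IsChar f) (x y : G) : f (y * x * y⁻¹) = f x := by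
  obtain ⟨V, _, _, _, ρ, rfl⟩ := hf
  exact Representation.char_conj ρ x y

lemma IsIrr.one_pos {f : G → ℂ} (hf : IsIrr f) : ∃ n : ℕ, 0 < n ∧ f 1 = n := by
  obtain ⟨V, _, _, _, ρ, hρ, rfl⟩ := hf
  refine ⟨_, ?_, Representation.char_one ρ⟩
  by_contra h
  have h0 : Module.finrank ℂ V = 0 := by omega
  have : Subsingleton V := Module.finrank_zero_iff.1 h0
  have h2 := hρ.exists_pair_ne
  obtain ⟨a, b, hab⟩ := h2
  exact hab (Subrepresentation.toSubmodule_injective (Subsingleton.elim _ _))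

lemma IsChar.comp {H : Type} [Group H] {f : G → ℂ} (hf : IsChar f) (φ : H →* G) :
    IsChar (fun h => f (φ h)) := by
  obtain ⟨V, _, _, _, ρ, rfl⟩ := hf
  exact ⟨V, _, _, ‹_›, ρ.comp φ, rfl⟩

/-- a one-dimensional character -/
def lin (l : G →* ℂˣ) : G → ℂ := fun g => (l g : ℂ)

noncomputable def linRep (l : G →* ℂˣ) : Representation ℂ G ℂ where
  toFun g := (l g : ℂ) • LinearMap.id
  map_one' := by ext; simp
  map_mul' x y := by ext; simp [mul_comm]

lemma lin_isIrr (l : G →* ℂˣ) : IsIrr (lin l) := by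
  refine ⟨ℂ, _, _, inferInstance, linRep l, ?_, ?_⟩
  · have hnt : Nontrivial (Subrepresentation (linRep l)) := by
      refine ⟨⟨⊥, ⊤, fun h => ?_⟩⟩
      have := congrArg Subrepresentation.toSubmodule h
      exact bot_ne_top (α := Submodule ℂ ℂ) this
    refine ⟨fun a => ?_⟩
    rcases eq_bot_or_eq_top a.toSubmodule with h | h
    · exact Or.inl (Subrepresentation.toSubmodule_injective h)
    · exact Or.inr (Subrepresentation.toSubmodule_injective h)
  · funext g
    simp [Representation.character, linRep, lin]

lemma lin_of_finrank_one {V : Type} [AddCommGroup V] [Module ℂ V] [FiniteDimensional ℂ V]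
    (ρ : Representation ℂ G V) (h : Module.finrank ℂ V = 1) :
    ∃ l : G →* ℂˣ, ρ.character = lin l := by
  let φ : G →* ℂ :=
    { toFun := fun g => LinearMap.det (ρ g)
      map_one' := by simp
      map_mul' := by intro x y; simp }
  refine ⟨φ.toHomUnits, ?_⟩
  funext g
  obtain ⟨c, hc⟩ : ∃ c : ℂ, ρ g = c • LinearMap.id := by
    obtain ⟨v, hv, hv'⟩ := finrank_eq_one_iff'.1 h
    obtain ⟨c, hc⟩ := hv' (ρ g v)
    refine ⟨c, LinearMap.ext fun w => ?_⟩
    obtain ⟨d, rfl⟩ := hv' w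
    simp [← hc, smul_comm c d v]
  simp [Representation.character, lin, φ, MonoidHom.toHomUnits, hc, h]

lemma IsIrr.lin_of_comm (hG : ∀ x y : G, x * y = y * x) {f : G → ℂ} (hf : IsIrr f) :
    ∃ l : G →* ℂˣ, f = lin l := by
  obtain ⟨V, _, _, _, ρ, hρ, rfl⟩ := hf
  have : IsMulCommutative G := ⟨⟨hG⟩⟩
  exact lin_of_finrank_one ρ (Representation.IsIrreducible.finrank_eq_one_of_isMulCommutative ρ)

lemma unit_finite_order [Finite G] (l : G →* ℂˣ) (x : G) : ((l x : ℂ)) ^ Nat.card G = 1 := by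
  rw [← Units.val_pow_eq_pow_val, ← map_pow, pow_card_eq_one', map_one, Units.val_one]

lemma lin_conj [Finite G] (l : G →* ℂˣ) (x : G) : starRingEnd ℂ (lin l x) = lin l x⁻¹ := by
  have h1 : ‖(l x : ℂ)‖ = 1 := Complex.norm_eq_one_of_pow_eq_one (unit_finite_order l x) Nat.card_pos.ne'
  rw [lin, lin, map_inv, Units.val_inv_eq_inv_val, Complex.inv_def, Complex.normSq_eq_norm_sq, h1]
  simp

lemma lin_integral [Finite G] (l : G →* ℂˣ) (x : G) : IsIntegral ℤ (lin l x) := by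
  refine IsIntegral.of_pow (n := Nat.card G) Nat.card_pos ?_
  rw [lin, unit_finite_order]
  exact isIntegral_one

lemma IsChar.conj_integral [Finite G] {f : G → ℂ} (hf : IsChar f) (x : G) :
    starRingEnd ℂ (f x) = f x⁻¹ ∧ IsIntegral ℤ (f x) := by
  obtain ⟨s, hs, hs'⟩ := (hf.comp (Subgroup.zpowers x).subtype).decomp
  have key : ∀ s : Multiset (Subgroup.zpowers x → ℂ), (∀ f ∈ s, IsIrr f) → ∀ y,
      starRingEnd ℂ (s.sum y) = s.sum y⁻¹ ∧ IsIntegral ℤ (s.sum y) := by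
    intro s
    induction s using Multiset.induction with
    | empty => intro _ y; simp [isIntegral_zero]
    | cons a s ih =>
      intro h y
      have ih' := ih (fun f hf => h f (Multiset.mem_cons_of_mem hf)) y
      obtain ⟨l, hl⟩ := (h a (Multiset.mem_cons_self _ _)).lin_of_comm
        (fun u v => by
          obtain ⟨u, m, rfl⟩ := u
          obtain ⟨v, n, rfl⟩ := v
          ext
          simp [← zpow_add, add_comm])
      rw [Multiset.sum_cons, Pi.add_apply, Pi.add_apply, map_add, ih'.1, hl, lin_conj]
      exact ⟨rfl, (lin_integral _ _).add ih'.2⟩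
  have := key s hs ⟨x, Subgroup.mem_zpowers x⟩
  rw [← hs'] at this
  simpa using this

lemma IsChar.dual {f : G → ℂ} (hf : IsChar f) : IsChar (fun x => f x⁻¹) := by
  obtain ⟨V, _, _, _, ρ, rfl⟩ := hf
  exact ⟨Module.Dual ℂ V, _, _, inferInstance, ρ.dual, funext fun g => Representation.char_dual ρ g⟩

end A
end EPOA5

namespace EPOA5
open scoped Classical BigOperators
section A
variable {G : Type} [Group G]

def dl (f : G → ℂ) : G → ℂ := fun x => f x⁻¹

@[simp] lemma dl_dl (f : G → ℂ) : dl (dl f) = f := by funext x; simp [dl]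
lemma dl_sub (f g : G → ℂ) : dl (f - g) = dl f - dl g := rfl
lemma dl_add (f g : G → ℂ) : dl (f + g) = dl f + dl g := rfl
lemma dl_one (f : G → ℂ) : dl f 1 = f 1 := by simp [dl]
lemma dl_lin (l : G →* ℂˣ) : dl (lin l) = lin l⁻¹ := by funext x; simp [dl, lin]

section ip
variable [Fintype G]
lemma ip_add_left (f g h : G → ℂ) : ip (f + g) h = ip f h + ip g h := by
  simp [ip, add_mul, Finset.sum_add_distrib, mul_add]
lemma ip_sub_left (f g h : G → ℂ) : ip (f - g) h = ip f h - ip g h := by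
  simp [ip, sub_mul, Finset.sum_sub_distrib, mul_sub]
lemma ip_neg_left (f h : G → ℂ) : ip (-f) h = - ip f h := by
  simp [ip]
lemma ip_zero_left (h : G → ℂ) : ip 0 h = 0 := by
  simp [ip]
lemma ip_smul_left (c : ℂ) (f h : G → ℂ) : ip (c • f) h = c * ip f h := by
  simp only [ip, Pi.smul_apply, smul_eq_mul, mul_assoc, ← Finset.mul_sum]
  ring
lemma ip_comm (f g : G → ℂ) : ip f g = ip g f := by
  unfold ip
  congr 1
  rw [← Equiv.sum_comp (Equiv.inv G)]
  simp [mul_comm]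
lemma ip_add_right (f g h : G → ℂ) : ip h (f + g) = ip h f + ip h g := by
  rw [ip_comm, ip_add_left, ip_comm h, ip_comm h]
lemma ip_sub_right (f g h : G → ℂ) : ip h (f - g) = ip h f - ip h g := by
  rw [ip_comm, ip_sub_left, ip_comm h, ip_comm h]
lemma ip_smul_right (c : ℂ) (f h : G → ℂ) : ip h (c • f) = c * ip h f := by
  rw [ip_comm, ip_smul_left, ip_comm h]
lemma ip_zero_right (h : G → ℂ) : ip h 0 = 0 := by
  simp [ip]
lemma ip_neg_right (f h : G → ℂ) : ip h (-f) = - ip h f := by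
  simp [ip]
lemma ip_dl (f g : G → ℂ) : ip (dl f) (dl g) = ip f g := by
  unfold ip
  congr 1
  rw [← Equiv.sum_comp (Equiv.inv G)]
  simp [dl]
lemma ip_dl_right (f g : G → ℂ) : ip f (dl g) = ip (dl f) g := by
  rw [← ip_dl f (dl g), dl_dl]
lemma ip_sum_left {ι : Type*} (s : Finset ι) (f : ι → G → ℂ) (h : G → ℂ) :
    ip (∑ i ∈ s, f i) h = ∑ i ∈ s, ip (f i) h := by
  induction s using Finset.induction_on with
  | empty => simp [ip_zero_left]
  | insert a s ha ih => rw [Finset.sum_insert ha, Finset.sum_insert ha, ip_add_left, ih]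
lemma ip_sum_right {ι : Type*} (s : Finset ι) (f : ι → G → ℂ) (h : G → ℂ) :
    ip h (∑ i ∈ s, f i) = ∑ i ∈ s, ip h (f i) := by
  rw [ip_comm, ip_sum_left]; simp only [ip_comm]
end ip

/-- virtual characters -/
def VG (G : Type) [Group G] : AddSubgroup (G → ℂ) := AddSubgroup.closure {f | IsIrr f}

lemma IsIrr.vg {f : G → ℂ} (h : IsIrr f) : f ∈ VG G := AddSubgroup.subset_closure h

lemma IsChar.vg [Finite G] {f : G → ℂ} (h : IsChar f) : f ∈ VG G := by
  obtain ⟨s, hs, rfl⟩ := h.decomp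
  exact AddSubgroup.multiset_sum_mem _ _ fun f hf => (hs f hf).vg

lemma vg_conj_class {f : G → ℂ} (h : f ∈ VG G) (x y : G) : f (y * x * y⁻¹) = f x := by
  induction h using AddSubgroup.closure_induction with
  | mem f hf => exact (IsIrr.isChar hf).conj x y
  | zero => rfl
  | add f g _ _ hf hg => simp [hf, hg]
  | neg f _ hf => simp [hf]

lemma vg_star [Finite G] {f : G → ℂ} (h : f ∈ VG G) (x : G) : starRingEnd ℂ (f x) = f x⁻¹ := by
  induction h using AddSubgroup.closure_induction with
  | mem f hf => exact ((IsIrr.isChar hf).conj_integral x).1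
  | zero => simp
  | add f g _ _ hf hg => simp [hf, hg]
  | neg f _ hf => simp [hf]

lemma vg_integral [Finite G] {f : G → ℂ} (h : f ∈ VG G) (x : G) : IsIntegral ℤ (f x) := by
  induction h using AddSubgroup.closure_induction with
  | mem f hf => exact ((IsIrr.isChar hf).conj_integral x).2
  | zero => exact isIntegral_zero
  | add f g _ _ hf hg => exact hf.add hg
  | neg f _ hf => exact hf.neg

lemma vg_one {f : G → ℂ} (h : f ∈ VG G) : ∃ n : ℤ, f 1 = n := by
  induction h using AddSubgroup.closure_induction with
  | mem f hf => obtain ⟨n, hn⟩ := (IsIrr.isChar hf).one_eq; exact ⟨n, by simp [hn]⟩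
  | zero => exact ⟨0, by simp⟩
  | add f g _ _ hf hg =>
    obtain ⟨m, hm⟩ := hf
    obtain ⟨n, hn⟩ := hg
    exact ⟨m + n, by simp [hm, hn]⟩
  | neg f _ hf =>
    obtain ⟨m, hm⟩ := hf
    exact ⟨-m, by simp [hm]⟩

lemma vg_res [Finite G] {f : G → ℂ} (h : f ∈ VG G) (H : Subgroup G) : (fun x : H => f x) ∈ VG H := by
  induction h using AddSubgroup.closure_induction with
  | mem f hf => exact ((IsIrr.isChar hf).comp H.subtype).vg
  | zero => exact (VG H).zero_mem
  | add f g _ _ hf hg => exact (VG H).add_mem hf hg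
  | neg f _ hf => exact (VG H).neg_mem hf

lemma vg_dl [Finite G] {f : G → ℂ} (h : f ∈ VG G) : dl f ∈ VG G := by
  induction h using AddSubgroup.closure_induction with
  | mem f hf => exact ((IsIrr.isChar hf).dual).vg
  | zero => exact (VG G).zero_mem
  | add f g _ _ hf hg => exact (VG G).add_mem hf hg
  | neg f _ hf => exact (VG G).neg_mem hf

variable [Fintype G]

lemma vg_ip {f g : G → ℂ} (hf : f ∈ VG G) (hg : g ∈ VG G) : ∃ n : ℤ, ip f g = n := by
  induction hf using AddSubgroup.closure_induction with
  | mem f hf =>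
    induction hg using AddSubgroup.closure_induction with
    | mem g hg => exact ⟨if f = g then 1 else 0, by rw [irr_ip hf hg]; split_ifs <;> simp⟩
    | zero => exact ⟨0, by simp [ip_zero_right]⟩
    | add g h _ _ hf hg =>
      obtain ⟨m, hm⟩ := hf
      obtain ⟨n, hn⟩ := hg
      exact ⟨m + n, by simp [ip_add_right, hm, hn]⟩
    | neg g _ hg =>
      obtain ⟨m, hm⟩ := hg
      exact ⟨-m, by simp [ip_neg_right, hm]⟩
  | zero => exact ⟨0, by simp [ip_zero_left]⟩
  | add g h _ _ hf hg =>
      obtain ⟨m, hm⟩ := hf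
      obtain ⟨n, hn⟩ := hg
      exact ⟨m + n, by simp [ip_add_left, hm, hn]⟩
  | neg g _ hg =>
      obtain ⟨m, hm⟩ := hg
      exact ⟨-m, by simp [ip_neg_left, hm]⟩

lemma char_irr_ip {f g : G → ℂ} (hf : IsChar f) (hg : IsIrr g) : ∃ n : ℕ, ip f g = n := by
  obtain ⟨s, hs, rfl⟩ := hf.decomp
  clear hf
  induction s using Multiset.induction with
  | empty => exact ⟨0, by simp [ip_zero_left]⟩
  | cons a s ih =>
    obtain ⟨n, hn⟩ := ih (fun f hf => hs f (Multiset.mem_cons_of_mem hf))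
    refine ⟨(if a = g then 1 else 0) + n, ?_⟩
    rw [Multiset.sum_cons, ip_add_left, hn, irr_ip (hs a (Multiset.mem_cons_self _ _)) hg]
    split_ifs <;> simp

noncomputable def ipZ (f g : G → ℂ) : ℤ := ⌊(ip f g).re⌋

lemma ipZ_spec {f g : G → ℂ} (hf : f ∈ VG G) (hg : g ∈ VG G) : ip f g = ipZ f g := by
  obtain ⟨n, hn⟩ := vg_ip hf hg
  simp [ipZ, hn]

lemma vg_norm {f : G → ℂ} (hf : f ∈ VG G) :
    ip f f = (((Nat.card G : ℝ)⁻¹ * ∑ x, ‖f x‖ ^ 2 : ℝ) : ℂ) := by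
  unfold ip
  push_cast
  congr 1
  refine Finset.sum_congr rfl fun x _ => ?_
  rw [← vg_star hf, Complex.mul_conj, Complex.normSq_eq_norm_sq]
  push_cast; rfl

lemma vg_normZ {f : G → ℂ} (hf : f ∈ VG G) :
    (ipZ f f : ℝ) = (Nat.card G : ℝ)⁻¹ * ∑ x, ‖f x‖ ^ 2 := by
  have := vg_norm hf
  rw [ipZ_spec hf hf] at this
  exact_mod_cast this

lemma ipZ_self_nonneg {f : G → ℂ} (hf : f ∈ VG G) : 0 ≤ ipZ f f := by
  have := vg_normZ hf
  have h2 : (0:ℝ) ≤ (ipZ f f : ℝ) := by rw [this]; positivity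
  exact_mod_cast h2

lemma eq_zero_of_ip {f : G → ℂ} (hf : f ∈ VG G) (h : ip f f = 0) : f = 0 := by
  rw [vg_norm hf] at h
  have h1 : (Nat.card G : ℝ)⁻¹ * ∑ x, ‖f x‖ ^ 2 = 0 := by exact_mod_cast h
  have h2 : ∑ x, ‖f x‖ ^ 2 = 0 := by
    rcases mul_eq_zero.1 h1 with h | h
    · simp [Nat.card_eq_fintype_card] at h
    · exact h
  funext x
  have := (Finset.sum_eq_zero_iff_of_nonneg (fun i _ => by positivity)).1 h2 x (Finset.mem_univ _)
  simpa using this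

lemma exists_irr_ip_ne {f : G → ℂ} (hf : f ∈ VG G) (h : f ≠ 0) : ∃ χ, IsIrr χ ∧ ip f χ ≠ 0 := by
  by_contra hcon
  push Not at hcon
  apply h
  apply eq_zero_of_ip hf
  have : ∀ g ∈ VG G, ip f g = 0 := by
    intro g hg
    induction hg using AddSubgroup.closure_induction with
    | mem g hg => exact hcon g hg
    | zero => exact ip_zero_right f
    | add g k _ _ h1 h2 => rw [ip_add_right, h1, h2, add_zero]
    | neg g _ h1 => rw [ip_neg_right, h1, neg_zero]
  exact this f hf

lemma IsIrr.dual {f : G → ℂ} (hf : IsIrr f) : IsIrr (dl f) := by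
  have hc : IsChar (dl f) := hf.isChar.dual
  have hne : dl f ≠ 0 := by
    intro h
    obtain ⟨n, hn, h1⟩ := hf.one_pos
    have := congrFun h 1
    rw [dl_one, h1] at this
    simp at this
    omega
  obtain ⟨χ, hχ, hχ'⟩ := exists_irr_ip_ne hc.vg hne
  obtain ⟨n, hn⟩ := char_irr_ip hc hχ
  have hv : dl f - χ ∈ VG G := (VG G).sub_mem hc.vg hχ.vg
  have h1 : ip (dl f - χ) (dl f - χ) = ((2 - 2 * n : ℤ) : ℂ) := by
    rw [ip_sub_left, ip_sub_right, ip_sub_right, ip_dl, irr_ip hf hf, irr_ip hχ hχ, ip_comm χ, hn]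
    simp; ring
  have h2 := ipZ_self_nonneg hv
  have h3 := ipZ_spec hv hv
  rw [h1] at h3
  have h3 : (2 - 2 * n : ℤ) = ipZ (dl f - χ) (dl f - χ) := by exact_mod_cast h3
  have h4 : n = 1 := by
    have : n ≠ 0 := by rintro rfl; simp at hn; exact hχ' hn
    omega
  rw [h4] at h1
  have := eq_zero_of_ip hv (by rw [h1]; simp)
  rw [sub_eq_zero.1 this]; exact hχ

lemma bessel {f : G → ℂ} (hf : f ∈ VG G) (T : Finset (G → ℂ)) (hT : ∀ χ ∈ T, IsIrr χ) :
    ∑ χ ∈ T, ipZ f χ ^ 2 ≤ ipZ f f := by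
  set g : G → ℂ := f - ∑ χ ∈ T, ((ipZ f χ : ℤ) : ℂ) • χ with hg
  have hs : (∑ χ ∈ T, ((ipZ f χ : ℤ) : ℂ) • χ) ∈ VG G := by
    refine (VG G).sum_mem fun χ hχ => ?_
    have := (VG G).zsmul_mem (hT χ hχ).vg (ipZ f χ)
    convert this using 1
    funext x; simp
  have hv : g ∈ VG G := (VG G).sub_mem hf hs
  have hss : ∀ χ ∈ T, ip (∑ χ ∈ T, ((ipZ f χ : ℤ) : ℂ) • χ) χ = (ipZ f χ : ℤ) := by
    intro χ hχ
    rw [ip_sum_left, Finset.sum_eq_single χ]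
    · rw [ip_smul_left, irr_ip (hT χ hχ) (hT χ hχ)]; simp
    · intro ψ hψ hne
      rw [ip_smul_left, irr_ip (hT ψ hψ) (hT χ hχ), if_neg hne, mul_zero]
    · exact fun h => absurd hχ h
  have h1 : ip g g = ((ipZ f f - ∑ χ ∈ T, ipZ f χ ^ 2 : ℤ) : ℂ) := by
    have e1 : ip g (∑ χ ∈ T, ((ipZ f χ : ℤ) : ℂ) • χ) = 0 := by
      rw [ip_sum_right]
      refine Finset.sum_eq_zero fun χ hχ => ?_
      rw [ip_smul_right, hg, ip_sub_left, hss χ hχ, ipZ_spec hf (hT χ hχ).vg, sub_self, mul_zero]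
    have e2 : ip g g = ip g f := by
      conv_lhs => rw [hg, ip_sub_right, ← hg, e1, sub_zero]
    rw [e2, hg, ip_sub_left, ipZ_spec hf hf, ip_sum_left]
    push_cast
    congr 1
    refine Finset.sum_congr rfl fun χ hχ => ?_
    rw [ip_smul_left, ip_comm, ipZ_spec hf (hT χ hχ).vg]; ring
  rw [ipZ_spec hv hv] at h1
  have h1 : ipZ g g = ipZ f f - ∑ χ ∈ T, ipZ f χ ^ 2 := by exact_mod_cast h1
  have := ipZ_self_nonneg hv
  omega

end A
end EPOA5

namespace EPOA5
open scoped Classical BigOperators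
section A
variable {G : Type} [Group G] [Fintype G]

noncomputable def ind (P : Subgroup G) (l : P →* ℂˣ) : G → ℂ := fun g =>
  (Nat.card P : ℂ)⁻¹ * ∑ y : G, if h : y * g * y⁻¹ ∈ P then (l ⟨_, h⟩ : ℂ) else 0

noncomputable def rreg (G : Type) [Group G] : Representation ℂ G (G → ℂ) where
  toFun g := LinearMap.funLeft ℂ ℂ (fun y => y * g)
  map_one' := by ext; simp [LinearMap.funLeft]
  map_mul' x y := by ext; simp [LinearMap.funLeft, mul_assoc, Function.comp_def]

def indSub (P : Subgroup G) (l : P →* ℂˣ) : Subrepresentation (rreg G) where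
  toSubmodule :=
    { carrier := {φ | ∀ (p : P) (y : G), φ (p * y) = l p * φ y}
      add_mem' := by intro a b ha hb p y; simp [ha p y, hb p y, mul_add]
      zero_mem' := by intro p y; simp
      smul_mem' := by intro c a ha p y; simp [ha p y]; ring }
  apply_mem_toSubmodule := by
    intro g v hv p y
    have := hv p (y * g)
    simpa [rreg, LinearMap.funLeft, mul_assoc] using this

noncomputable def indE (P : Subgroup G) (l : P →* ℂˣ) : (G → ℂ) →ₗ[ℂ] (G → ℂ) where
  toFun φ := fun y => (Nat.card P : ℂ)⁻¹ * ∑ p : P, (l p⁻¹ : ℂ) * φ (p * y)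
  map_add' a b := by funext y; simp [mul_add, Finset.sum_add_distrib]
  map_smul' c a := by
    funext y
    simp only [Pi.smul_apply, smul_eq_mul, RingHom.id_apply, Finset.mul_sum]
    refine Finset.sum_congr rfl fun p _ => by ring

lemma indE_mem (P : Subgroup G) (l : P →* ℂˣ) (φ : G → ℂ) : indE P l φ ∈ (indSub P l).toSubmodule := by
  intro p y
  simp only [indE, LinearMap.coe_mk, AddHom.coe_mk]
  rw [mul_left_comm]
  congr 1
  rw [Finset.mul_sum, ← Equiv.sum_comp (Equiv.mulRight p⁻¹)]
  refine Finset.sum_congr rfl fun q _ => ?_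
  have : (l (q * p⁻¹)⁻¹ : ℂ) = l p * l q⁻¹ := by
    rw [mul_inv_rev, inv_inv, map_mul, Units.val_mul]
  simp [mul_assoc]

lemma indE_id (P : Subgroup G) (l : P →* ℂˣ) (φ : G → ℂ) (h : φ ∈ (indSub P l).toSubmodule) :
    indE P l φ = φ := by
  funext y
  have h' : ∀ p : P, (l p⁻¹ : ℂ) * φ (p * y) = φ y := by
    intro p
    rw [h p y, ← mul_assoc, ← Units.val_mul, ← map_mul]; simp
  simp only [indE, LinearMap.coe_mk, AddHom.coe_mk, h']
  simp [Nat.card_eq_fintype_card]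

lemma ind_isChar (P : Subgroup G) (l : P →* ℂˣ) : IsChar (ind P l) := by
  refine ⟨(indSub P l).toSubmodule, inferInstance, inferInstance, inferInstance, (indSub P l).toRepresentation, ?_⟩
  funext g
  have hmem : ∀ x, (rreg G g ∘ₗ indE P l) x ∈ (indSub P l).toSubmodule := fun x =>
    (indSub P l).apply_mem_toSubmodule g (indE_mem P l x)
  have h1 : (indSub P l).toRepresentation g = (rreg G g ∘ₗ indE P l).restrict (fun x _ => hmem x) := by
    ext x y
    simp only [LinearMap.restrict_apply, LinearMap.comp_apply, indE_id P l x.1 x.2]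
    rfl
  rw [Representation.character, h1, LinearMap.trace_restrict_eq_of_forall_mem _ _ hmem,
    LinearMap.trace_eq_matrix_trace ℂ (Pi.basisFun ℂ G), Matrix.trace]
  unfold ind
  rw [Finset.mul_sum]
  refine Finset.sum_congr rfl fun y _ => ?_
  rw [Matrix.diag_apply, LinearMap.toMatrix_apply]
  simp only [rreg, Pi.basisFun_apply, LinearMap.comp_apply, MonoidHom.coe_mk, OneHom.coe_mk,
    LinearMap.funLeft_apply, Pi.basisFun_repr, indE, LinearMap.coe_mk, AddHom.coe_mk]
  congr 1
  by_cases h : y * g * y⁻¹ ∈ P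
  · rw [dif_pos h, Finset.sum_eq_single (⟨y * g * y⁻¹, h⟩⁻¹ : P)]
    · simp [mul_assoc]
    · intro b _ hb
      rw [Pi.single_eq_of_ne, mul_zero]
      intro h2
      apply hb
      rw [← inv_inj, inv_inv]
      ext
      have : (b : G) = (y * g * y⁻¹)⁻¹ := by
        rw [eq_inv_iff_mul_eq_one, ← mul_assoc, h2, mul_inv_cancel]
      simp [this]
    · simp
  · rw [dif_neg h, Finset.sum_eq_zero]
    intro p _
    rw [Pi.single_eq_of_ne, mul_zero]
    intro h2
    apply h
    have : y * g * y⁻¹ = (p : G)⁻¹ := by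
      have hp := eq_mul_inv_iff_mul_eq.2 h2
      rw [hp]; group
    rw [this]
    exact P.inv_mem p.2

/-- Frobenius reciprocity -/
lemma frobenius {f : G → ℂ} (hf : ∀ x y, f (y * x * y⁻¹) = f x) (P : Subgroup G) (l : P →* ℂˣ) :
    ip f (ind P l) = ip (fun x : P => f x) (lin l) := by
  unfold ip ind
  have h1 : ∀ x : G, f x * ((Nat.card P : ℂ)⁻¹ * ∑ y : G, if h : y * x⁻¹ * y⁻¹ ∈ P then (l ⟨_, h⟩ : ℂ) else 0)
    = (Nat.card P : ℂ)⁻¹ * ∑ y : G, f (y * x * y⁻¹) * (if h : (y * x * y⁻¹)⁻¹ ∈ P then (l ⟨_, h⟩ : ℂ) else 0) := by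
    intro x
    rw [mul_left_comm, Finset.mul_sum]
    congr 1
    refine Finset.sum_congr rfl fun y _ => ?_
    rw [hf]
    congr 1
    have : y * x⁻¹ * y⁻¹ = (y * x * y⁻¹)⁻¹ := by group
    simp only [this]
  simp only [h1]
  rw [← Finset.mul_sum, Finset.sum_comm]
  have h2 : ∀ y : G, (∑ x : G, f (y * x * y⁻¹) * (if h : (y * x * y⁻¹)⁻¹ ∈ P then (l ⟨_, h⟩ : ℂ) else 0))
    = ∑ x : G, f x * (if h : x⁻¹ ∈ P then (l ⟨_, h⟩ : ℂ) else 0) := by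
    intro y
    exact Equiv.sum_comp (MulAut.conj y).toEquiv
      (fun x => f x * (if h : x⁻¹ ∈ P then (l ⟨_, h⟩ : ℂ) else 0))
  simp only [h2]
  rw [Finset.sum_const, Finset.card_univ, nsmul_eq_mul, Nat.card_eq_fintype_card (α := G)]
  rw [mul_left_comm, inv_mul_cancel_left₀ (by simp)]
  congr 1
  rw [← Finset.sum_subset (Finset.subset_univ (Finset.univ.filter (fun x => x ∈ P)))]
  · rw [Finset.sum_subtype (p := fun x => x ∈ P) _ (by simp)]
    refine Finset.sum_congr rfl fun x _ => ?_
    rw [dif_pos (P.inv_mem x.2)]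
    rfl
  · intro x _ hx
    rw [dif_neg, mul_zero]
    simpa using hx

end A
end EPOA5

namespace EPOA5
open scoped Classical BigOperators commutatorElement
section A
variable {G : Type} [Group G]

lemma schur {V : Type} [AddCommGroup V] [Module ℂ V] [FiniteDimensional ℂ V]
    (ρ : Representation ℂ G V) (hρ : ρ.IsIrreducible) (T : V →ₗ[ℂ] V)
    (hT : ∀ g, T ∘ₗ ρ g = ρ g ∘ₗ T) : ∃ c : ℂ, T = c • LinearMap.id := by
  let F : Representation.IntertwiningMap ρ ρ := ⟨T, hT⟩
  obtain ⟨c, hc⟩ := (Representation.IsIrreducible.algebraMap_intertwiningMap_bijective_of_isAlgClosed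
    (ρ := ρ)).2 F
  refine ⟨c, ?_⟩
  have := congrArg (fun (f : Representation.IntertwiningMap ρ ρ) => f.toLinearMap) hc
  simp only [F] at this
  rw [← this]
  ext x
  rfl

lemma finrank_one_of_comm {V : Type} [AddCommGroup V] [Module ℂ V] [FiniteDimensional ℂ V]
    (ρ : Representation ℂ G V) (hρ : ρ.IsIrreducible)
    (hc : ∀ x y, ρ x ∘ₗ ρ y = ρ y ∘ₗ ρ x) : Module.finrank ℂ V = 1 := by
  have hs : ∀ x, ∃ c : ℂ, ρ x = c • LinearMap.id := fun x => schur ρ hρ (ρ x) (fun g => hc x g)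
  have hnt : Nontrivial V := by
    by_contra h
    rw [not_nontrivial_iff_subsingleton] at h
    obtain ⟨a, b, hab⟩ := hρ.exists_pair_ne
    exact hab (Subrepresentation.toSubmodule_injective (Subsingleton.elim _ _))
  obtain ⟨v, hv⟩ := exists_ne (0 : V)
  let S : Subrepresentation ρ :=
    { toSubmodule := Submodule.span ℂ {v}
      apply_mem_toSubmodule := by
        intro g w hw
        obtain ⟨c, hc⟩ := hs g
        rw [hc]
        exact Submodule.smul_mem _ _ hw }
  have hS : S = ⊤ := by
    rcases hρ.eq_bot_or_eq_top S with h | h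
    · exfalso
      have : v ∈ S.toSubmodule := Submodule.mem_span_singleton_self v
      rw [h] at this
      exact hv this
    · exact h
  have hS' : Submodule.span ℂ {v} = ⊤ := congrArg Subrepresentation.toSubmodule hS
  exact finrank_eq_one v hv (fun w => Submodule.mem_span_singleton.1 (hS' ▸ Submodule.mem_top))

lemma pgroup_irr [Finite G] {p : ℕ} (hp : p.Prime) (hG : IsPGroup p G) {f : G → ℂ} (hf : IsIrr f) :
    (∃ l : G →* ℂˣ, f = lin l) ∨ ∃ n : ℕ, f 1 = (p * n : ℕ) := by
  have := Fact.mk hp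
  obtain ⟨V, _, _, _, ρ, hρ, rfl⟩ := hf
  have hnil : Group.IsNilpotent G := hG.isNilpotent
  obtain ⟨n0, hn0⟩ := Subgroup.nilpotent_iff_lowerCentralSeries.1 hnil
  have hex : ∃ n, ∀ x ∈ Subgroup.lowerCentralSeries (⊤ : Subgroup G) n, ρ x = 1 := ⟨n0, by
    intro x hx
    rw [hn0, Subgroup.mem_bot] at hx
    rw [hx, map_one]⟩
  have hmin := Nat.find_spec hex
  have hlt := fun m => Nat.find_min hex (m := m)
  set n := Nat.find hex with hn
  by_cases h1 : n ≤ 1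
  · left
    apply lin_of_finrank_one
    apply finrank_one_of_comm ρ hρ
    intro x y
    have : ⁅x, y⁆ ∈ Subgroup.lowerCentralSeries (⊤ : Subgroup G) n := by
      have h2 : Subgroup.lowerCentralSeries (⊤ : Subgroup G) 1 ≤ Subgroup.lowerCentralSeries (⊤ : Subgroup G) n :=
        Subgroup.lowerCentralSeries_antitone ⊤ h1
      apply h2
      rw [Subgroup.top_lowerCentralSeries_one]
      exact Subgroup.commutator_mem_commutator (Subgroup.mem_top x) (Subgroup.mem_top y)
    have h3 := hmin _ this
    have h4 : x * y = ⁅x, y⁆ * (y * x) := by simp [commutatorElement_def]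
    have h5 : ρ (x * y) = ρ (y * x) := by rw [h4, map_mul, h3, one_mul]
    rw [map_mul, map_mul] at h5
    exact h5
  · right
    obtain ⟨m, hm⟩ : ∃ m, n = m + 2 := ⟨n - 2, by omega⟩
    have h2 := hlt (m + 1) (by omega)
    push Not at h2
    obtain ⟨z, hz, hz'⟩ := h2
    have hzc : ∀ g, ρ z ∘ₗ ρ g = ρ g ∘ₗ ρ z := by
      intro g
      have : ⁅z, g⁆ ∈ Subgroup.lowerCentralSeries (⊤ : Subgroup G) n := by
        rw [hm]
        exact Subgroup.commutator_mem_commutator hz (Subgroup.mem_top g)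
      have h3 := hmin _ this
      have h4 : z * g = ⁅z, g⁆ * (g * z) := by simp [commutatorElement_def]
      have h5 : ρ (z * g) = ρ (g * z) := by rw [h4, map_mul, h3, one_mul]
      rw [map_mul, map_mul] at h5
      exact h5
    obtain ⟨c, hc⟩ := schur ρ hρ (ρ z) hzc
    have hdet : LinearMap.det (ρ z) = 1 := by
      let φ : G →* ℂ :=
        { toFun := fun g => LinearMap.det (ρ g)
          map_one' := by simp
          map_mul' := by intro x y; simp }
      have h2 : Subgroup.lowerCentralSeries (⊤ : Subgroup G) (m+1) ≤ Subgroup.lowerCentralSeries (⊤ : Subgroup G) 1 :=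
        Subgroup.lowerCentralSeries_antitone ⊤ (by omega)
      have h3 := h2 hz
      rw [Subgroup.top_lowerCentralSeries_one] at h3
      have h4 : commutator G ≤ φ.toHomUnits.ker := Abelianization.commutator_subset_ker _
      have h5 := h4 h3
      rw [MonoidHom.mem_ker] at h5
      have := congrArg Units.val h5
      exact this
    rw [hc, LinearMap.det_smul, LinearMap.det_id, mul_one] at hdet
    obtain ⟨k, hk⟩ := hG z
    have hcp : c ^ p ^ k = 1 := by
      have h6 : (ρ z) ^ p ^ k = 1 := by rw [← map_pow, hk, map_one]
      obtain ⟨x, hx⟩ : ∃ x : V, x ≠ 0 := by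
        by_contra h
        push Not at h
        apply hz'
        ext x
        rw [h x, map_zero, map_zero]
      have h7 := congrArg (fun T : V →ₗ[ℂ] V => T x) h6
      have h8 : ∀ j, ((ρ z) ^ j) x = c ^ j • x := by
        intro j
        induction j with
        | zero => simp
        | succ j ih => rw [pow_succ', Module.End.mul_apply, ih, hc]; simp [pow_succ', mul_smul, smul_comm c]
      simp only [h8, Module.End.one_apply] at h7
      have h9 : (c ^ p ^ k - 1) • x = 0 := by rw [sub_smul, h7, one_smul, sub_self]
      rcases smul_eq_zero.1 h9 with h | h
      · exact sub_eq_zero.1 h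
      · exact absurd h hx
    have hc1 : c ≠ 1 := by
      rintro rfl
      apply hz'
      rw [hc, one_smul]; rfl
    have hd1 : orderOf c ∣ p ^ k := orderOf_dvd_of_pow_eq_one hcp
    have hd2 : orderOf c ∣ Module.finrank ℂ V := orderOf_dvd_of_pow_eq_one hdet
    obtain ⟨j, hj, hj'⟩ := (Nat.dvd_prime_pow hp).1 hd1
    have hj0 : j ≠ 0 := by
      rintro rfl
      rw [pow_zero, orderOf_eq_one_iff] at hj'
      exact hc1 hj'
    have : p ∣ Module.finrank ℂ V := (dvd_pow_self p hj0).trans (hj' ▸ hd2)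
    obtain ⟨t, ht⟩ := this
    exact ⟨t, by rw [Representation.char_one, ht]⟩

end A
end EPOA5

namespace EPOA5
open scoped Classical BigOperators
section B

def EPO (G : Type*) [Group G] : Prop := ∀ g : G, g ≠ 1 → (orderOf g).Prime

variable {G : Type*} [Group G]

lemma EPO.sub (h : EPO G) (H : Subgroup G) : EPO H := by
  intro g hg
  rw [← Subgroup.orderOf_coe]
  exact h g (by simpa using hg)

lemma EPO.of_surj {H : Type*} [Group H] (h : EPO G) (f : G →* H) (hf : Function.Surjective f) : EPO H := by
  intro x hx
  obtain ⟨g, rfl⟩ := hf x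
  have hg : g ≠ 1 := by rintro rfl; simp at hx
  have h1 := orderOf_map_dvd f g
  rcases (Nat.dvd_prime (h g hg)).1 h1 with h2 | h2
  · exact absurd (orderOf_eq_one_iff.1 h2) hx
  · rw [h2]; exact h g hg

lemma EPO.comm (h : EPO G) {x y : G} (hx : x ≠ 1) (hy : y ≠ 1) (hxy : Commute x y) :
    orderOf x = orderOf y := by
  by_contra hne
  have hc : (orderOf x).Coprime (orderOf y) := (Nat.coprime_primes (h x hx) (h y hy)).2 hne
  have h1 := hxy.orderOf_mul_eq_mul_orderOf_of_coprime hc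
  have h2 : x * y ≠ 1 := by
    intro h3
    rw [h3, orderOf_one] at h1
    have := Nat.eq_one_of_mul_eq_one_right h1.symm
    exact (h x hx).ne_one this
  have h3 := h _ h2
  rw [h1] at h3
  exact Nat.not_prime_mul (h x hx).ne_one (h y hy).ne_one h3

lemma pow_mul_mem {V : Subgroup G} {y v : G} (hy : y ∈ Subgroup.normalizer (V : Set G)) (hv : v ∈ V) (n : ℕ) :
    (y ^ n)⁻¹ * (y * v) ^ n ∈ V := by
  induction n with
  | zero => simp
  | succ n ih =>
    have h1 := (Subgroup.mem_normalizer_iff.1 (inv_mem hy) _).1 ih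
    have : (y ^ (n+1))⁻¹ * (y * v) ^ (n+1) = (y⁻¹ * ((y ^ n)⁻¹ * (y * v) ^ n) * y⁻¹⁻¹) * v := by
      rw [pow_succ, pow_succ]; group
    rw [this]
    exact V.mul_mem h1 hv

lemma EPO.order_mul (h : EPO G) {V : Subgroup G} {y v : G} (hy : y ∈ Subgroup.normalizer (V : Set G)) (hyV : y ∉ V)
    (hv : v ∈ V) : orderOf (y * v) = orderOf y := by
  have h1 := pow_mul_mem hy hv (orderOf y)
  rw [pow_orderOf_eq_one, inv_one, one_mul] at h1
  have hyv : y * v ∉ V := fun h2 => hyV ((V.mul_mem_cancel_right hv).1 h2)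
  have hne : y * v ≠ 1 := fun h2 => hyv (h2 ▸ V.one_mem)
  have hy1 : y ≠ 1 := fun h2 => hyV (h2 ▸ V.one_mem)
  by_contra hcon
  have hc : (orderOf y).Coprime (orderOf (y * v)) := (Nat.coprime_primes (h y hy1) (h _ hne)).2 (Ne.symm hcon)
  obtain ⟨m, hm⟩ := exists_pow_eq_self_of_coprime hc
  apply hyv
  rw [← hm]
  exact V.pow_mem h1 m

lemma EPO.order_mul' (h : EPO G) {V : Subgroup G} {y v : G} (hy : y ∈ Subgroup.normalizer (V : Set G)) (hyV : y ∉ V)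
    (hv : v ∈ V) : orderOf (v * y) = orderOf y := by
  have h1 := (Subgroup.mem_normalizer_iff.1 (inv_mem hy) _).1 hv
  have h2 := h.order_mul hy hyV h1
  rw [← h2]
  congr 1
  group

lemma key_abs {A L : Type*} [CommGroup A] [Group L] [Finite L] (φ : L →* MulAut A) {p : ℕ}
    (hA : ∀ a : A, a ^ p = 1) (hL : EPO L)
    (H : ∀ x : L, x ≠ 1 → ∀ a, ∏ i ∈ Finset.range (orderOf x), φ (x ^ i) a = 1)
    (C : Subgroup L) (hC : C ≠ ⊥) (hpC : p.Coprime (Nat.card C)) (y : L) (hy : y ∉ C)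
    (hyN : y ∈ Subgroup.normalizer (C : Set L)) (a : A) : a = 1 := by
  have := Fintype.ofFinite C
  have hcop : ∀ (b : A) (n : ℕ), n ∣ Nat.card C → b ^ n = 1 → b = 1 := by
    intro b n hn hb
    have h1 : (p.Coprime n) := Nat.Coprime.coprime_dvd_right hn hpC
    have h2 := Nat.dvd_gcd (orderOf_dvd_of_pow_eq_one (hA b)) (orderOf_dvd_of_pow_eq_one hb)
    rw [h1.gcd_eq_one, Nat.dvd_one, orderOf_eq_one_iff] at h2
    exact h2
  have hnorm : ∀ u : A, ∏ c : C, φ c u = 1 := by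
    intro u
    obtain ⟨c0, hc0⟩ := (Subgroup.ne_bot_iff_exists_ne_one).1 hC
    apply hcop _ (orderOf c0) (orderOf_dvd_natCard c0)
    have h1 : ∏ c : C, ∏ i ∈ Finset.range (orderOf (c0 : L)), φ ((c0 : L) ^ i) (φ c u) = 1 :=
      Finset.prod_eq_one fun c _ => H c0 (by simpa using hc0) _
    rw [Finset.prod_comm] at h1
    rw [Subgroup.orderOf_coe] at h1
    have h2 : ∀ i ∈ Finset.range (orderOf c0), ∏ c : C, φ ((c0 : L) ^ i) (φ c u) = ∏ c : C, φ c u := by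
      intro i _
      rw [← Equiv.prod_comp (Equiv.mulLeft (c0 ^ i)) (fun c : C => φ (c : L) u)]
      refine Finset.prod_congr rfl fun c _ => ?_
      simp
    rw [Finset.prod_congr rfl h2, Finset.prod_const, Finset.card_range] at h1
    exact h1
  have hy1 : y ≠ 1 := fun h2 => hy (h2 ▸ C.one_mem)
  have hord : ∀ c : C, orderOf ((c : L) * y) = orderOf y := fun c => hL.order_mul' hyN hy c.2
  have hcy : ∀ c : C, (c : L) * y ≠ 1 := by
    intro c h
    apply hy
    rw [eq_inv_of_mul_eq_one_right h]
    exact C.inv_mem c.2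
  have hpr := hL y hy1
  apply hcop a _ dvd_rfl
  have h1 : ∏ c : C, ∏ i ∈ Finset.range (orderOf y), φ (((c : L) * y) ^ i) a = 1 := by
    refine Finset.prod_eq_one fun c _ => ?_
    rw [← hord c]
    exact H _ (hcy c) a
  rw [Finset.prod_comm, Finset.prod_eq_single 0] at h1
  · simpa [Nat.card_eq_fintype_card] using h1
  · intro i hi hi0
    have hir : i < orderOf y := Finset.mem_range.1 hi
    have hcop2 : i.Coprime (orderOf y) :=
      ((Nat.Prime.coprime_iff_not_dvd hpr).2 (Nat.not_dvd_of_pos_of_lt (by omega) hir)).symm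
    have hmem : ∀ c : C, ((c : L) * y) ^ i * (y ^ i)⁻¹ ∈ C := by
      intro c
      have h2 := pow_mul_mem hyN ((Subgroup.mem_normalizer_iff.1 (inv_mem hyN) _).1 c.2) i
      have h3 : y * (y⁻¹ * (c : L) * y⁻¹⁻¹) = c * y := by group
      rw [h3] at h2
      have h4 := (Subgroup.mem_normalizer_iff.1 ((Subgroup.normalizer (C : Set L)).pow_mem hyN i) _).1 h2
      have h5 : y ^ i * ((y ^ i)⁻¹ * ((c : L) * y) ^ i) * (y ^ i)⁻¹ = ((c : L) * y) ^ i * (y ^ i)⁻¹ := by group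
      rwa [h5] at h4
    let F : C → C := fun c => ⟨_, hmem c⟩
    have hF : Function.Injective F := by
      intro c d hcd
      have h2 : ((c : L) * y) ^ i = ((d : L) * y) ^ i := by
        have := congrArg Subtype.val hcd
        exact mul_right_cancel this
      have h6 : ((c : L) * y) = ((d : L) * y) := by
        have e : ∀ c : C, ((c : L) * y) = (((c : L) * y) ^ i) ^ (Nat.gcdA i (orderOf y)) := by
          intro c
          have hc := hord c
          have h8 := Nat.gcd_eq_gcd_ab i (orderOf y)
          rw [hcop2.gcd_eq_one] at h8
          conv_lhs => rw [← zpow_one ((c : L) * y)]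
          have h9 : (1 : ℤ) = i * Nat.gcdA i (orderOf y) + orderOf y * Nat.gcdB i (orderOf y) := by
            exact_mod_cast h8
          rw [h9, zpow_add, zpow_mul, zpow_mul, zpow_natCast, zpow_natCast]
          conv_lhs => rw [← hc]
          rw [pow_orderOf_eq_one]
          simp [hc]
        rw [e c, e d, h2]
      exact Subtype.ext (mul_right_cancel h6)
    have hFb : Function.Bijective F := Finite.injective_iff_bijective.1 hF
    rw [← hnorm (φ (y ^ i) a), ← Equiv.prod_comp (Equiv.ofBijective F hFb) (fun c : C => φ (c : L) (φ (y ^ i) a))]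
    refine Finset.prod_congr rfl fun c _ => ?_
    rw [← MulAut.mul_apply, ← map_mul]
    simp [F]
  · intro h
    exact absurd (Finset.mem_range.2 hpr.pos) h

end B
end EPOA5

namespace EPOA5
open scoped Classical BigOperators commutatorElement
section B
variable {G : Type*} [Group G]

lemma EPO.pow_p (h : EPO G) {p : ℕ} (hp : p.Prime) {V : Subgroup G} (hV : IsPGroup p V) {v : G} (hv : v ∈ V) :
    v ^ p = 1 := by
  by_cases h1 : v = 1
  · simp [h1]
  have h2 := h v h1
  obtain ⟨k, hk⟩ := hV ⟨v, hv⟩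
  have hk' : v ^ p ^ k = 1 := by simpa using congrArg Subtype.val hk
  have h3 := orderOf_dvd_of_pow_eq_one hk'
  have h4 : orderOf v = p := (Nat.prime_dvd_prime_iff_eq h2 hp).1 (h2.dvd_of_dvd_pow h3)
  rw [← h4, pow_orderOf_eq_one]

lemma EPO.order_p (h : EPO G) {p : ℕ} (hp : p.Prime) {V : Subgroup G} (hV : IsPGroup p V) {v : G} (hv : v ∈ V)
    (h1 : v ≠ 1) : orderOf v = p :=
  (Nat.prime_dvd_prime_iff_eq (h v h1) hp).1 (orderOf_dvd_of_pow_eq_one (h.pow_p hp hV hv))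

lemma prod_conj_eq {A : Type*} [CommMonoid A] (e : A → G) (hm : ∀ a b, e (a * b) = e a * e b)
    (h1 : e 1 = 1) (f : ℕ → A) (x v : G)
    (hf : ∀ i, e (f i) = x ^ i * v * (x ^ i)⁻¹) (n : ℕ) :
    e (∏ i ∈ Finset.range n, f i) = (v * x) ^ n * (x ^ n)⁻¹ := by
  induction n with
  | zero => simp [h1]
  | succ n ih =>
    rw [Finset.prod_range_succ, hm, ih, hf, pow_succ (v * x), pow_succ x]
    group

theorem EPO.key [Finite G] (h : EPO G) {p : ℕ} (hp : p.Prime) {V L C : Subgroup G}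
    (hVc : ∀ a ∈ V, ∀ b ∈ V, a * b = b * a) (hV : IsPGroup p V) (hV1 : V ≠ ⊥)
    (hL : L ≤ Subgroup.normalizer (V : Set G)) (hLV : ∀ x ∈ L, x ∈ V → x = 1)
    (hCL : C ≤ L) (hC : C ≠ ⊥) (hpC : p.Coprime (Nat.card C)) {y : G} (hy : y ∈ L)
    (hyN : y ∈ Subgroup.normalizer (C : Set G)) : y ∈ C := by
  by_contra hyC
  apply hV1
  rw [Subgroup.eq_bot_iff_forall]
  intro v hv
  let iC : CommGroup V := { (inferInstance : Group V) with mul_comm := fun a b => Subtype.ext (hVc a a.2 b b.2) }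
  let φ : L →* MulAut V := V.normalizerMonoidHom.comp (Subgroup.inclusion hL)
  have hφ : ∀ (x : L) (a : V), ((φ x a : V) : G) = x * a * (x : G)⁻¹ := by
    intro x a
    simp [φ]
  have hCL' : (C.subgroupOf L) ≠ ⊥ := by
    intro h0
    rw [Subgroup.subgroupOf_eq_bot] at h0
    exact hC (by simpa [hCL] using h0.eq_bot_of_le)
  have hcard : Nat.card (C.subgroupOf L) = Nat.card C := Nat.card_congr (Subgroup.subgroupOfEquivOfLe hCL).toEquiv
  have key := key_abs φ (p := p) (fun a => Subtype.ext (h.pow_p hp hV a.2)) (h.sub L) ?_ (C.subgroupOf L) hCL'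
    (by rwa [hcard]) ⟨y, hy⟩ (by simpa [Subgroup.mem_subgroupOf] using hyC) ?_ ⟨v, hv⟩
  · exact congrArg Subtype.val key
  · intro x hx a
    apply Subtype.ext
    have hx1 : (x : G) ≠ 1 := by simpa using hx
    rw [prod_conj_eq (fun a : V => (a : G)) (fun a b => rfl) rfl (fun i => φ (x ^ i) a) (x : G) (a : G)
      (fun i => by rw [hφ]; simp)]
    have h3 : orderOf ((a : G) * x) = orderOf (x : G) :=
      h.order_mul' (hL x.2) (fun h4 => hx1 (hLV x x.2 h4)) a.2
    have h4 : ((a : G) * x) ^ orderOf x = 1 := by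
      rw [← Subgroup.orderOf_coe, ← h3, pow_orderOf_eq_one]
    have h5 : (x : G) ^ orderOf x = 1 := by
      rw [← Subgroup.orderOf_coe, pow_orderOf_eq_one]
    rw [h4, h5]; simp
  · rw [Subgroup.mem_normalizer_iff] at hyN ⊢
    intro x
    simpa [Subgroup.mem_subgroupOf] using hyN x

lemma selfnorm_card {F : Type*} [Group F] [Finite F] (h : EPO F)
    (hs : ∀ C : Subgroup F, C ≠ ⊥ → Subgroup.normalizer (C : Set F) ≤ C) :
    Nat.card F = 1 ∨ (Nat.card F).Prime := by
  rcases subsingleton_or_nontrivial F with hF | hF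
  · left; exact Nat.card_of_subsingleton 1
  right
  have hsq : Squarefree (Nat.card F) := by
    rw [Nat.squarefree_iff_prime_squarefree]
    intro r hr hrr
    have := Fact.mk hr
    rw [← pow_two] at hrr
    obtain ⟨K, hK⟩ := Sylow.exists_subgroup_card_pow_prime r hrr
    have hKc : ∀ a b : K, a * b = b * a := fun a b =>
      (IsPGroup.isMulCommutative_of_card_eq_prime_sq hK).is_comm.comm a b
    obtain ⟨x, hx⟩ : ∃ x : K, x ≠ 1 := by
      have : Nontrivial K := Finite.one_lt_card_iff_nontrivial.1 (by rw [hK]; exact Nat.one_lt_pow two_ne_zero hr.one_lt)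
      exact exists_ne 1
    have hx1 : (x : F) ≠ 1 := by simpa using hx
    have hle : K ≤ Subgroup.zpowers (x : F) := by
      refine le_trans ?_ (hs (Subgroup.zpowers (x : F)) (by simpa using hx1))
      intro y hy
      rw [Subgroup.mem_normalizer_iff]
      have hcomm : ∀ n : ℤ, y * (x : F) ^ n * y⁻¹ = (x : F) ^ n := by
        intro n
        have : y * (x : F) = x * y := congrArg Subtype.val (hKc ⟨y, hy⟩ x)
        have h2 : Commute y ((x : F) ^ n) := (show Commute y (x : F) from this).zpow_right n
        rw [h2.eq, mul_inv_cancel_right]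
      intro z
      constructor
      · rintro ⟨n, rfl⟩
        exact ⟨n, (hcomm n).symm⟩
      · rintro ⟨n, hn⟩
        refine ⟨n, ?_⟩
        have : z = y⁻¹ * (y * z * y⁻¹) * y := by group
        rw [this, ← hn]
        simp only
        conv_rhs => rw [← hcomm n]
        group
    have h5 := Subgroup.card_le_of_le hle
    rw [hK, Nat.card_zpowers] at h5
    have h6 : orderOf (x : F) = r := h.order_p hr (IsPGroup.of_card hK) x.2 hx1
    rw [h6] at h5
    have := hr.two_le
    nlinarith
  have hz : IsZGroup F := IsZGroup.of_squarefree hsq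
  have hlt : commutator F < ⊤ := IsZGroup.commutator_lt F
  have hcb : commutator F = ⊥ := by
    by_contra hne
    have h1 := hs _ hne
    rw [Subgroup.normalizer_eq_top] at h1
    exact hlt.ne (top_le_iff.1 h1)
  obtain ⟨x, hx⟩ := exists_ne (1 : F)
  have hnorm : (Subgroup.zpowers x).Normal := by
    constructor
    intro n hn g
    have h1 : ⁅g, n⁆ ∈ commutator F := Subgroup.commutator_mem_commutator (Subgroup.mem_top _) (Subgroup.mem_top _)
    rw [hcb, Subgroup.mem_bot, commutatorElement_eq_one_iff_mul_comm] at h1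
    rw [h1, mul_inv_cancel_right]
    exact hn
  have h2 := hs (Subgroup.zpowers x) (by simpa using hx)
  rw [Subgroup.normalizer_eq_top, top_le_iff] at h2
  have h3 : Nat.card F = orderOf x := by rw [← Nat.card_zpowers, h2, Subgroup.card_top]
  rw [h3]; exact h x hx

theorem EPO.compl_card [Finite G] (h : EPO G) {p : ℕ} (hp : p.Prime) {V F : Subgroup G}
    (hVc : ∀ a ∈ V, ∀ b ∈ V, a * b = b * a) (hV : IsPGroup p V) (hV1 : V ≠ ⊥)
    (hF : F ≤ Subgroup.normalizer (V : Set G)) (hpF : p.Coprime (Nat.card F)) :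
    Nat.card F = 1 ∨ (Nat.card F).Prime := by
  have hFV : ∀ x ∈ F, x ∈ V → x = 1 := by
    intro x hx hxV
    by_contra h1
    have h2 := h.order_p hp hV hxV h1
    have h3 : orderOf x ∣ Nat.card F := by
      have := orderOf_dvd_natCard (⟨x, hx⟩ : F)
      rwa [← Subgroup.orderOf_coe] at this
    rw [h2] at h3
    exact hp.one_lt.ne' (Nat.eq_one_of_dvd_coprimes hpF dvd_rfl h3)
  apply selfnorm_card (h.sub F)
  intro C hC y hy
  have h1 : (y : G) ∈ C.map F.subtype := by
    refine h.key hp hVc hV hV1 hF hFV (C := C.map F.subtype) ?_ ?_ ?_ y.2 ?_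
    · exact Subgroup.map_subtype_le C
    · intro h0
      exact hC ((Subgroup.map_eq_bot_iff_of_injective C F.subtype_injective).1 h0)
    · have : Nat.card (C.map F.subtype) ∣ Nat.card F := Subgroup.card_dvd_of_le (Subgroup.map_subtype_le C)
      exact Nat.Coprime.coprime_dvd_right this hpF
    · rw [Subgroup.mem_normalizer_iff] at hy ⊢
      intro z
      constructor
      · rintro ⟨w, hw, rfl⟩
        exact ⟨y * w * y⁻¹, (hy w).1 hw, by simp⟩
      · rintro ⟨w, hw, hwz⟩
        refine ⟨y⁻¹ * w * y, ?_, ?_⟩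
        · apply (hy _).2
          have : y * (y⁻¹ * w * y) * y⁻¹ = w := by group
          rw [this]; exact hw
        · have hwz' : (w : G) = y * z * (y : G)⁻¹ := hwz
          simp [hwz', mul_assoc]
  obtain ⟨w, hw, hwy⟩ := h1
  have : w = y := Subtype.ext hwy
  rwa [← this]

theorem EPO.normal_index [Finite G] (h : EPO G) {p : ℕ} (hp : p.Prime) {P : Subgroup G} (hN : P.Normal)
    (hP : IsPGroup p P) (hP1 : P ≠ ⊥) (hi : p.Coprime P.index) : P.index = 1 ∨ P.index.Prime := by
  have := Fact.mk hp
  obtain ⟨n, hn⟩ := hP.exists_card_eq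
  obtain ⟨F, hF⟩ := Subgroup.exists_right_complement'_of_coprime (N := P) (by rw [hn]; exact hi.pow_left n)
  have hFi : Nat.card F = P.index := hF.symm.index_eq_card.symm
  rw [← hFi]
  let V : Subgroup G := (Subgroup.center P).map P.subtype
  have hVn : V.Normal := inferInstance
  have hVP : V ≤ P := Subgroup.map_subtype_le _
  refine h.compl_card hp (V := V) ?_ (hP.to_le hVP) ?_ ?_ (by rwa [hFi])
  · rintro _ ⟨a, ha, rfl⟩ _ ⟨b, hb, rfl⟩
    exact congrArg Subtype.val ((Subgroup.mem_center_iff.1 hb) a)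
  · intro h0
    have h1 := (Subgroup.map_eq_bot_iff_of_injective _ P.subtype_injective).1 h0
    have : Nontrivial P := (Subgroup.nontrivial_iff_ne_bot P).2 hP1
    exact hP.bot_lt_center.ne' h1
  · rw [Subgroup.normalizer_eq_top]; exact le_top

theorem EPO.two_primes [Finite G] (h : EPO G) {p : ℕ} (hp : p.Prime) {P : Subgroup G} (hN : P.Normal)
    (hP : IsPGroup p P) (hP1 : P ≠ ⊥) (hi : p.Coprime P.index) : (Nat.card G).primeFactors.card ≤ 2 := by
  have := Fact.mk hp
  obtain ⟨n, hn⟩ := hP.exists_card_eq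
  rw [← P.card_mul_index, hn]
  have h0 : P.index ≠ 0 := Subgroup.FiniteIndex.index_ne_zero
  rw [Nat.primeFactors_mul (pow_ne_zero _ hp.ne_zero) h0]
  refine (Finset.card_union_le _ _).trans ?_
  have h1 : (p ^ n).primeFactors.card ≤ 1 := by
    rcases Nat.eq_zero_or_pos n with rfl | hn0
    · simp
    · rw [Nat.primeFactors_pow p hn0.ne', hp.primeFactors]; simp
  have h2 : P.index.primeFactors.card ≤ 1 := by
    rcases h.normal_index hp hN hP hP1 hi with h | h
    · simp [h]
    · rw [h.primeFactors]; simp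
  omega

end B
end EPOA5

namespace EPOA5
open scoped Classical BigOperators commutatorElement
section C
variable {G : Type*} [Group G]

def NS (G : Type*) [Group G] : Prop :=
  ∃ p : ℕ, p.Prime ∧ ∃ P : Subgroup G, P.Normal ∧ IsPGroup p P ∧ P ≠ ⊥ ∧ p.Coprime P.index

lemma mem_of_normal_coprime {p : ℕ} {P : Subgroup G} (hN : P.Normal) (hi : p.Coprime P.index)
    {x : G} (hx : x ^ p = 1) : x ∈ P := by
  rw [← QuotientGroup.eq_one_iff, ← orderOf_eq_one_iff]
  apply Nat.eq_one_of_dvd_coprimes hi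
  · apply orderOf_dvd_of_pow_eq_one
    rw [← QuotientGroup.mk_pow, hx]; rfl
  · exact orderOf_dvd_natCard _

lemma EPO.disj_comm (h : EPO G) {p r : ℕ} (hp : p.Prime) (hr : r.Prime) (hpr : p ≠ r) {P R : Subgroup G}
    (hP : IsPGroup p P) (hR : IsPGroup r R) {x y : G} (hx : x ∈ P) (hy : y ∈ R)
    (h1 : x * y * x⁻¹ ∈ R) (h2 : y * x * y⁻¹ ∈ P) : x = 1 ∨ y = 1 := by
  by_contra hcon
  push Not at hcon
  have hdis : ∀ z ∈ P, z ∈ R → z = 1 := by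
    intro z hzP hzR
    by_contra hz
    exact hpr ((h.order_p hp hP hzP hz).symm.trans (h.order_p hr hR hzR hz))
  have hc : x * y * x⁻¹ * y⁻¹ = 1 := by
    apply hdis
    · have : x * y * x⁻¹ * y⁻¹ = x * (y * x * y⁻¹)⁻¹ := by group
      rw [this]; exact P.mul_mem hx (P.inv_mem h2)
    · exact R.mul_mem h1 (R.inv_mem hy)
  have hcc : Commute x y := by
    have := mul_inv_eq_one.1 hc
    exact mul_inv_eq_iff_eq_mul.1 this
  have := h.comm hcon.1 hcon.2 hcc
  rw [h.order_p hp hP hx hcon.1, h.order_p hr hR hy hcon.2] at this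
  exact hpr this

theorem EPO.ns_of_quot [Finite G] (h : EPO G) {p : ℕ} (hp : p.Prime) {Q : Subgroup G} [hN : Q.Normal]
    (hQ : IsPGroup p Q) (hQ1 : Q ≠ ⊥) (hq : NS (G ⧸ Q)) : NS G := by
  have := Fact.mk hp
  obtain ⟨r, hr, R0, hR0n, hR0, hR01, hR0i⟩ := hq
  have := Fact.mk hr
  set R : Subgroup G := R0.comap (QuotientGroup.mk' Q) with hR
  have hRn : R.Normal := hR0n.comap _
  have hRi : R.index = R0.index := Subgroup.index_comap_of_surjective _ (QuotientGroup.mk'_surjective Q)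
  have hQR : Q ≤ R := by
    intro x hx
    rw [hR, Subgroup.mem_comap, QuotientGroup.mk'_apply, (QuotientGroup.eq_one_iff x).2 hx]
    exact R0.one_mem
  by_cases hrp : r = p
  · subst hrp
    refine ⟨r, hr, R, hRn, ?_, ?_, by rwa [hRi]⟩
    · apply hR0.comap_of_ker_isPGroup
      rwa [QuotientGroup.ker_mk']
    · intro h0; rw [h0] at hQR; exact hQ1 (le_bot_iff.1 hQR)
  · let F : Sylow r R := default
    have hfr := Sylow.normalizer_sup_eq_top F
    set C : Subgroup G := (F : Subgroup R).map R.subtype with hC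
    have hCr : IsPGroup r C := F.2.map _
    have hCR : C ≤ R := Subgroup.map_subtype_le _
    have hrR : r ∣ Nat.card R := by
      have h1 : r ∣ Nat.card R0 := by
        obtain ⟨n, hn⟩ := hR0.exists_card_eq
        rw [hn]
        apply dvd_pow_self
        rintro rfl
        rw [pow_zero, Subgroup.card_eq_one] at hn
        exact hR01 hn
      have h2 : R.map (QuotientGroup.mk' Q) = R0 := Subgroup.map_comap_eq_self_of_surjective (QuotientGroup.mk'_surjective Q) _
      rw [← h2] at h1
      exact h1.trans (Subgroup.card_map_dvd _ _)
    have hC1 : C ≠ ⊥ := by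
      intro h0
      exact F.ne_bot_of_dvd_card hrR ((Subgroup.map_eq_bot_iff_of_injective _ R.subtype_injective).1 h0)
    let V : Subgroup G := (Subgroup.center Q).map Q.subtype
    have hVn : V.Normal := inferInstance
    have hVP : V ≤ Q := Subgroup.map_subtype_le _
    have hCc : p.Coprime (Nat.card C) := by
      obtain ⟨n, hn⟩ := hCr.exists_card_eq
      rw [hn]
      exact ((Nat.coprime_primes hp hr).2 (Ne.symm hrp)).pow_right n
    have hNC : Subgroup.normalizer (C : Set G) ≤ C := by
      intro y hy
      refine h.key hp (V := V) (L := Subgroup.normalizer (C : Set G)) ?_ (hQ.to_le hVP) ?_ ?_ ?_ Subgroup.le_normalizer hC1 hCc hy hy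
      · rintro _ ⟨a, ha, rfl⟩ _ ⟨b, hb, rfl⟩
        exact congrArg Subtype.val ((Subgroup.mem_center_iff.1 hb) a)
      · intro h0
        have h1 := (Subgroup.map_eq_bot_iff_of_injective _ Q.subtype_injective).1 h0
        have : Nontrivial Q := (Subgroup.nontrivial_iff_ne_bot Q).2 hQ1
        exact hQ.bot_lt_center.ne' h1
      · exact le_top.trans (Subgroup.normalizer_eq_top_iff.2 hVn).ge
      · intro x hx hxV
        obtain ⟨c, hc⟩ := (Subgroup.ne_bot_iff_exists_ne_one).1 hC1
        have hxQ := hVP hxV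
        rcases h.disj_comm hp hr (Ne.symm hrp) hQ hCr hxQ c.2 ((Subgroup.mem_normalizer_iff.1 hx _).1 c.2)
          (hN.conj_mem _ hxQ _) with h1 | h1
        · exact h1
        · exact absurd (Subtype.ext h1) hc
    have hRt : R = ⊤ := by
      rw [← top_le_iff, ← hfr]
      exact sup_le (hNC.trans hCR) le_rfl
    have hR0t : R0 = ⊤ := by
      rw [← Subgroup.index_eq_one, ← hRi, hRt, Subgroup.index_top]
    refine ⟨p, hp, Q, hN, hQ, hQ1, ?_⟩
    obtain ⟨n, hn⟩ := hR0.exists_card_eq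
    have : Q.index = r ^ n := by rw [← hn, hR0t, Subgroup.card_top]; rfl
    rw [this]
    exact ((Nat.coprime_primes hp hr).2 (Ne.symm hrp)).pow_right n

/-- Sylow subgroups are TI -/
theorem EPO.ti [Finite G] (h : EPO G)
    (hmin : ∀ H : Subgroup G, H ≠ ⊤ → H ≠ ⊥ → NS H)
    (hno : ∀ p : ℕ, p.Prime → ∀ Q : Subgroup G, Q.Normal → IsPGroup p Q → Q = ⊥)
    {p : ℕ} (hp : p.Prime) (P Q : Sylow p G) (hPQ : P ≠ Q) : (P : Subgroup G) ⊓ Q = ⊥ := by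
  have := Fact.mk hp
  by_contra hne
  obtain ⟨⟨P, Q⟩, ⟨hPQ, hne⟩, hmax⟩ := Set.Finite.exists_maximalFor
    (fun t : Sylow p G × Sylow p G => Nat.card ((t.1 : Subgroup G) ⊓ t.2 : Subgroup G))
    {t | t.1 ≠ t.2 ∧ (t.1 : Subgroup G) ⊓ t.2 ≠ ⊥} (Set.toFinite _) ⟨(P, Q), hPQ, hne⟩
  set D : Subgroup G := (P : Subgroup G) ⊓ Q with hD
  simp only at hPQ hne hmax
  have hDp : IsPGroup p D := P.2.to_le inf_le_left
  set N := Subgroup.normalizer (D : Set G) with hNd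
  have hDN : D ≤ N := Subgroup.le_normalizer
  obtain ⟨r, hr, R, hRn, hRr, hR1, hRi⟩ := hmin N
    (fun h0 => hne (hno p hp D (Subgroup.normalizer_eq_top_iff.1 h0) hDp))
    (fun h0 => hne (by rw [h0] at hDN; exact le_bot_iff.1 hDN))
  have := Fact.mk hr
  obtain ⟨d, hd⟩ := (Subgroup.ne_bot_iff_exists_ne_one).1 hne
  obtain ⟨x, hx⟩ := (Subgroup.ne_bot_iff_exists_ne_one).1 hR1
  have hrp : p = r := by
    by_contra hpr
    have hD' : IsPGroup p (D.subgroupOf N) := hDp.of_equiv (Subgroup.subgroupOfEquivOfLe hDN).symm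
    rcases (h.sub N).disj_comm hp hr hpr hD' hRr (x := ⟨d, hDN d.2⟩) (y := x.1) d.2 x.2
      (hRn.conj_mem _ x.2 _) ((Subgroup.mem_normalizer_iff.1 x.1.2 _).1 d.2) with h1 | h1
    · exact hd (Subtype.ext (show ((d : D) : G) = 1 from congrArg (fun z : N => (z : G)) h1))
    · exact hx (Subtype.ext h1)
  subst hrp
  have hRmap : IsPGroup p (R.map N.subtype) := hRr.map _
  obtain ⟨S, hS⟩ := hRmap.exists_le_sylow
  have key : ∀ T : Sylow p G, D ≤ T → D ≠ T → S = T := by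
    intro T hDT hDT'
    have hnil : Group.IsNilpotent T := T.2.isNilpotent
    have hlt : D.subgroupOf T < ⊤ := by
      rw [lt_top_iff_ne_top, Ne, Subgroup.subgroupOf_eq_top]
      exact fun h0 => hDT' (le_antisymm hDT h0)
    have h3 := Group.normalizerCondition_of_isNilpotent (G := T) _ hlt
    obtain ⟨y, hy, hyD⟩ := SetLike.exists_of_lt h3
    have hyN : (y : G) ∈ N := by
      rw [hNd, Subgroup.mem_normalizer_iff]
      intro z
      constructor
      · intro hz
        exact (Subgroup.mem_normalizer_iff.1 hy ⟨z, hDT hz⟩).1 hz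
      · intro hz
        have hzT : z ∈ (T : Subgroup G) := by
          have : z = (y : G)⁻¹ * (y * z * (y : G)⁻¹) * y := by group
          rw [this]
          exact mul_mem (mul_mem (inv_mem y.2) (hDT hz)) y.2
        exact (Subgroup.mem_normalizer_iff.1 hy ⟨z, hzT⟩).2 hz
    have hin : ∀ z ∈ N, z ∈ (T : Subgroup G) → z ∈ (S : Subgroup G) := by
      intro z hzN hzT
      apply hS
      refine ⟨⟨z, hzN⟩, ?_, rfl⟩
      exact mem_of_normal_coprime hRn hRi (Subtype.ext (h.pow_p hp T.2 hzT))
    by_contra hST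
    have hle : D ≤ (S : Subgroup G) ⊓ T := fun z hz => ⟨hin z (hDN hz) (hDT hz), hDT hz⟩
    have hlt2 : D < (S : Subgroup G) ⊓ T := by
      refine lt_of_le_of_ne hle fun h0 => hyD ?_
      have : (y : G) ∈ (S : Subgroup G) ⊓ T := ⟨hin y hyN y.2, y.2⟩
      rw [← h0] at this
      exact this
    have hb : (S : Subgroup G) ⊓ T ≠ ⊥ := fun h0 => by rw [h0] at hle; exact hne (le_bot_iff.1 hle)
    have h5 := hmax (j := (S, T)) ⟨hST, hb⟩ (Subgroup.card_le_of_le hle)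
    simp only at h5
    exact hlt2.ne (Subgroup.eq_of_le_of_card_ge hle h5)
  have h1 : S = P := key P inf_le_left (fun h0 => hPQ (Sylow.ext (by
    have : (P : Subgroup G) ≤ Q := by rw [← h0]; exact inf_le_right
    exact (P.3 Q.2 this).symm)))
  have h2 : S = Q := key Q inf_le_right (fun h0 => hPQ (Sylow.ext (by
    have : (Q : Subgroup G) ≤ P := by rw [← h0]; exact inf_le_left
    exact (Q.3 P.2 this))))
  exact hPQ (h1.symm.trans h2)

end C
end EPOA5

namespace EPOA5
open scoped Classical BigOperators commutatorElement
section C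

structure Cfg (G : Type) [Group G] where
  epo : EPO G
  odd : Odd (Nat.card G)
  nt : Nontrivial G
  ι : Type
  ft : Fintype ι
  P : ι → Subgroup G
  p : ι → ℕ
  q : ι → ℕ
  hp : ∀ i, (p i).Prime
  hq : ∀ i, (q i).Prime
  qp : ∀ i, q i ≠ p i
  pinj : Function.Injective p
  hP : ∀ i, IsPGroup (p i) (P i)
  P1 : ∀ i, P i ≠ ⊥
  ti : ∀ i, ∀ x ∈ P i, x ≠ 1 → ∀ g : G, g * x * g⁻¹ ∈ P i → g ∈ Subgroup.normalizer (P i : Set G)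
  cover : ∀ x : G, x ≠ 1 → ∃ i, ∃ g : G, g * x * g⁻¹ ∈ P i
  cardN : ∀ i, Nat.card (Subgroup.normalizer (P i : Set G)) = Nat.card (P i) * q i
  ordN : ∀ i, ∀ x ∈ Subgroup.normalizer (P i : Set G), x ∉ P i → orderOf x = q i

lemma EPO.normal_descend {G : Type*} [Group G] [Finite G] (h : EPO G) {H : Subgroup G} (hH : H.Normal) (hns : NS H) :
    ∃ p : ℕ, p.Prime ∧ ∃ Q : Subgroup G, Q.Normal ∧ IsPGroup p Q ∧ Q ≠ ⊥ := by
  obtain ⟨p, hp, R, hRn, hRp, hR1, hRi⟩ := hns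
  refine ⟨p, hp, R.map H.subtype, ⟨?_⟩, hRp.map _, ?_⟩
  · rintro _ ⟨x, hx, rfl⟩ g
    have h1 : g * x * g⁻¹ ∈ H := hH.conj_mem _ x.2 g
    refine ⟨⟨_, h1⟩, ?_, rfl⟩
    apply mem_of_normal_coprime hRn hRi
    apply Subtype.ext
    have : x ^ p = 1 := (h.sub H).pow_p hp hRp hx
    have h2 : (x : G) ^ p = 1 := by simpa using congrArg Subtype.val this
    simp [conj_pow, h2]
  · intro h0
    exact hR1 ((Subgroup.map_eq_bot_iff_of_injective _ H.subtype_injective).1 h0)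

theorem cfg_of_min {G : Type} [Group G] [Finite G] [Nontrivial G] (h : EPO G) (hodd : Odd (Nat.card G))
    (hmin : ∀ H : Subgroup G, H ≠ ⊤ → H ≠ ⊥ → NS H)
    (hno : ∀ p : ℕ, p.Prime → ∀ Q : Subgroup G, Q.Normal → IsPGroup p Q → Q = ⊥) : Nonempty (Cfg G) := by
  have hti : ∀ p : ℕ, p.Prime → ∀ P : Sylow p G, ∀ x ∈ (P : Subgroup G), x ≠ 1 → ∀ g : G,
      g * x * g⁻¹ ∈ (P : Subgroup G) → g ∈ Subgroup.normalizer (P : Set G) := by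
    intro p hp P x hx hx1 g hg
    have := Fact.mk hp
    by_contra hgn
    have h1 : g⁻¹ • P ≠ P := by
      intro h0
      apply hgn
      have := (Sylow.smul_eq_iff_mem_normalizer).1 h0
      exact inv_mem_iff.1 this
    have h2 := h.ti hmin hno hp P (g⁻¹ • P) h1.symm
    apply hx1
    rw [← Subgroup.mem_bot, ← h2]
    refine ⟨hx, ?_⟩
    show x ∈ ((g⁻¹ • P : Sylow p G) : Subgroup G)
    rw [Sylow.coe_subgroup_smul, Subgroup.mem_pointwise_smul_iff_inv_smul_mem]
    simpa [MulAut.smul_def] using hg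
  have hcomm : commutator G = ⊤ := by
    by_contra h1
    have h2 : commutator G ≠ ⊥ := by
      intro h0
      obtain ⟨x, hx⟩ := exists_ne (1 : G)
      have hp := h x hx
      have := Fact.mk hp
      have hall : ∀ y : G, y ^ orderOf x = 1 := by
        intro y
        by_cases hy : y = 1
        · simp [hy]
        have h1 : ⁅x, y⁆ ∈ commutator G := Subgroup.commutator_mem_commutator (Subgroup.mem_top _) (Subgroup.mem_top _)
        rw [h0, Subgroup.mem_bot, commutatorElement_eq_one_iff_mul_comm] at h1
        rw [h.comm hx hy h1, pow_orderOf_eq_one]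
      have := hno _ hp ⊤ inferInstance (fun y => ⟨1, by
        apply Subtype.ext; simpa using hall y⟩)
      exact top_ne_bot this
    obtain ⟨p, hp, Q, hQn, hQp, hQ1⟩ := h.normal_descend (H := commutator G) inferInstance (hmin _ h1 h2)
    exact hQ1 (hno p hp Q hQn hQp)
  have hmem : ∀ p : ℕ, p.Prime → ∀ P : Sylow p G, ∀ x ∈ Subgroup.normalizer (P : Set G), x ^ p = 1 →
      x ∈ (P : Subgroup G) := by
    intro p hp P x hx hxp
    have := Fact.mk hp
    have hle : (P : Subgroup G) ≤ Subgroup.normalizer (P : Set G) := Subgroup.le_normalizer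
    have hi : p.Coprime ((P : Subgroup G).subgroupOf (Subgroup.normalizer (P : Set G))).index := by
      have h1 : ¬ p ∣ (P : Subgroup G).index := P.not_dvd_index
      rw [hp.coprime_iff_not_dvd]
      intro h2
      apply h1
      refine h2.trans ?_
      exact Subgroup.relIndex_dvd_index_of_le hle
    have := mem_of_normal_coprime (x := ⟨x, hx⟩) (Subgroup.normal_in_normalizer) hi (Subtype.ext hxp)
    exact this
  have hP1 : ∀ p : ℕ, p.Prime → p ∣ Nat.card G → ∀ P : Sylow p G, (P : Subgroup G) ≠ ⊥ := by
    intro p hp hd P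
    have := Fact.mk hp
    exact P.ne_bot_of_dvd_card hd
  have hidx : ∀ p : ℕ, p.Prime → p ∣ Nat.card G → ∀ P : Sylow p G, ∃ q : ℕ, q.Prime ∧ q ≠ p ∧
      Nat.card (Subgroup.normalizer (P : Set G)) = Nat.card P * q := by
    intro p hp hd P
    have := Fact.mk hp
    have hle : (P : Subgroup G) ≤ Subgroup.normalizer (P : Set G) := Subgroup.le_normalizer
    have hi : p.Coprime ((P : Subgroup G).subgroupOf (Subgroup.normalizer (P : Set G))).index := by
      have h1 : ¬ p ∣ (P : Subgroup G).index := P.not_dvd_index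
      rw [hp.coprime_iff_not_dvd]
      intro h2
      apply h1
      refine h2.trans ?_
      exact Subgroup.relIndex_dvd_index_of_le hle
    have hcard : Nat.card (Subgroup.normalizer (P : Set G)) = Nat.card P *
        ((P : Subgroup G).subgroupOf (Subgroup.normalizer (P : Set G))).index := by
      rw [← Subgroup.card_mul_index ((P : Subgroup G).subgroupOf (Subgroup.normalizer (P : Set G)))]
      congr 1
      exact Nat.card_congr (Subgroup.subgroupOfEquivOfLe hle).toEquiv
    rcases (h.sub (Subgroup.normalizer (P : Set G))).normal_index hp
      (P := (P : Subgroup G).subgroupOf (Subgroup.normalizer (P : Set G))) Subgroup.normal_in_normalizer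
      (P.2.of_equiv (Subgroup.subgroupOfEquivOfLe hle).symm)
      (by rw [Ne, Subgroup.subgroupOf_eq_bot]; intro h0; exact hP1 p hp hd P (by simpa [hle] using h0.eq_bot_of_le)) hi with h1 | h1
    · exfalso
      have hNP : Subgroup.normalizer (P : Set G) ≤ P := Subgroup.relIndex_eq_one.1 h1
      have hf := Subgroup.commutator_inf_eq_focalSubgroup P
      rw [hcomm, top_inf_eq] at hf
      have hle2 : (P : Subgroup G) ≤ (commutator P).map (P : Subgroup G).subtype := by
        refine hf.le.trans ?_
        rw [Subgroup.focalSubgroup_def, Subgroup.closure_le]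
        rintro g ⟨hgP, x, hx, u, rfl⟩
        by_cases hx1 : x = 1
        · simp [hx1]
        have hu : u ∈ (P : Subgroup G) := by
          apply hNP
          apply hti p hp P x⁻¹ (inv_mem hx) (by simpa using hx1)
          have := mul_mem (inv_mem hx) hgP
          simpa [commutatorElement_def, mul_assoc] using this
        exact ⟨⁅⟨x, hx⟩, ⟨u, hu⟩⁆, Subgroup.commutator_mem_commutator (Subgroup.mem_top _) (Subgroup.mem_top _), rfl⟩
      have hnil : Group.IsNilpotent P := P.2.isNilpotent
      have hntP : Nontrivial P := (Subgroup.nontrivial_iff_ne_bot _).2 (hP1 p hp hd P)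
      have hsol : Group.IsSolvable P := inferInstance
      have hlt := Group.IsSolvable.commutator_lt_top_of_nontrivial P
      apply hlt.ne
      rw [eq_top_iff]
      rintro ⟨x, hx⟩ -
      obtain ⟨y, hy, hyx⟩ := hle2 hx
      have : y = ⟨x, hx⟩ := Subtype.ext hyx
      exact this ▸ hy
    · refine ⟨_, h1, ?_, hcard⟩
      intro h0
      rw [h0] at hi
      exact hp.one_lt.ne' (by simpa using hi)
  choose! Q hQ using fun p (hp : p.Prime) => (⟨default, trivial⟩ : ∃ P : Sylow p G, True)
  choose! q hq using hidx
  refine ⟨⟨h, hodd, inferInstance, (Nat.card G).primeFactors, inferInstance, fun i => (Q i : Subgroup G), fun i => i,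
    fun i => q i (Q i), ?_, ?_, ?_, ?_, ?_, ?_, ?_, ?_, ?_, ?_⟩⟩
  · exact fun i => Nat.prime_of_mem_primeFactors i.2
  · exact fun i => (hq i (Nat.prime_of_mem_primeFactors i.2) (Nat.dvd_of_mem_primeFactors i.2) _).1
  · exact fun i => (hq i (Nat.prime_of_mem_primeFactors i.2) (Nat.dvd_of_mem_primeFactors i.2) _).2.1
  · exact Subtype.val_injective
  · exact fun i => (Q i).2
  · exact fun i => hP1 i (Nat.prime_of_mem_primeFactors i.2) (Nat.dvd_of_mem_primeFactors i.2) _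
  · exact fun i => hti i (Nat.prime_of_mem_primeFactors i.2) _
  · intro x hx
    have hp := h x hx
    have := Fact.mk hp
    refine ⟨⟨orderOf x, Nat.mem_primeFactors.2 ⟨hp, orderOf_dvd_natCard x, Nat.card_pos.ne'⟩⟩, ?_⟩
    have hz : IsPGroup (orderOf x) (Subgroup.zpowers x) := IsPGroup.of_card (n := 1) (by rw [Nat.card_zpowers, pow_one])
    obtain ⟨S, hS⟩ := hz.exists_le_sylow
    obtain ⟨g, hg⟩ := MulAction.exists_smul_eq G S (Q (orderOf x))
    refine ⟨g, ?_⟩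
    show g * x * g⁻¹ ∈ (Q (orderOf x) : Subgroup G)
    rw [← hg, Sylow.coe_subgroup_smul, Subgroup.mem_pointwise_smul_iff_inv_smul_mem]
    have := hS (Subgroup.mem_zpowers x)
    simpa [MulAut.smul_def, mul_assoc] using this
  · exact fun i => (hq i (Nat.prime_of_mem_primeFactors i.2) (Nat.dvd_of_mem_primeFactors i.2) _).2.2
  · intro i x hx hxP
    have hip := (Nat.prime_of_mem_primeFactors i.2)
    obtain ⟨h1, h2, h3⟩ := hq i hip (Nat.dvd_of_mem_primeFactors i.2) (Q i)
    have hx1 : x ≠ 1 := fun h0 => hxP (h0 ▸ one_mem _)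
    have hs := h x hx1
    have hd : orderOf x ∣ Nat.card (Subgroup.normalizer (Q i : Set G)) := by
      have := orderOf_dvd_natCard (⟨x, hx⟩ : Subgroup.normalizer (Q i : Set G))
      rwa [← Subgroup.orderOf_coe] at this
    rw [h3, hs.dvd_mul] at hd
    rcases hd with hd | hd
    · exfalso
      have := Fact.mk hip
      obtain ⟨n, hn⟩ := (Q i).2.exists_card_eq
      have hn' : Nat.card (Q i) = i ^ n := hn
      rw [hn'] at hd
      have h4 := (Nat.prime_dvd_prime_iff_eq hs hip).1 (hs.dvd_of_dvd_pow hd)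
      exact hxP (hmem i hip (Q i) x hx (by rw [← h4, pow_orderOf_eq_one]))
    · exact (Nat.prime_dvd_prime_iff_eq hs h1).1 hd

end C
end EPOA5

namespace EPOA5
open scoped Classical BigOperators
section D

lemma cut {T : Type*} [Fintype T] (m : T → ℤ) (s : ℤ) (k : ℤ) (A B : Finset T) (hA : k ≤ A.card) (hB : k ≤ B.card)
    (hAs : ∀ t ∈ A, s ≤ m t) (hBs : ∀ t ∈ B, m t < s) :
    k * (Fintype.card T - k) ≤ Fintype.card T * ∑ t, m t ^ 2 - (∑ t, m t) ^ 2 := by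
  set U := Finset.univ.filter (fun t => s ≤ m t) with hU
  set W := Finset.univ.filter (fun t => ¬ s ≤ m t) with hW
  have hUW : U.card + W.card = Fintype.card T := Finset.card_filter_add_card_filter_not _
  have hAU : A.card ≤ U.card := Finset.card_le_card fun t ht => by simp [hU, hAs t ht]
  have hBW : B.card ≤ W.card := Finset.card_le_card fun t ht => by simpa [hW] using hBs t ht
  have h1 : ∑ t, ∑ u, (m t - m u) ^ 2 = 2 * (Fintype.card T * ∑ t, m t ^ 2 - (∑ t, m t) ^ 2) := by
    have : ∀ t u, (m t - m u) ^ 2 = m t ^ 2 + m u ^ 2 - 2 * (m t * m u) := fun t u => by ring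
    simp only [this, Finset.sum_sub_distrib, Finset.sum_add_distrib, ← Finset.mul_sum, Finset.sum_const,
      Finset.card_univ, nsmul_eq_mul, ← Finset.sum_mul]
    ring
  have h2 : ∑ t, ∑ u, (if (s ≤ m t ↔ ¬ s ≤ m u) then (1 : ℤ) else 0) ≤ ∑ t, ∑ u, (m t - m u) ^ 2 := by
    refine Finset.sum_le_sum fun t _ => Finset.sum_le_sum fun u _ => ?_
    split_ifs with h
    · have hne : m t - m u ≠ 0 := by
        intro h0
        have : m t = m u := by omega
        rw [this] at h
        tauto
      have := sq_pos_of_ne_zero hne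
      omega
    · positivity
  have h3 : ∑ t, ∑ u, (if (s ≤ m t ↔ ¬ s ≤ m u) then (1 : ℤ) else 0) = 2 * (U.card * W.card) := by
    have : ∀ t, ∑ u, (if (s ≤ m t ↔ ¬ s ≤ m u) then (1 : ℤ) else 0) = if s ≤ m t then (W.card : ℤ) else U.card := by
      intro t
      by_cases h : s ≤ m t
      · simp only [h, true_iff, if_true, hW, Finset.sum_boole]
      · simp only [h, false_iff, if_false, hU, Finset.sum_boole, not_not]
    simp only [this, Finset.sum_ite, Finset.sum_const, nsmul_eq_mul]
    rw [← hU, ← hW]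
    ring
  have h4 : (U.card : ℤ) + W.card = Fintype.card T := by exact_mod_cast hUW
  have h5 : k ≤ U.card := hA.trans (by exact_mod_cast hAU)
  have h6 : k ≤ W.card := hB.trans (by exact_mod_cast hBW)
  nlinarith

variable {H : Type} [Group H]

instance lin_finite [Finite H] : Finite (H →* ℂˣ) := by
  have h1 : Nat.card (Abelianization H →* ℂˣ) = Nat.card (Abelianization H) :=
    CommGroup.card_monoidHom_of_hasEnoughRootsOfUnity (Abelianization H) ℂ
  have h2 : Finite (Abelianization H →* ℂˣ) := Nat.finite_of_card_ne_zero (by rw [h1]; exact Nat.card_pos.ne')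
  exact Finite.of_equiv _ (Abelianization.lift (G := H) (A := ℂˣ)).symm

noncomputable instance linFt [Finite H] : Fintype (H →* ℂˣ) := Fintype.ofFinite _

lemma lin_card [Finite H] [Nontrivial H] {p : ℕ} (hp : p.Prime) (hH : IsPGroup p H) :
    ∃ k, 0 < k ∧ Fintype.card (H →* ℂˣ) = p ^ k := by
  have := Fact.mk hp
  have h1 : Nat.card (Abelianization H →* ℂˣ) = Nat.card (Abelianization H) :=
    CommGroup.card_monoidHom_of_hasEnoughRootsOfUnity (Abelianization H) ℂ
  rw [← Nat.card_eq_fintype_card, Nat.card_congr (Abelianization.lift (G := H) (A := ℂˣ)), h1]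
  have h2 : IsPGroup p (Abelianization H) := hH.of_surjective (Abelianization.of) (QuotientGroup.mk_surjective)
  obtain ⟨k, hk⟩ := h2.exists_card_eq
  refine ⟨k, ?_, hk⟩
  rw [Nat.pos_iff_ne_zero]
  rintro rfl
  have hnil : Group.IsNilpotent H := hH.isNilpotent
  have hsol : Group.IsSolvable H := inferInstance
  have hlt := Group.IsSolvable.commutator_lt_top_of_nontrivial H
  apply hlt.ne
  rw [← Subgroup.index_eq_one]
  exact hk

lemma lin_inj : Function.Injective (lin : (H →* ℂˣ) → H → ℂ) := by
  intro a b h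
  ext x
  exact congrFun h x

variable [Fintype H]

lemma lin_ip (a b : H →* ℂˣ) : ip (lin a) (lin b) = if a = b then 1 else 0 := by
  rw [irr_ip (lin_isIrr a) (lin_isIrr b)]
  simp [lin_inj.eq_iff]

lemma modp {p : ℕ} (hp : p.Prime) (hH : IsPGroup p H) {f : H → ℂ} (hf : f ∈ VG H) :
    ∃ n : ℤ, f 1 = ((∑ ψ : H →* ℂˣ, ipZ f (lin ψ) + p * n : ℤ) : ℂ) := by
  suffices h : ∃ n : ℤ, f 1 = ∑ ψ : H →* ℂˣ, ip f (lin ψ) + (p * n : ℤ) by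
    obtain ⟨n, hn⟩ := h
    refine ⟨n, ?_⟩
    rw [hn]
    push_cast
    congr 1
    exact Finset.sum_congr rfl fun ψ _ => ipZ_spec hf (lin_isIrr ψ).vg
  induction hf using AddSubgroup.closure_induction with
  | mem f hf =>
    rcases pgroup_irr hp hH hf with ⟨l, rfl⟩ | ⟨n, hn⟩
    · refine ⟨0, ?_⟩
      simp [lin_ip, lin]
    · by_cases hl : ∃ l : H →* ℂˣ, f = lin l
      · obtain ⟨l, rfl⟩ := hl
        refine ⟨0, ?_⟩
        simp [lin_ip, lin]
      · refine ⟨n, ?_⟩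
        rw [Finset.sum_eq_zero]
        · rw [hn]; push_cast; ring
        · intro ψ _
          rw [irr_ip hf (lin_isIrr ψ), if_neg]
          exact fun h => hl ⟨ψ, h⟩
  | zero => exact ⟨0, by simp [ip_zero_left]⟩
  | add f g _ _ hf hg =>
    obtain ⟨n, hn⟩ := hf
    obtain ⟨m, hm⟩ := hg
    refine ⟨n + m, ?_⟩
    simp only [Pi.add_apply, ip_add_left, Finset.sum_add_distrib, hn, hm]
    push_cast; ring
  | neg f _ hf =>
    obtain ⟨n, hn⟩ := hf
    refine ⟨-n, ?_⟩
    simp only [Pi.neg_apply, ip_neg_left, Finset.sum_neg_distrib, hn]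
    push_cast; ring

/-- the off-identity norm -/
noncomputable def loc (f : H → ℂ) : ℝ := (Nat.card H : ℝ)⁻¹ * (∑ x, ‖f x‖ ^ 2 - ‖f 1‖ ^ 2)

lemma testfn {f : H → ℂ} (hf : f ∈ VG H) :
    (∑ ψ : H →* ℂˣ, (ipZ f (lin ψ) : ℝ) ^ 2) - (∑ ψ : H →* ℂˣ, (ipZ f (lin ψ) : ℝ)) ^ 2 / Fintype.card (H →* ℂˣ)
      ≤ loc f := by
  set L : ℝ := ((Fintype.card (H →* ℂˣ) : ℕ) : ℝ) with hL
  have hL0 : L ≠ 0 := by rw [hL]; exact_mod_cast Fintype.card_ne_zero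
  set M : ℝ := ∑ ψ : H →* ℂˣ, (ipZ f (lin ψ) : ℝ) with hM
  set c : (H →* ℂˣ) → ℝ := fun ψ => ipZ f (lin ψ) - M / L with hc
  set v : ℝ := (∑ ψ : H →* ℂˣ, (ipZ f (lin ψ) : ℝ) ^ 2) - M ^ 2 / L with hv
  have hcsum : ∑ ψ, c ψ = 0 := by
    simp only [hc, Finset.sum_sub_distrib, Finset.sum_const, Finset.card_univ, nsmul_eq_mul]
    rw [← hM, ← hL]; field_simp; ring
  have hcm : ∑ ψ, c ψ * ipZ f (lin ψ) = v := by
    simp only [hc, sub_mul, Finset.sum_sub_distrib, ← Finset.mul_sum]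
    rw [← hM, hv]
    congr 1
    · exact Finset.sum_congr rfl fun ψ _ => by ring
    · ring
  have hcc : ∑ ψ, c ψ * c ψ = v := by
    rw [← hcm]
    have : ∀ ψ, c ψ * c ψ = c ψ * ipZ f (lin ψ) - c ψ * (M / L) := fun ψ => by simp only [hc]; ring
    simp only [this, Finset.sum_sub_distrib, ← Finset.sum_mul, hcsum]
    ring
  set β : H → ℂ := ∑ ψ, (c ψ : ℂ) • lin ψ with hβ
  have hβs : ∀ x, starRingEnd ℂ (β x) = β x⁻¹ := by
    intro x
    simp only [hβ, Finset.sum_apply, Pi.smul_apply, smul_eq_mul, map_sum, map_mul, lin_conj, Complex.conj_ofReal]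
  have hβ1 : β 1 = 0 := by
    simp only [hβ, Finset.sum_apply, Pi.smul_apply, smul_eq_mul, lin, map_one, Units.val_one, mul_one]
    exact_mod_cast hcsum
  have e1 : ip f β = v := by
    rw [hβ, ip_sum_right, ← hcm]
    push_cast
    exact Finset.sum_congr rfl fun ψ _ => by rw [ip_smul_right, ipZ_spec hf (lin_isIrr ψ).vg]
  have e2 : ip β β = v := by
    conv_lhs => rw [hβ]
    rw [ip_sum_right, ← hcc]
    push_cast
    refine Finset.sum_congr rfl fun ψ _ => ?_
    rw [ip_smul_right, ip_sum_left]
    simp only [ip_smul_left, lin_ip]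
    simp
  have e3 : ip (f - β) (f - β) = (((Nat.card H : ℝ)⁻¹ * ∑ x, ‖f x - β x‖ ^ 2 : ℝ) : ℂ) := by
    unfold ip
    push_cast
    congr 1
    refine Finset.sum_congr rfl fun x _ => ?_
    have : (f - β) x⁻¹ = starRingEnd ℂ (f x - β x) := by
      rw [map_sub, vg_star hf, hβs]; rfl
    rw [this, Pi.sub_apply, Complex.mul_conj, Complex.normSq_eq_norm_sq]
    push_cast; rfl
  have e4 : ip (f - β) (f - β) = ip f f - v := by
    rw [ip_sub_left, ip_sub_right, ip_sub_right, ip_comm β f, e1, e2]; ring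
  rw [e3, vg_norm hf] at e4
  have e5 : (Nat.card H : ℝ)⁻¹ * ∑ x, ‖f x - β x‖ ^ 2 = (Nat.card H : ℝ)⁻¹ * ∑ x, ‖f x‖ ^ 2 - v := by
    exact_mod_cast e4
  have e6 : ‖f 1‖ ^ 2 ≤ ∑ x, ‖f x - β x‖ ^ 2 := by
    have := Finset.single_le_sum (f := fun x => ‖f x - β x‖ ^ 2) (fun x _ => by positivity) (Finset.mem_univ (1 : H))
    simpa [hβ1] using this
  unfold loc
  have e7 : (Nat.card H : ℝ)⁻¹ * ‖f 1‖ ^ 2 ≤ (Nat.card H : ℝ)⁻¹ * ∑ x, ‖f x - β x‖ ^ 2 :=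
    mul_le_mul_of_nonneg_left e6 (by positivity)
  rw [mul_sub]
  linarith

lemma loc_cut {f : H → ℂ} (hf : f ∈ VG H) (s k : ℤ) (A B : Finset (H →* ℂˣ)) (hA : k ≤ A.card) (hB : k ≤ B.card)
    (hAs : ∀ t ∈ A, s ≤ ipZ f (lin t)) (hBs : ∀ t ∈ B, ipZ f (lin t) < s) :
    (k : ℝ) * (Fintype.card (H →* ℂˣ) - k) / Fintype.card (H →* ℂˣ) ≤ loc f := by
  refine le_trans ?_ (testfn hf)
  have h1 := cut (fun t => ipZ f (lin t)) s k A B hA hB hAs hBs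
  have h2 : (k : ℝ) * (Fintype.card (H →* ℂˣ) - k) ≤ Fintype.card (H →* ℂˣ) * ∑ t : H →* ℂˣ, (ipZ f (lin t) : ℝ) ^ 2
    - (∑ t : H →* ℂˣ, (ipZ f (lin t) : ℝ)) ^ 2 := by exact_mod_cast h1
  have hL0 : (0 : ℝ) < Fintype.card (H →* ℂˣ) := by exact_mod_cast Fintype.card_pos
  rw [div_le_iff₀ hL0, sub_mul, div_mul_cancel₀ _ hL0.ne']
  linarith

end D
end EPOA5

namespace EPOA5
open scoped Classical BigOperators
section D
variable {H : Type} [Group H] [Fintype H]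

lemma loc_eq (f : H → ℂ) : loc f = (Nat.card H : ℝ)⁻¹ * ∑ x ∈ Finset.univ.filter (fun x : H => x ≠ 1), ‖f x‖ ^ 2 := by
  unfold loc
  congr 1
  rw [Finset.filter_ne' Finset.univ (1 : H)]
  rw [← Finset.add_sum_erase Finset.univ (fun x => ‖f x‖ ^ 2) (Finset.mem_univ (1 : H))]
  ring

lemma loc_in_dvd {f : H → ℂ} (hf : f ∈ VG H) (a b : ℤ) (ha : ipZ f (lin (1 : H →* ℂˣ)) = a)
    (hb : ∀ ψ : H →* ℂˣ, ψ ≠ 1 → ipZ f (lin ψ) = b) (hc : 3 ≤ |a - b|) (hL : 3 ≤ Fintype.card (H →* ℂˣ)) :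
    1 ≤ loc f := by
  refine le_trans ?_ (testfn hf)
  have h1 : ∀ ψ : H →* ℂˣ, (ipZ f (lin ψ) : ℝ) = b + (if ψ = 1 then ((a - b : ℤ) : ℝ) else 0) := by
    intro ψ
    split_ifs with h
    · subst h; rw [ha]; push_cast; ring
    · rw [hb ψ h]; ring
  have h2 : ∑ ψ : H →* ℂˣ, (ipZ f (lin ψ) : ℝ) = Fintype.card (H →* ℂˣ) * b + ((a - b : ℤ) : ℝ) := by
    simp only [h1, Finset.sum_add_distrib, Finset.sum_ite_eq', Finset.mem_univ, if_true, Finset.sum_const,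
      Finset.card_univ, nsmul_eq_mul]
  have h3 : ∑ ψ : H →* ℂˣ, (ipZ f (lin ψ) : ℝ) ^ 2 = Fintype.card (H →* ℂˣ) * b ^ 2 + 2 * b * ((a - b : ℤ) : ℝ) + ((a - b : ℤ) : ℝ) ^ 2 := by
    have : ∀ ψ : H →* ℂˣ, (ipZ f (lin ψ) : ℝ) ^ 2 = b ^ 2 + (if ψ = 1 then (2 * b * ((a - b : ℤ) : ℝ) + ((a - b : ℤ) : ℝ) ^ 2) else 0) := by
      intro ψ
      rw [h1]; split_ifs <;> ring
    simp only [this, Finset.sum_add_distrib, Finset.sum_ite_eq', Finset.mem_univ, if_true, Finset.sum_const,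
      Finset.card_univ, nsmul_eq_mul]
    ring
  rw [h2, h3]
  have hc2 : (9 : ℝ) ≤ ((a - b : ℤ) : ℝ) ^ 2 := by
    have : (9 : ℤ) ≤ (a - b) ^ 2 := by rw [← sq_abs]; nlinarith
    exact_mod_cast this
  set c : ℝ := ((a - b : ℤ) : ℝ)
  set L : ℝ := ((Fintype.card (H →* ℂˣ) : ℕ) : ℝ) with hLd
  have hL3 : 3 ≤ L := by rw [hLd]; exact_mod_cast hL
  have : L * b ^ 2 + 2 * b * c + c ^ 2 - (L * b + c) ^ 2 / L = c ^ 2 * (1 - 1 / L) := by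
    field_simp; ring
  rw [this]
  have h5 : 1 / L ≤ 1 / 3 := one_div_le_one_div_of_le (by norm_num) hL3
  nlinarith

lemma loc_in_cop {p : ℕ} (hp : p.Prime) (hH : ∀ x : H, x ^ p = 1) {f : H → ℂ} (hf : f ∈ VG H) {d : ℤ}
    (hd : f 1 = d) (hpd : ¬ (p : ℤ) ∣ d) : 1 - (Nat.card H : ℝ)⁻¹ ≤ loc f := by
  have := Fact.mk hp
  have hord : ∀ x : H, x ≠ 1 → orderOf x = p := fun x hx => orderOf_eq_prime (hH x) hx
  have hcz : ∀ x : H, x ≠ 1 → Nat.card (Subgroup.zpowers x) = p := fun x hx => by rw [Nat.card_zpowers, hord x hx]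
  have hmem : ∀ x z : H, x ≠ 1 → z ≠ 1 → z ∈ Subgroup.zpowers x → x ∈ Subgroup.zpowers z := by
    intro x z hx hz h
    have h1 : Subgroup.zpowers z ≤ Subgroup.zpowers x := by rwa [Subgroup.zpowers_le]
    have h2 := Subgroup.eq_of_le_of_card_ge h1 (by rw [hcz x hx, hcz z hz])
    rw [h2]; exact Subgroup.mem_zpowers x
  have hloc : ∀ x : H, x ≠ 1 → (p : ℝ) - 1 ≤ ∑ z ∈ Finset.univ.filter (fun z : H => z ≠ 1 ∧ z ∈ Subgroup.zpowers x), ‖f z‖ ^ 2 := by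
    intro x hx
    set Z := Subgroup.zpowers x with hZ
    have hZp : IsPGroup p Z := IsPGroup.of_card (n := 1) (by rw [hcz x hx, pow_one])
    have hg := vg_res hf Z
    have hnt : Nontrivial Z := (Subgroup.nontrivial_iff_ne_bot _).2 (by simpa [hZ] using hx)
    obtain ⟨k, hk0, hk⟩ := lin_card hp hZp
    obtain ⟨n, hn⟩ := modp hp hZp hg
    simp only [Subgroup.coe_one, hd] at hn
    have hn' : d = ∑ ψ : Z →* ℂˣ, ipZ (fun x : Z => f x) (lin ψ) + p * n := by exact_mod_cast hn
    obtain ⟨a, b, hab⟩ : ∃ a b : Z →* ℂˣ, ipZ (fun x : Z => f x) (lin a) < ipZ (fun x : Z => f x) (lin b) := by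
      by_contra hcon
      push Not at hcon
      apply hpd
      have : ∀ ψ : Z →* ℂˣ, ipZ (fun x : Z => f x) (lin ψ) = ipZ (fun x : Z => f x) (lin 1) :=
        fun ψ => le_antisymm (hcon _ _) (hcon _ _)
      rw [hn', Finset.sum_congr rfl fun ψ _ => this ψ, Finset.sum_const, Finset.card_univ, hk, nsmul_eq_mul]
      refine dvd_add (Dvd.dvd.mul_right ?_ _) (dvd_mul_right _ _)
      push_cast
      exact dvd_pow_self _ hk0.ne'
    have h1 := loc_cut hg (ipZ (fun x : Z => f x) (lin b)) 1 {b} {a} (by simp) (by simp) (by simp) (by simpa using hab)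
    have hpL : (p : ℝ) ≤ Fintype.card (Z →* ℂˣ) := by
      rw [hk]; exact_mod_cast Nat.le_self_pow hk0.ne' p
    have hp0 : (0 : ℝ) < p := by exact_mod_cast hp.pos
    rw [loc_eq, hcz x hx] at h1
    have h2 : 1 - 1 / (p : ℝ) ≤ ((1 : ℤ) : ℝ) * (Fintype.card (Z →* ℂˣ) - ((1 : ℤ) : ℝ)) / Fintype.card (Z →* ℂˣ) := by
      have hL : (0 : ℝ) < Fintype.card (Z →* ℂˣ) := lt_of_lt_of_le hp0 hpL
      have := one_div_le_one_div_of_le hp0 hpL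
      have e : ((1 : ℤ) : ℝ) * (Fintype.card (Z →* ℂˣ) - ((1 : ℤ) : ℝ)) / Fintype.card (Z →* ℂˣ) = 1 - 1 / Fintype.card (Z →* ℂˣ) := by
        push_cast; field_simp
      rw [e]; linarith
    have h3 : ∑ z ∈ Finset.univ.filter (fun z : H => z ≠ 1 ∧ z ∈ Z), ‖f z‖ ^ 2 =
        ∑ z ∈ Finset.univ.filter (fun z : Z => z ≠ 1), ‖f z‖ ^ 2 := by
      symm
      refine Finset.sum_bij (fun z _ => (z : H)) ?_ ?_ ?_ ?_
      · intro z hz; simpa using hz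
      · intro a _ b _ h; exact Subtype.ext h
      · intro z hz; simp at hz; exact ⟨⟨z, hz.2⟩, by simpa using hz.1, rfl⟩
      · intro z _; rfl
    rw [h3]
    have h4 := h2.trans h1
    have h5 := mul_le_mul_of_nonneg_left h4 hp0.le
    rw [← mul_assoc, mul_inv_cancel₀ hp0.ne', one_mul] at h5
    have : (p : ℝ) * (1 - 1 / p) = p - 1 := by field_simp
    rw [this] at h5
    refine h5.trans (le_of_eq ?_)
    congr
  rcases subsingleton_or_nontrivial H with hs | hnt
  · have : Nat.card H = 1 := Nat.card_of_subsingleton 1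
    rw [loc_eq, this]; simp
    positivity
  set S := Finset.univ.filter (fun x : H => x ≠ 1) with hS
  have h1 : ∑ x ∈ S, ((p : ℝ) - 1) ≤ ∑ x ∈ S, ∑ z ∈ Finset.univ.filter (fun z : H => z ≠ 1 ∧ z ∈ Subgroup.zpowers x), ‖f z‖ ^ 2 :=
    Finset.sum_le_sum fun x hx => hloc x (by simpa [hS] using hx)
  have h2 : ∑ x ∈ S, ∑ z ∈ Finset.univ.filter (fun z : H => z ≠ 1 ∧ z ∈ Subgroup.zpowers x), ‖f z‖ ^ 2 =
      ∑ z ∈ S, ((p : ℝ) - 1) * ‖f z‖ ^ 2 := by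
    rw [Finset.sum_comm' (t' := S) (s' := fun z => (Finset.univ.filter (fun x : H => x ∈ Subgroup.zpowers z)).erase 1)]
    · refine Finset.sum_congr rfl fun z hz => ?_
      have hz1 : z ≠ 1 := by simpa [hS] using hz
      rw [Finset.sum_const, Finset.card_erase_of_mem (by simp [one_mem]), nsmul_eq_mul]
      have : (Finset.univ.filter (fun x : H => x ∈ Subgroup.zpowers z)).card = p := by
        rw [← hcz z hz1, Nat.card_eq_fintype_card, Fintype.card_subtype]
      rw [this, Nat.cast_sub hp.one_le]; simp
    · intro x z
      simp only [hS, Finset.mem_filter, Finset.mem_univ, true_and, Finset.mem_erase]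
      constructor
      · rintro ⟨a, b, c⟩; exact ⟨⟨a, hmem x z a b c⟩, b⟩
      · rintro ⟨⟨a, b⟩, c⟩; exact ⟨a, c, hmem z x c a b⟩
  rw [h2, ← Finset.mul_sum, Finset.sum_const, nsmul_eq_mul, mul_comm] at h1
  have hp1 : (0 : ℝ) < p - 1 := by
    have : (1 : ℝ) < p := by exact_mod_cast hp.one_lt
    linarith
  have h3 := le_of_mul_le_mul_left h1 hp1
  have hSc : (S.card : ℝ) = Nat.card H - 1 := by
    rw [hS, Finset.filter_ne' Finset.univ (1 : H), Finset.card_erase_of_mem (Finset.mem_univ _), Finset.card_univ,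
      Nat.card_eq_fintype_card, Nat.cast_sub Fintype.card_pos]; simp
  rw [hSc] at h3
  have hH0 : (0 : ℝ) < Nat.card H := by exact_mod_cast Nat.card_pos
  rw [loc_eq]
  have h4 := mul_le_mul_of_nonneg_left h3 (inv_nonneg.2 hH0.le)
  rw [mul_sub, inv_mul_cancel₀ hH0.ne', mul_one] at h4
  exact h4

end D
end EPOA5

namespace EPOA5
open scoped Classical BigOperators
section D
variable {G : Type} [Group G]

namespace Cfg
variable (c : Cfg G)

instance : Fintype c.ι := c.ft

abbrev N (i : c.ι) : Subgroup G := Subgroup.normalizer (c.P i : Set G)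

lemma ord {i : c.ι} {x : G} (hx : x ∈ c.P i) (h1 : x ≠ 1) : orderOf x = c.p i := c.epo.order_p (c.hp i) (c.hP i) hx h1

lemma fuse {i j : c.ι} {x : G} (h1 : x ≠ 1) {g k : G} (hg : g * x * g⁻¹ ∈ c.P i) (hk : k * x * k⁻¹ ∈ c.P j) : i = j := by
  apply c.pinj
  have e : ∀ g : G, orderOf (g * x * g⁻¹) = orderOf x := fun g => by
    have := orderOf_injective (MulAut.conj g).toMonoidHom (MulAut.conj g).injective x
    simpa using this
  have ne : ∀ g : G, g * x * g⁻¹ ≠ 1 := fun g h => h1 (by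
    have : x = g⁻¹ * (g * x * g⁻¹) * g := by group
    rw [this, h]; group)
  rw [← c.ord hg (ne g), ← c.ord hk (ne k), e, e]

lemma conj_mem_of_N {i : c.ι} {n x : G} (hn : n ∈ c.N i) (hx : x ∈ c.P i) : n * x * n⁻¹ ∈ c.P i :=
  (Subgroup.mem_normalizer_iff.1 hn x).1 hx

/-- conjugated linear character -/
noncomputable def cj {i : c.ι} (l : c.P i →* ℂˣ) (n : c.N i) : c.P i →* ℂˣ :=
  l.comp ((c.P i).normalizerMonoidHom n).toMonoidHom

lemma cj_apply {i : c.ι} (l : c.P i →* ℂˣ) (n : c.N i) (x : c.P i) :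
    c.cj l n x = l ⟨n * x * (n : G)⁻¹, c.conj_mem_of_N n.2 x.2⟩ := by
  rw [cj, MonoidHom.comp_apply]
  congr 1

lemma cj_cj {i : c.ι} (l : c.P i →* ℂˣ) (n m : c.N i) : c.cj (c.cj l n) m = c.cj l (n * m) := by
  ext x
  simp [cj]

lemma cj_one {i : c.ι} (l : c.P i →* ℂˣ) : c.cj l 1 = l := by
  ext x
  simp [cj]

lemma one_cj {i : c.ι} (n : c.N i) : c.cj 1 n = 1 := by
  ext x
  simp [cj]

lemma inv_cj {i : c.ι} (l : c.P i →* ℂˣ) (n : c.N i) : c.cj l⁻¹ n = (c.cj l n)⁻¹ := by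
  ext x
  simp [cj]

variable [Fintype G]

lemma count {i : c.ι} {y : G} (hy : y ≠ 1) {g0 : G} (h0 : g0 * y * g0⁻¹ ∈ c.P i) :
    (Finset.univ.filter (fun g : G => g * y * g⁻¹ ∈ c.P i)).card = Nat.card (c.N i) := by
  rw [Nat.card_eq_fintype_card, ← Finset.card_univ]
  symm
  refine Finset.card_bij (fun n _ => (n : G) * g0) ?_ ?_ ?_
  · intro n _
    simp only [Finset.mem_filter, Finset.mem_univ, true_and]
    have := c.conj_mem_of_N n.2 h0
    simpa [mul_assoc] using this
  · intro a _ b _ h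
    exact Subtype.ext (mul_right_cancel h)
  · intro g hg
    simp only [Finset.mem_filter, Finset.mem_univ, true_and] at hg
    have hn : g * g0⁻¹ ∈ c.N i := by
      apply c.ti i (g0 * y * g0⁻¹) h0
      · intro h; apply hy
        have : y = g0⁻¹ * (g0 * y * g0⁻¹) * g0 := by group
        rw [this, h]; group
      · have : g * g0⁻¹ * (g0 * y * g0⁻¹) * (g * g0⁻¹)⁻¹ = g * y * g⁻¹ := by group
        rwa [this]
    exact ⟨⟨_, hn⟩, Finset.mem_univ _, by simp⟩

lemma cardN_pos (i : c.ι) : (0 : ℝ) < Nat.card (c.N i) := by exact_mod_cast Nat.card_pos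

lemma class_sum (F : G → ℂ) (hF : ∀ x y, F (y * x * y⁻¹) = F x) :
    ∑ x, F x = F 1 + ∑ i, (Nat.card G : ℂ) / Nat.card (c.N i) * (∑ x : c.P i, F x - F 1) := by
  have hN0 : ∀ i, (Nat.card (c.N i) : ℂ) ≠ 0 := fun i => by exact_mod_cast Nat.card_pos.ne'
  have h1 : ∀ y : G, y ≠ 1 → ∑ i, (Nat.card (c.N i) : ℂ)⁻¹ * ∑ g : G, (if g * y * g⁻¹ ∈ c.P i then F y else 0) = F y := by
    intro y hy
    obtain ⟨i, g0, h0⟩ := c.cover y hy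
    rw [Finset.sum_eq_single i]
    · rw [← Finset.sum_filter, Finset.sum_const, c.count hy h0, nsmul_eq_mul, ← mul_assoc, inv_mul_cancel₀ (hN0 i), one_mul]
    · intro j _ hj
      rw [Finset.sum_eq_zero, mul_zero]
      intro g _
      rw [if_neg]
      exact fun h => hj (c.fuse hy h h0)
    · simp
  rw [← Finset.add_sum_erase Finset.univ F (Finset.mem_univ (1 : G))]
  congr 1
  rw [← Finset.sum_congr rfl fun y hy => h1 y (Finset.ne_of_mem_erase hy), Finset.sum_comm]
  refine Finset.sum_congr rfl fun i _ => ?_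
  rw [← Finset.mul_sum, Finset.sum_comm, div_eq_inv_mul, mul_assoc]
  congr 1
  have h2 : ∀ g : G, ∑ y ∈ Finset.univ.erase 1, (if g * y * g⁻¹ ∈ c.P i then F y else 0) = ∑ x : c.P i, F x - F 1 := by
    intro g
    have e1 : ∑ y : G, (if g * y * g⁻¹ ∈ c.P i then F y else 0) = ∑ x : c.P i, F x := by
      rw [← Finset.sum_filter]
      symm
      refine Finset.sum_bij (fun x _ => g⁻¹ * (x : G) * g) ?_ ?_ ?_ ?_
      · intro x _
        have : g * (g⁻¹ * (x : G) * g) * g⁻¹ = x := by group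
        simp [this]
      · intro a _ b _ h
        exact Subtype.ext (mul_left_cancel (mul_right_cancel h))
      · intro y hy
        simp only [Finset.mem_filter, Finset.mem_univ, true_and] at hy
        exact ⟨⟨_, hy⟩, Finset.mem_univ _, by simp only; group⟩
      · intro x _
        have := hF x g⁻¹
        rw [inv_inv] at this
        exact this.symm
    rw [← e1, ← Finset.add_sum_erase Finset.univ _ (Finset.mem_univ (1 : G))]
    simp [one_mem]
  rw [Finset.sum_congr rfl fun g _ => h2 g, Finset.sum_const, Finset.card_univ, nsmul_eq_mul, Nat.card_eq_fintype_card]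

lemma norm_formula {f : G → ℂ} (hf : f ∈ VG G) :
    (ipZ f f : ℝ) = ‖f 1‖ ^ 2 / Nat.card G + ∑ i, loc (fun x : c.P i => f x) / c.q i := by
  have h1 := c.class_sum (fun x => ((‖f x‖ ^ 2 : ℝ) : ℂ)) (fun x y => by rw [vg_conj_class hf])
  rw [vg_normZ hf]
  have h2 : ∑ x, ‖f x‖ ^ 2 = ‖f 1‖ ^ 2 + ∑ i, (Nat.card G : ℝ) / Nat.card (c.N i) * (∑ x : c.P i, ‖f x‖ ^ 2 - ‖f 1‖ ^ 2) := by
    apply Complex.ofReal_injective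
    push_cast at h1 ⊢
    exact h1
  rw [h2, mul_add, Finset.mul_sum]
  have hG0 : (Nat.card G : ℝ) ≠ 0 := by exact_mod_cast Nat.card_pos.ne'
  congr 1
  · rw [div_eq_inv_mul]
  · refine Finset.sum_congr rfl fun i _ => ?_
    have hq0 : (c.q i : ℝ) ≠ 0 := by exact_mod_cast (c.hq i).ne_zero
    have hP0 : (Nat.card (c.P i) : ℝ) ≠ 0 := by exact_mod_cast Nat.card_pos.ne'
    unfold loc
    rw [c.cardN i]
    push_cast
    field_simp

lemma ind_same {i : c.ι} (l : c.P i →* ℂˣ) (x : c.P i) (hx : x ≠ 1) :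
    ind (c.P i) l x = (Nat.card (c.P i) : ℂ)⁻¹ * ∑ n : c.N i, lin (c.cj l n) x := by
  unfold ind
  congr 1
  have hx1 : (x : G) ≠ 1 := by simpa using hx
  symm
  rw [← Finset.sum_subset (Finset.subset_univ (Finset.univ.filter (fun y : G => y ∈ c.N i)))]
  · refine Finset.sum_bij (fun n _ => (n : G)) ?_ ?_ ?_ ?_
    · intro n _; simp
    · intro a _ b _ h; exact Subtype.ext h
    · intro y hy
      exact ⟨⟨y, (Finset.mem_filter.1 hy).2⟩, Finset.mem_univ _, rfl⟩
    · intro n _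
      rw [dif_pos (c.conj_mem_of_N n.2 x.2), lin, cj_apply]
  · intro y _ hy
    rw [dif_neg]
    intro h
    apply hy
    simp only [Finset.mem_filter, Finset.mem_univ, true_and]
    exact c.ti i x x.2 hx1 y h

lemma ind_other {i j : c.ι} (hij : i ≠ j) (l : c.P i →* ℂˣ) (x : c.P j) (hx : x ≠ 1) :
    ind (c.P i) l x = 0 := by
  unfold ind
  rw [Finset.sum_eq_zero, mul_zero]
  intro y _
  rw [dif_neg]
  intro h
  have hx1 : (x : G) ≠ 1 := by simpa using hx
  exact hij (c.fuse hx1 h (k := 1) (by simp))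

lemma ind_one {i : c.ι} (l : c.P i →* ℂˣ) : ind (c.P i) l 1 = (Nat.card (c.P i) : ℂ)⁻¹ * Nat.card G := by
  unfold ind
  congr 1
  have : ∀ y : G, (if h : y * 1 * y⁻¹ ∈ c.P i then (l ⟨_, h⟩ : ℂ) else 0) = 1 := by
    intro y
    have hy : y * 1 * y⁻¹ = 1 := by group
    rw [dif_pos (by rw [hy]; exact one_mem _)]
    have : (⟨y * 1 * y⁻¹, by rw [hy]; exact one_mem _⟩ : c.P i) = 1 := Subtype.ext hy
    rw [this]; simp
  rw [Finset.sum_congr rfl fun y _ => this y]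
  simp [Nat.card_eq_fintype_card]

/-- difference of induced characters -/
noncomputable def df {i : c.ι} (l m : c.P i →* ℂˣ) : G → ℂ := ind (c.P i) l - ind (c.P i) m

lemma df_vg {i : c.ι} (l m : c.P i →* ℂˣ) : c.df l m ∈ VG G := (VG G).sub_mem (ind_isChar _ _).vg (ind_isChar _ _).vg

lemma df_one {i : c.ι} (l m : c.P i →* ℂˣ) : c.df l m 1 = 0 := by
  simp [df, ind_one]

lemma df_same {i : c.ι} (l m : c.P i →* ℂˣ) :
    (fun x : c.P i => c.df l m x) = (Nat.card (c.P i) : ℂ)⁻¹ • ∑ n : c.N i, (lin (c.cj l n) - lin (c.cj m n)) := by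
  funext x
  by_cases hx : x = 1
  · subst hx
    simp [df_one, lin]
  · simp only [df, Pi.sub_apply, ind_same _ _ _ hx, Pi.smul_apply, Finset.sum_apply, smul_eq_mul, Finset.sum_sub_distrib, mul_sub]

lemma df_other {i j : c.ι} (hij : i ≠ j) (l m : c.P i →* ℂˣ) : (fun x : c.P j => c.df l m x) = 0 := by
  funext x
  by_cases hx : x = 1
  · subst hx
    simp [df_one]
  · simp [df, ind_other _ hij _ _ hx]

noncomputable def K {i : c.ι} (l n : c.P i →* ℂˣ) : ℂ :=
  (Nat.card (c.P i) : ℂ)⁻¹ * (Finset.univ.filter (fun y : c.N i => c.cj l y = n)).card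

lemma df_ind {i : c.ι} (l m n : c.P i →* ℂˣ) : ip (c.df l m) (ind (c.P i) n) = c.K l n - c.K m n := by
  rw [frobenius (vg_conj_class (c.df_vg l m)), df_same, ip_smul_left, ip_sum_left]
  simp only [ip_sub_left, lin_ip, Finset.sum_sub_distrib, Finset.sum_boole, mul_sub, K]

lemma df_ind_other {i j : c.ι} (hij : i ≠ j) (l m : c.P i →* ℂˣ) (n : c.P j →* ℂˣ) :
    ip (c.df l m) (ind (c.P j) n) = 0 := by
  rw [frobenius (vg_conj_class (c.df_vg l m)), c.df_other hij, ip_zero_left]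

lemma df_df_other {i j : c.ι} (hij : i ≠ j) (l m : c.P i →* ℂˣ) (n o : c.P j →* ℂˣ) :
    ip (c.df l m) (c.df n o) = 0 := by
  conv_lhs => rw [df.eq_1 c n o]
  rw [ip_sub_right, c.df_ind_other hij, c.df_ind_other hij, sub_zero]

lemma df_df {i : c.ι} (l m n o : c.P i →* ℂˣ) :
    ip (c.df l m) (c.df n o) = (c.K l n - c.K m n) - (c.K l o - c.K m o) := by
  conv_lhs => rw [df.eq_1 c n o]
  rw [ip_sub_right, df_ind, df_ind]

end Cfg
end D
end EPOA5

namespace EPOA5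
open scoped Classical BigOperators
section D
variable {G : Type} [Group G]

lemma linv_inv {H : Type} [Group H] (l : H →* ℂˣ) : l⁻¹⁻¹ = l := by
  ext x; simp

lemma linv_ne {H : Type} [Group H] {l : H →* ℂˣ} (hl : l ≠ 1) : l⁻¹ ≠ 1 := by
  intro h
  apply hl
  ext x
  have := DFunLike.congr_fun h x
  rw [MonoidHom.inv_apply, MonoidHom.one_apply, inv_eq_one] at this
  rw [this]; simp

lemma dl_ind [Fintype G] (P : Subgroup G) (l : P →* ℂˣ) : dl (ind P l) = ind P l⁻¹ := by
  funext x
  simp only [dl, ind]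
  congr 1
  refine Finset.sum_congr rfl fun y _ => ?_
  by_cases h : y * x * y⁻¹ ∈ P
  · have h' : y * x⁻¹ * y⁻¹ ∈ P := by
      have := P.inv_mem h
      simpa [mul_assoc] using this
    rw [dif_pos h, dif_pos h']
    have : (⟨y * x⁻¹ * y⁻¹, h'⟩ : P) = (⟨y * x * y⁻¹, h⟩ : P)⁻¹ := Subtype.ext (by simp [mul_assoc])
    rw [this, map_inv]; rfl
  · have h' : y * x⁻¹ * y⁻¹ ∉ P := by
      intro h1; apply h
      have := P.inv_mem h1
      simpa [mul_assoc] using this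
    rw [dif_neg h, dif_neg h']

lemma ipZ_irr [Fintype G] {f g : G → ℂ} (hf : IsIrr f) (hg : IsIrr g) : ipZ f g = if f = g then 1 else 0 := by
  have := ipZ_spec hf.vg hg.vg
  rw [irr_ip hf hg] at this
  split_ifs at this ⊢ <;> exact_mod_cast this.symm

lemma exX [Fintype G] {D : G → ℂ} (hD : D ∈ VG G) (h1 : dl D = -D) (h2 : ip D D = 2) :
    ∃ X, IsIrr X ∧ X ≠ dl X ∧ D = X - dl X := by
  have hD0 : D ≠ 0 := by rintro rfl; simp [ip_zero_left] at h2
  have main : ∀ X, IsIrr X → ip D X ≠ 0 → X ≠ dl X ∧ (ipZ D X = 1 ∨ ipZ D X = -1) ∧ ipZ D (dl X) = - ipZ D X := by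
    intro X hX hne
    have e1 : ip D (dl X) = - ip D X := by rw [ip_dl_right, h1, ip_neg_left]
    have hXne : X ≠ dl X := by
      intro h
      rw [← h] at e1
      apply hne
      linear_combination (1/2 : ℂ) * e1
    have e2 : ipZ D (dl X) = - ipZ D X := by
      rw [ipZ_spec hD hX.vg, ipZ_spec hD hX.dual.vg] at e1
      exact_mod_cast e1
    have hb := bessel hD {X, dl X} (by intro χ hχ; simp at hχ; rcases hχ with rfl | rfl; exacts [hX, hX.dual])
    rw [Finset.sum_pair hXne, e2] at hb
    have e3 : ipZ D D = 2 := by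
      rw [ipZ_spec hD hD] at h2
      exact_mod_cast h2
    have e4 : ipZ D X ≠ 0 := by
      intro h0; apply hne; rw [ipZ_spec hD hX.vg, h0]; simp
    refine ⟨hXne, ?_, e2⟩
    have h5 : ipZ D X ^ 2 ≤ 1 := by nlinarith
    have h6 : ipZ D X ≤ 1 := by nlinarith
    have h7 : -1 ≤ ipZ D X := by nlinarith
    omega
  obtain ⟨X, hX, hne, hX1⟩ : ∃ X, IsIrr X ∧ X ≠ dl X ∧ ipZ D X = 1 := by
    obtain ⟨X, hX, hne⟩ := exists_irr_ip_ne hD hD0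
    obtain ⟨a, b, d⟩ := main X hX hne
    rcases b with b | b
    · exact ⟨X, hX, a, b⟩
    · exact ⟨dl X, hX.dual, by rw [dl_dl]; exact a.symm, by rw [d, b]; rfl⟩
  refine ⟨X, hX, hne, ?_⟩
  have e0 : ip D X = 1 := by rw [ipZ_spec hD hX.vg, hX1]; simp
  have e1 : ip D (dl X) = - 1 := by rw [ip_dl_right, h1, ip_neg_left, e0]
  rw [← sub_eq_zero]
  apply eq_zero_of_ip ((VG G).sub_mem hD ((VG G).sub_mem hX.vg hX.dual.vg))
  simp only [ip_sub_left, ip_sub_right, h2, ip_comm X D, ip_comm (dl X) D, e0, e1, irr_ip hX hX, irr_ip hX hX.dual,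
    irr_ip hX.dual hX, irr_ip hX.dual hX.dual, if_neg hne, if_neg hne.symm]
  norm_num

namespace Cfg
variable (c : Cfg G)

lemma lin_pow {i : c.ι} (l : c.P i →* ℂˣ) (x : c.P i) : l x ^ c.p i = 1 := by
  rw [← map_pow]
  have : x ^ c.p i = 1 := Subtype.ext (c.epo.pow_p (c.hp i) (c.hP i) x.2)
  rw [this, map_one]

lemma cj_P {i : c.ι} (l : c.P i →* ℂˣ) (y : c.N i) (hy : (y : G) ∈ c.P i) : c.cj l y = l := by
  ext x
  rw [cj_apply]
  have : (⟨y * x * (y : G)⁻¹, c.conj_mem_of_N y.2 x.2⟩ : c.P i) = ⟨y, hy⟩ * x * ⟨y, hy⟩⁻¹ := Subtype.ext rfl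
  rw [this, map_mul, map_mul, map_inv, mul_comm, inv_mul_cancel_left]

lemma cj_fix {i : c.ι} {l : c.P i →* ℂˣ} (hl : l ≠ 1) {y : c.N i} (h : c.cj l y = l) : (y : G) ∈ c.P i := by
  by_contra hy
  apply hl
  ext x
  have hq := c.ordN i y y.2 hy
  have key : ∀ n : ℕ, ∃ h : ((x : G) * y) ^ n * ((y : G) ^ n)⁻¹ ∈ c.P i, l ⟨_, h⟩ = l x ^ n := by
    intro n
    induction n with
    | zero =>
      refine ⟨by simp [one_mem], ?_⟩
      have : (⟨((x : G) * y) ^ 0 * ((y : G) ^ 0)⁻¹, by simp [one_mem]⟩ : c.P i) = 1 := Subtype.ext (by simp)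
      rw [this]; simp
    | succ n ih =>
      obtain ⟨hm, e⟩ := ih
      have e2 : ((x : G) * y) ^ (n+1) * ((y : G) ^ (n+1))⁻¹ = x * (y * (((x : G) * y) ^ n * ((y : G) ^ n)⁻¹) * (y : G)⁻¹) := by
        rw [pow_succ', pow_succ']; group
      have hm2 := c.conj_mem_of_N y.2 hm
      refine ⟨by rw [e2]; exact mul_mem x.2 hm2, ?_⟩
      have : (⟨((x : G) * y) ^ (n+1) * ((y : G) ^ (n+1))⁻¹, by rw [e2]; exact mul_mem x.2 hm2⟩ : c.P i) =
        x * ⟨_, hm2⟩ := Subtype.ext e2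
      rw [this, map_mul, pow_succ', ← e]
      congr 1
      conv_rhs => rw [← h]
      rw [cj_apply]
  obtain ⟨hm, e⟩ := key (c.q i)
  have ho : orderOf ((x : G) * y) = orderOf (y : G) := c.epo.order_mul' y.2 hy x.2
  have : (⟨((x : G) * y) ^ c.q i * ((y : G) ^ c.q i)⁻¹, hm⟩ : c.P i) = 1 := by
    apply Subtype.ext
    simp only [← hq]
    conv_lhs => rw [← ho]
    rw [pow_orderOf_eq_one, ho, pow_orderOf_eq_one]; simp
  rw [this, map_one] at e
  have hcop : (c.q i).Coprime (c.p i) := (Nat.coprime_primes (c.hq i) (c.hp i)).2 (c.qp i)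
  have h3 : orderOf (l x) = 1 :=
    Nat.eq_one_of_dvd_coprimes hcop (orderOf_dvd_of_pow_eq_one e.symm) (orderOf_dvd_of_pow_eq_one (c.lin_pow l x))
  rw [orderOf_eq_one_iff.1 h3]; simp

lemma sq_mem (c : Cfg G) [Finite G] {H : Subgroup G} {y : G} (h : y * y ∈ H) : y ∈ H := by
  obtain ⟨k, hk⟩ := c.odd
  have : y = (y * y) ^ (k + 1) := by
    rw [← pow_two, ← pow_mul]
    have : 2 * (k + 1) = Nat.card G + 1 := by omega
    rw [this, pow_succ, pow_card_eq_one', one_mul]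
  rw [this]; exact H.pow_mem h _

lemma inv_ne [Finite G] {i : c.ι} {l : c.P i →* ℂˣ} (hl : l ≠ 1) : l⁻¹ ≠ l := by
  intro h
  apply hl
  obtain ⟨k, hk⟩ := c.odd
  ext x
  have h1 : l x * l x = 1 := by
    have := DFunLike.congr_fun h x
    rw [MonoidHom.inv_apply] at this
    nth_rewrite 1 [← this]; simp
  have : x = (x * x) ^ (k + 1) := by
    apply Subtype.ext
    rw [← pow_two, ← pow_mul]
    have : 2 * (k + 1) = Nat.card G + 1 := by omega
    rw [this, pow_succ]
    push_cast
    rw [pow_card_eq_one', one_mul]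
  rw [this, map_pow, map_mul, h1]; simp

lemma inv_not_conj [Finite G] {i : c.ι} {l : c.P i →* ℂˣ} (hl : l ≠ 1) (y : c.N i) : c.cj l y ≠ l⁻¹ := by
  intro h
  have h1 : c.cj l (y * y) = l := by rw [← cj_cj, h, inv_cj, h, linv_inv]
  have h2 := c.cj_fix hl h1
  have h3 := c.sq_mem (H := c.P i) (y := (y : G)) h2
  rw [c.cj_P l y h3] at h
  exact c.inv_ne hl h.symm

variable [Fintype G]

lemma K_one {i : c.ι} (n : c.P i →* ℂˣ) : c.K 1 n = if n = 1 then (c.q i : ℂ) else 0 := by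
  have hP0 : (Nat.card (c.P i) : ℂ) ≠ 0 := by exact_mod_cast Nat.card_pos.ne'
  unfold K
  simp only [one_cj]
  split_ifs with h
  · rw [Finset.filter_true_of_mem (fun _ _ => h.symm), Finset.card_univ, ← Nat.card_eq_fintype_card, c.cardN]
    push_cast
    field_simp
  · rw [Finset.filter_false_of_mem (fun _ _ h' => h h'.symm)]; simp

lemma orbit_fiber {i : c.ι} {l : c.P i →* ℂˣ} (hl : l ≠ 1) (y0 : c.N i) :
    (Finset.univ.filter (fun y : c.N i => c.cj l y = c.cj l y0)).card = Nat.card (c.P i) := by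
  rw [Nat.card_eq_fintype_card, ← Finset.card_univ]
  symm
  refine Finset.card_bij (fun x _ => (⟨x, Subgroup.le_normalizer x.2⟩ : c.N i) * y0) ?_ ?_ ?_
  · intro x _
    simp only [Finset.mem_filter, Finset.mem_univ, true_and]
    rw [← cj_cj, c.cj_P l _ x.2]
  · intro a _ b _ h
    have := mul_right_cancel h
    exact Subtype.ext (congrArg (fun z : c.N i => (z : G)) this)
  · intro y hy
    simp only [Finset.mem_filter, Finset.mem_univ, true_and] at hy
    have h1 : c.cj l (y * y0⁻¹) = l := by rw [← cj_cj, hy, cj_cj, mul_inv_cancel, cj_one]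
    refine ⟨⟨_, c.cj_fix hl h1⟩, Finset.mem_univ _, ?_⟩
    apply Subtype.ext
    simp

lemma K_ne {i : c.ι} {l : c.P i →* ℂˣ} (hl : l ≠ 1) (n : c.P i →* ℂˣ) :
    c.K l n = if ∃ y, c.cj l y = n then 1 else 0 := by
  have hP0 : (Nat.card (c.P i) : ℂ) ≠ 0 := by exact_mod_cast Nat.card_pos.ne'
  unfold K
  split_ifs with h
  · obtain ⟨y0, rfl⟩ := h
    rw [c.orbit_fiber hl, inv_mul_cancel₀ hP0]
  · rw [Finset.filter_false_of_mem (fun y _ h' => h ⟨y, h'⟩)]; simp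

lemma K_self {i : c.ι} {l : c.P i →* ℂˣ} (hl : l ≠ 1) : c.K l l = 1 := by
  rw [c.K_ne hl, if_pos ⟨1, c.cj_one l⟩]

lemma K_inv {i : c.ι} {l : c.P i →* ℂˣ} (hl : l ≠ 1) : c.K l l⁻¹ = 0 := by
  rw [c.K_ne hl, if_neg]
  rintro ⟨y, hy⟩
  exact c.inv_not_conj hl y hy

lemma K_inv' {i : c.ι} {l : c.P i →* ℂˣ} (hl : l ≠ 1) : c.K l⁻¹ l = 0 := by
  have := c.K_inv (l := l⁻¹) (linv_ne hl)
  rwa [linv_inv] at this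

lemma K_to_one {i : c.ι} {l : c.P i →* ℂˣ} (hl : l ≠ 1) : c.K l 1 = 0 := by
  rw [c.K_ne hl, if_neg]
  rintro ⟨y, hy⟩
  apply hl
  have : c.cj (c.cj l y) y⁻¹ = l := by rw [cj_cj, mul_inv_cancel, cj_one]
  rw [← this, hy, one_cj]

lemma dl_df {i : c.ι} (l m : c.P i →* ℂˣ) : dl (c.df l m) = c.df l⁻¹ m⁻¹ := by
  rw [df, dl_sub, dl_ind, dl_ind, df]

lemma exists_X {i : c.ι} {l : c.P i →* ℂˣ} (hl : l ≠ 1) : ∃ X, IsIrr X ∧ X ≠ dl X ∧ c.df l l⁻¹ = X - dl X := by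
  apply exX (c.df_vg _ _)
  · rw [dl_df, linv_inv, df, df, neg_sub]
  · rw [df_df, c.K_self hl, c.K_inv' hl, c.K_inv hl, c.K_self (l := l⁻¹) (linv_ne hl)]; norm_num

end Cfg
end D
end EPOA5

namespace EPOA5
open scoped Classical BigOperators
section D
variable {G : Type} [Group G]

lemma ipZ_of [Fintype G] {f g : G → ℂ} (hf : f ∈ VG G) (hg : g ∈ VG G) {n : ℤ} (h : ip f g = n) : ipZ f g = n := by
  rw [ipZ_spec hf hg] at h; exact_mod_cast h

lemma sum_two [Fintype G] (hodd : Odd (Nat.card G)) (f : G → ℂ) (hf : ∀ x, IsIntegral ℤ (f x)) (hs : ∀ x, f x⁻¹ = f x) :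
    ∃ z : ℂ, IsIntegral ℤ z ∧ ∑ x, f x = f 1 + 2 * z := by
  let R := integralClosure ℤ ℂ
  let F : G → R := fun x => ⟨f x, hf x⟩
  let I : Ideal R := Ideal.span {(2 : R)}
  have h0 : ∑ x ∈ Finset.univ.erase (1 : G), Ideal.Quotient.mk I (F x) = 0 := by
    refine Finset.sum_involution (fun x _ => x⁻¹) ?_ ?_ ?_ ?_
    · intro x _
      have : F x⁻¹ = F x := Subtype.ext (hs x)
      rw [this, ← map_add, Ideal.Quotient.eq_zero_iff_mem, ← two_mul]
      exact Ideal.mul_mem_right _ _ (Ideal.mem_span_singleton_self _)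
    · intro x hx _ h
      have hx1 : x ≠ 1 := (Finset.mem_erase.1 hx).1
      apply hx1
      have h2 : x ^ 2 = 1 := by
        rw [pow_two]; nth_rewrite 1 [← h]; simp
      have := orderOf_dvd_of_pow_eq_one h2
      have h3 := orderOf_dvd_natCard x
      have hc : Nat.Coprime 2 (Nat.card G) := Nat.coprime_two_left.2 hodd
      exact orderOf_eq_one_iff.1 (Nat.eq_one_of_dvd_coprimes hc this h3)
    · intro x hx
      have hx1 : x ≠ 1 := (Finset.mem_erase.1 hx).1
      simp [hx1]
    · intro x _; simp
  rw [← map_sum, Ideal.Quotient.eq_zero_iff_mem, Ideal.mem_span_singleton] at h0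
  obtain ⟨z, hz⟩ := h0
  refine ⟨z, z.2, ?_⟩
  have := congrArg (fun r : R => (r : ℂ)) hz
  simp only [F] at this
  rw [← Finset.add_sum_erase _ _ (Finset.mem_univ (1 : G))]
  congr 1
  push_cast at this
  have e : (((2 : R) : R) : ℂ) = 2 := rfl
  rw [e] at this
  simpa using this

lemma even_of {n : ℤ} {z : ℂ} (hz : IsIntegral ℤ z) (h : (n : ℂ) = 2 * z) : Even n := by
  have h1 : z = algebraMap ℚ ℂ ((n : ℚ) / 2) := by
    simp; linear_combination (-1/2 : ℂ) * h
  rw [h1] at hz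
  have h2 : IsIntegral ℤ ((n : ℚ) / 2) := (isIntegral_algebraMap_iff (algebraMap ℚ ℂ).injective).1 hz
  obtain ⟨m, hm⟩ := IsIntegrallyClosed.isIntegral_iff.1 h2
  refine ⟨m, ?_⟩
  have : (n : ℚ) = m + m := by
    simp at hm; linarith
  exact_mod_cast this

lemma parity [Fintype G] (hodd : Odd (Nat.card G)) {f g : G → ℂ} (hf : f ∈ VG G) (hg : g ∈ VG G)
    (df : dl f = f) (dg : dl g = g) (h1 : ip f (lin 1) = 0) : Even (ipZ f g) := by
  have hc : (Nat.card G : ℂ) ≠ 0 := by exact_mod_cast Nat.card_pos.ne'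
  have key : ∀ g : G → ℂ, g ∈ VG G → dl g = g → ∃ z : ℂ, IsIntegral ℤ z ∧ (Nat.card G : ℂ) * ip f g = f 1 * g 1 + 2 * z := by
    intro g hg dg
    obtain ⟨z, hz, h⟩ := sum_two hodd (fun x => f x * g x⁻¹) (fun x => (vg_integral hf _).mul (vg_integral hg _)) (fun x => by
      have e1 := congrFun df x
      have e2 := congrFun dg x
      simp only [dl] at e1 e2
      simp only [e1, e2, inv_inv])
    refine ⟨z, hz, ?_⟩
    rw [ip, mul_inv_cancel_left₀ hc, h]; simp
  obtain ⟨a, ha⟩ := vg_one hf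
  obtain ⟨b, hb⟩ := vg_one hg
  have ha2 : Even a := by
    obtain ⟨z, hz, h⟩ := key (lin 1) (lin_isIrr _).vg (by rw [dl_lin]; congr 1)
    rw [h1] at h
    have : (a : ℂ) = 2 * (-z) := by
      rw [ha] at h; simp [lin] at h; linear_combination -h
    exact even_of hz.neg this
  obtain ⟨z, hz, h⟩ := key g hg dg
  obtain ⟨k, rfl⟩ := ha2
  rw [ipZ_spec hf hg, ha, hb] at h
  have h2 : Even ((Nat.card G : ℤ) * ipZ f g) := by
    refine even_of (z := k * b + z) (((isIntegral_algebraMap (x := k)).mul (isIntegral_algebraMap (x := b))).add hz) ?_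
    push_cast at h ⊢
    rw [h]; ring
  rcases Int.even_mul.1 h2 with h3 | h3
  · exact absurd h3 (by rw [Int.not_even_iff_odd]; exact_mod_cast hodd)
  · exact h3

namespace Cfg
variable (c : Cfg G) [Fintype G]

noncomputable def X {i : c.ι} (l : c.P i →* ℂˣ) : G → ℂ := if h : l ≠ 1 then (c.exists_X h).choose else 0

variable {i : c.ι} {l : c.P i →* ℂˣ} (hl : l ≠ 1)

lemma X_spec {i : c.ι} {l : c.P i →* ℂˣ} (hl : l ≠ 1) : IsIrr (c.X l) ∧ c.X l ≠ dl (c.X l) ∧ c.df l l⁻¹ = c.X l - dl (c.X l) := by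
  rw [X, dif_pos hl]; exact (c.exists_X hl).choose_spec

lemma X_irr {i : c.ι} {l : c.P i →* ℂˣ} (hl : l ≠ 1) : IsIrr (c.X l) := (c.X_spec hl).1
lemma X_ne {i : c.ι} {l : c.P i →* ℂˣ} (hl : l ≠ 1) : c.X l ≠ dl (c.X l) := (c.X_spec hl).2.1
lemma X_df {i : c.ι} {l : c.P i →* ℂˣ} (hl : l ≠ 1) : c.df l l⁻¹ = c.X l - dl (c.X l) := (c.X_spec hl).2.2

lemma dl_triv : dl (lin (1 : G →* ℂˣ)) = lin 1 := by
  rw [dl_lin]; congr 1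

lemma X_triv {i : c.ι} {l : c.P i →* ℂˣ} (hl : l ≠ 1) : c.X l ≠ lin 1 := by
  intro h
  apply c.X_ne hl
  rw [h, dl_triv]

lemma dX_triv {i : c.ι} {l : c.P i →* ℂˣ} (hl : l ≠ 1) : dl (c.X l) ≠ lin 1 := by
  intro h
  apply c.X_triv hl
  rw [← dl_dl (c.X l), h, dl_triv]

lemma X_other {i j : c.ι} (hij : i ≠ j) {l : c.P i →* ℂˣ} (hl : l ≠ 1) {m : c.P j →* ℂˣ} (hm : m ≠ 1) :
    c.X m ≠ c.X l ∧ c.X m ≠ dl (c.X l) := by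
  have h := c.df_df_other hij l l⁻¹ m m⁻¹
  have hX := c.X_irr hl
  have hne := c.X_ne hl
  rw [c.X_df hl, c.X_df hm] at h
  constructor
  · intro e
    rw [e] at h
    simp only [ip_sub_left, ip_sub_right, irr_ip hX hX, irr_ip hX hX.dual,
    irr_ip hX.dual hX, irr_ip hX.dual hX.dual, if_neg hne, if_neg hne.symm] at h
    norm_num at h
  · intro e
    rw [e, dl_dl] at h
    simp only [ip_sub_left, ip_sub_right, irr_ip hX hX, irr_ip hX hX.dual,
    irr_ip hX.dual hX, irr_ip hX.dual hX.dual, if_neg hne, if_neg hne.symm] at h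
    norm_num at h

lemma X_orbit {i : c.ι} {l m : c.P i →* ℂˣ} (hl : l ≠ 1) (hm : m ≠ 1) (h : c.X l = c.X m) : ∃ y, c.cj l y = m := by
  by_contra hno
  have hX := c.X_irr hl
  have hne := c.X_ne hl
  have h1 : ip (c.df l l⁻¹) (c.df m m⁻¹) = 2 := by
    rw [c.X_df hl, c.X_df hm, ← h]
    simp only [ip_sub_left, ip_sub_right, irr_ip hX hX, irr_ip hX hX.dual,
      irr_ip hX.dual hX, irr_ip hX.dual hX.dual, if_neg hne, if_neg hne.symm]
    norm_num
  rw [df_df, c.K_ne hl, c.K_ne hl, c.K_ne (linv_ne hl), c.K_ne (linv_ne hl), if_neg hno] at h1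
  split_ifs at h1 <;> norm_num at h1

lemma df_triv {i : c.ι} {l : c.P i →* ℂˣ} (hl : l ≠ 1) : ip (c.df 1 l) (lin 1) = 1 := by
  rw [ip_comm, df, ip_sub_right, frobenius (vg_conj_class (lin_isIrr 1).vg), frobenius (vg_conj_class (lin_isIrr 1).vg)]
  have : (fun x : c.P i => lin (1 : G →* ℂˣ) x) = lin (1 : c.P i →* ℂˣ) := by funext x; simp [lin]
  rw [this, lin_ip, lin_ip, if_pos rfl, if_neg hl.symm, sub_zero]

lemma alpha_norm {i : c.ι} {l : c.P i →* ℂˣ} (hl : l ≠ 1) : ip (c.df 1 l) (c.df 1 l) = c.q i + 1 := by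
  rw [df_df, K_one, K_one, c.K_self hl, c.K_to_one hl, if_pos rfl, if_neg hl]; ring

lemma alpha_D {i : c.ι} {l : c.P i →* ℂˣ} (hl : l ≠ 1) : ip (c.df 1 l) (c.X l) - ip (c.df 1 l) (dl (c.X l)) = -1 := by
  rw [← ip_sub_right, ← c.X_df hl, df_df, K_one, K_one, c.K_self hl, c.K_inv hl, if_neg hl, if_neg (linv_ne hl)]; ring

noncomputable def Gam {i : c.ι} (l : c.P i →* ℂˣ) : G → ℂ := c.df 1 l - lin 1 + c.X l

lemma Gam_vg {i : c.ι} {l : c.P i →* ℂˣ} (hl : l ≠ 1) : c.Gam l ∈ VG G :=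
  (VG G).add_mem ((VG G).sub_mem (c.df_vg _ _) (lin_isIrr _).vg) (c.X_irr hl).vg

lemma Gam_dl {i : c.ι} {l : c.P i →* ℂˣ} (hl : l ≠ 1) : dl (c.Gam l) = c.Gam l := by
  have h1 : (1 : c.P i →* ℂˣ)⁻¹ = 1 := by ext x; simp
  have h2 : c.df 1 l⁻¹ = c.df 1 l + c.df l l⁻¹ := by simp only [df]; abel
  rw [Gam, dl_add, dl_sub, dl_triv, dl_df, h1, h2, c.X_df hl]; abel

lemma Gam_triv {i : c.ι} {l : c.P i →* ℂˣ} (hl : l ≠ 1) : ip (c.Gam l) (lin 1) = 0 := by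
  rw [Gam, ip_add_left, ip_sub_left, c.df_triv hl, lin_ip, if_pos rfl, irr_ip (c.X_irr hl) (lin_isIrr 1), if_neg (c.X_triv hl)]; ring

lemma cross {i j : c.ι} (hij : i ≠ j) {l : c.P i →* ℂˣ} (hl : l ≠ 1) {m : c.P j →* ℂˣ} (hm : m ≠ 1) :
    Odd (ipZ (c.df 1 l) (c.X m) + ipZ (c.df 1 m) (c.X l)) := by
  obtain ⟨k, hk⟩ := parity c.odd (c.Gam_vg hl) (c.Gam_vg hm) (c.Gam_dl hl) (c.Gam_dl hm) (c.Gam_triv hl)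
  have h := ipZ_spec (c.Gam_vg hl) (c.Gam_vg hm)
  conv_lhs at h => rw [Gam.eq_1 c m, ip_add_right, ip_sub_right, c.Gam_triv hl, Gam]
  rw [ip_add_left, ip_add_left, ip_sub_left, ip_sub_left, c.df_df_other hij, ip_comm (lin 1) (c.df 1 m), c.df_triv hm,
    irr_ip (lin_isIrr 1) (c.X_irr hm), if_neg (c.X_triv hm).symm, irr_ip (c.X_irr hl) (c.X_irr hm), if_neg (c.X_other hij hl hm).1.symm,
    ip_comm (c.X l) (c.df 1 m), ipZ_spec (c.df_vg 1 m) (c.X_irr hl).vg, ipZ_spec (c.df_vg 1 l) (c.X_irr hm).vg, hk] at h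
  have h2 : ipZ (c.df 1 l) (c.X m) + ipZ (c.df 1 m) (c.X l) = 2 * k + 1 := by
    have : ((ipZ (c.df 1 l) (c.X m) + ipZ (c.df 1 m) (c.X l) : ℤ) : ℂ) = ((2 * k + 1 : ℤ) : ℂ) := by
      push_cast at h ⊢
      linear_combination h
    exact_mod_cast this
  exact ⟨k, h2⟩

end Cfg
end D
end EPOA5

namespace EPOA5
open scoped Classical BigOperators
section D
variable {G : Type} [Group G]
namespace Cfg
variable (c : Cfg G) [Fintype G]

noncomputable def m (f : G → ℂ) {i : c.ι} (t : c.P i →* ℂˣ) : ℤ := ipZ (fun x : c.P i => f x) (lin t)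

lemma m_sub {f : G → ℂ} (hf : f ∈ VG G) {i : c.ι} (a b : c.P i →* ℂˣ) : c.m f a - c.m f b = ipZ (c.df a b) f := by
  have h : ip (c.df a b) f = (ipZ (c.df a b) f : ℂ) := ipZ_spec (c.df_vg _ _) hf
  have hr := vg_res hf (c.P i)
  rw [ip_comm, df, ip_sub_right, frobenius (vg_conj_class hf), frobenius (vg_conj_class hf), ipZ_spec hr (lin_isIrr _).vg,
    ipZ_spec hr (lin_isIrr _).vg] at h
  exact_mod_cast h

lemma m_const {i r : c.ι} (hir : i ≠ r) {l : c.P i →* ℂˣ} (hl : l ≠ 1) {a b : c.P r →* ℂˣ} (ha : a ≠ 1) (hb : b ≠ 1) :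
    c.m (c.X l) a = c.m (c.X l) b := by
  have hX := c.X_irr hl
  have hne := c.X_ne hl
  rw [← sub_eq_zero, c.m_sub hX.vg]
  by_contra ht
  set t := ipZ (c.df a b) (c.X l) with htd
  have h1 : ip (c.df a b) (c.X l) = t := ipZ_spec (c.df_vg _ _) hX.vg
  have h2 : ip (c.df a b) (dl (c.X l)) = t := by
    have := c.df_df_other hir.symm a b l l⁻¹
    rw [c.X_df hl, ip_sub_right, h1] at this
    linear_combination -this
  have hN : ∃ N : ℤ, ip (c.df a b) (c.df a b) = N ∧ N ≤ 2 := by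
    rw [df_df, c.K_self ha, c.K_self hb, c.K_ne ha, c.K_ne hb]
    split_ifs
    · exact ⟨0, by norm_num, by norm_num⟩
    · exact ⟨1, by norm_num, by norm_num⟩
    · exact ⟨1, by norm_num, by norm_num⟩
    · exact ⟨2, by norm_num, by norm_num⟩
  obtain ⟨N, hN, hN2⟩ := hN
  have hg : c.df a b - t • (c.X l + dl (c.X l)) ∈ VG G :=
    (VG G).sub_mem (c.df_vg _ _) ((VG G).zsmul_mem ((VG G).add_mem hX.vg hX.dual.vg) t)
  have hzs : t • (c.X l + dl (c.X l)) = (t : ℂ) • (c.X l + dl (c.X l)) := (Int.cast_smul_eq_zsmul ℂ t _).symm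
  have hgn : ip (c.df a b - t • (c.X l + dl (c.X l))) (c.df a b - t • (c.X l + dl (c.X l))) = ((N - 2 * t ^ 2 : ℤ) : ℂ) := by
    rw [hzs]
    simp only [ip_sub_left, ip_sub_right, ip_smul_left, ip_smul_right, ip_add_left, ip_add_right, hN, h1, h2,
      ip_comm _ (c.df a b), irr_ip hX hX, irr_ip hX hX.dual,
      irr_ip hX.dual hX, irr_ip hX.dual hX.dual, if_neg hne, if_neg hne.symm]
    push_cast
    simp
    ring
  have hge := ipZ_self_nonneg hg
  rw [ipZ_of hg hg hgn] at hge
  have ht1 : 1 ≤ t ^ 2 := by have := sq_nonneg t; have : t ^ 2 ≠ 0 := pow_ne_zero _ ht; omega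
  have h0 : N - 2 * t ^ 2 = 0 := by omega
  rw [h0] at hgn
  have hz := eq_zero_of_ip hg (by simpa using hgn)
  have := congrFun hz 1
  obtain ⟨d, hd, hd1⟩ := hX.one_pos
  simp only [Pi.sub_apply, Pi.smul_apply, Pi.add_apply, Pi.zero_apply, dl_one, c.df_one, hd1] at this
  have h4 : t * (d + d : ℤ) = 0 := by
    have : ((t * (d + d : ℤ) : ℤ) : ℂ) = 0 := by
      push_cast
      simp at this
      rcases this with h | h
      · simp [h]
      · simp [h]
    exact_mod_cast this
  rcases mul_eq_zero.1 h4 with h | h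
  · exact ht h
  · omega

noncomputable def L (i : c.ι) : ℕ := Fintype.card (c.P i →* ℂˣ)

lemma ntP (i : c.ι) : Nontrivial (c.P i) := (Subgroup.nontrivial_iff_ne_bot _).2 (c.P1 i)

lemma L_pow (i : c.ι) : ∃ k, 0 < k ∧ c.L i = c.p i ^ k := by
  have := c.ntP i
  exact lin_card (c.hp i) (c.hP i)

lemma p_odd (i : c.ι) : Odd (c.p i) := by
  have := c.ntP i
  obtain ⟨x, hx⟩ := exists_ne (1 : c.P i)
  have h := c.ord x.2 (fun h => hx (Subtype.ext h))
  have h2 := orderOf_dvd_natCard (x : G)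
  rw [h] at h2
  exact c.odd.of_dvd_nat h2

lemma p_ge (i : c.ι) : 3 ≤ c.p i := by
  have := (c.hp i).two_le
  obtain ⟨k, hk⟩ := c.p_odd i
  omega

lemma q_odd (i : c.ι) : Odd (c.q i) := by
  have h : Nat.card (c.N i) ∣ Nat.card G := Subgroup.card_subgroup_dvd_card _
  rw [c.cardN] at h
  exact c.odd.of_dvd_nat ((dvd_mul_left _ _).trans h)

lemma q_ge (i : c.ι) : 3 ≤ c.q i := by
  have := (c.hq i).two_le
  obtain ⟨k, hk⟩ := c.q_odd i
  omega

lemma L_odd (i : c.ι) : Odd (c.L i) := by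
  obtain ⟨k, _, h⟩ := c.L_pow i
  rw [h]; exact (c.p_odd i).pow

lemma p_dvd_L (i : c.ι) : c.p i ∣ c.L i := by
  obtain ⟨k, h0, h⟩ := c.L_pow i
  rw [h]; exact dvd_pow_self _ h0.ne'

lemma L_ge (i : c.ι) : 3 ≤ c.L i := (c.p_ge i).trans (Nat.le_of_dvd (by obtain ⟨k, hk⟩ := c.L_odd i; omega) (c.p_dvd_L i))

lemma L_inj {i j : c.ι} (h : c.L i = c.L j) : i = j := by
  obtain ⟨k, h0, hk⟩ := c.L_pow i
  have := c.p_dvd_L j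
  rw [← h, hk] at this
  exact c.pinj ((Nat.prime_dvd_prime_iff_eq (c.hp j) (c.hp i)).1 ((c.hp j).dvd_of_dvd_pow this)).symm

lemma exists_w (i : c.ι) : ∃ w, c.L i = c.q i * w + 1 ∧ 2 ≤ w ∧ Even w := by
  have hdvd : c.q i ∣ c.L i - 1 := by
    have := Fact.mk (c.hq i)
    obtain ⟨y, hy⟩ : ∃ y : c.N i, (y : G) ∉ c.P i := by
      by_contra hno
      push Not at hno
      have hle : c.N i ≤ c.P i := fun y hy => hno ⟨y, hy⟩
      have h1 := Subgroup.card_le_of_le hle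
      have h2 := c.cardN i
      have h3 : 0 < Nat.card (c.P i) := Nat.card_pos
      have h4 := c.q_ge i
      have h5 : Nat.card (c.N i) ≤ Nat.card (c.P i) := h1
      rw [show Nat.card (c.N i) = _ from h2] at h5
      nlinarith
    let σ : Function.End (c.P i →* ℂˣ) := fun l => c.cj l y
    have hpow : ∀ (n : ℕ) l, (σ ^ n) l = c.cj l (y ^ n) := by
      intro n
      induction n with
      | zero => intro l; rw [pow_zero, pow_zero, cj_one]; rfl
      | succ n ih =>
        intro l
        rw [pow_succ]
        show (σ ^ n) (c.cj l y) = _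
        rw [ih, cj_cj, pow_succ']
    have hσ : σ ^ (c.q i) ^ 1 = 1 := by
      funext l
      rw [pow_one, hpow]
      have : y ^ c.q i = 1 := by
        apply Subtype.ext
        have := c.ordN i y y.2 hy
        rw [SubmonoidClass.coe_pow, ← this, pow_orderOf_eq_one]; rfl
      rw [this, cj_one]; rfl
    have h := Equiv.Perm.card_fixedPoints_modEq (f := σ) (p := c.q i) (n := 1) hσ
    have hfp : Fintype.card (Function.fixedPoints σ) = 1 := by
      rw [Fintype.card_eq_one_iff]
      refine ⟨⟨1, c.one_cj y⟩, ?_⟩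
      rintro ⟨l, hl⟩
      apply Subtype.ext
      by_contra hne
      exact hy (c.cj_fix hne hl)
    rw [hfp] at h
    exact (Nat.modEq_iff_dvd' (by have := c.L_ge i; omega)).1 h.symm
  obtain ⟨w, hw⟩ := hdvd
  have hL := c.L_ge i
  have hLw : c.L i = c.q i * w + 1 := by omega
  have hev : Even w := by
    have h1 := c.L_odd i
    have h2 := c.q_odd i
    rw [hLw] at h1
    have h3 : Even (c.q i * w) := by
      rcases Nat.even_or_odd (c.q i * w) with h | h
      · exact h
      · exact absurd h1 (by rw [Nat.not_odd_iff_even]; exact h.add_one)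
    rcases Nat.even_mul.1 h3 with h | h
    · exact absurd h (by rwa [Nat.not_even_iff_odd])
    · exact h
  refine ⟨w, hLw, ?_, hev⟩
  obtain ⟨k, rfl⟩ := hev
  rcases Nat.eq_zero_or_pos k with h | h
  · subst h; omega
  · omega

noncomputable def orb {i : c.ι} (l : c.P i →* ℂˣ) : Finset (c.P i →* ℂˣ) := Finset.univ.filter (fun n => ∃ y, c.cj l y = n)

lemma mem_orb {i : c.ι} {l n : c.P i →* ℂˣ} : n ∈ c.orb l ↔ ∃ y, c.cj l y = n := by simp [orb]

lemma orb_card {i : c.ι} {l : c.P i →* ℂˣ} (hl : l ≠ 1) : (c.orb l).card = c.q i := by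
  have h := Finset.card_eq_sum_card_fiberwise (f := fun y : c.N i => c.cj l y) (s := Finset.univ) (t := c.orb l)
    (fun y _ => Finset.mem_coe.2 (c.mem_orb.2 ⟨y, rfl⟩))
  have h2 : ∀ n ∈ c.orb l, (Finset.univ.filter (fun y : c.N i => c.cj l y = n)).card = Nat.card (c.P i) := fun n hn => by
    obtain ⟨y0, rfl⟩ := c.mem_orb.1 hn
    exact c.orbit_fiber hl y0
  rw [Finset.sum_congr rfl h2] at h
  rw [Finset.card_univ, ← Nat.card_eq_fintype_card, c.cardN, Finset.sum_const, smul_eq_mul, mul_comm] at h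
  exact (Nat.eq_of_mul_eq_mul_right Nat.card_pos h).symm

lemma m_orb {f : G → ℂ} (hf : f ∈ VG G) {i : c.ι} {l n : c.P i →* ℂˣ} (hl : l ≠ 1) (hn : n ∈ c.orb l) : c.m f n = c.m f l := by
  obtain ⟨y, rfl⟩ := c.mem_orb.1 hn
  have hn1 : c.cj l y ≠ 1 := by
    intro h
    apply hl
    have : c.cj (c.cj l y) y⁻¹ = l := by rw [cj_cj, mul_inv_cancel, cj_one]
    rw [← this, h, one_cj]
  have h0 : c.df (c.cj l y) l = 0 := by
    apply eq_zero_of_ip (c.df_vg _ _)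
    rw [df_df, c.K_self hl, c.K_self hn1, c.K_ne hl, c.K_ne hn1, if_pos ⟨y, rfl⟩,
      if_pos ⟨y⁻¹, by rw [cj_cj, mul_inv_cancel, cj_one]⟩]
    norm_num
  have h1 := c.m_sub hf (c.cj l y) l
  rw [h0] at h1
  have h2 : ipZ (0 : G → ℂ) f = 0 := ipZ_of (VG G).zero_mem hf (by rw [ip_zero_left]; simp)
  omega

lemma loc_self {i : c.ι} {l : c.P i →* ℂˣ} (hl : l ≠ 1) :
    (c.q i : ℝ) * (c.L i - c.q i) / c.L i ≤ loc (fun x : c.P i => c.X l x) := by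
  have hX := c.X_irr hl
  have hne := c.X_ne hl
  have h1 : c.m (c.X l) l - c.m (c.X l) l⁻¹ = 1 := by
    rw [c.m_sub hX.vg, c.X_df hl]
    apply ipZ_of ((VG G).sub_mem hX.vg hX.dual.vg) hX.vg
    rw [ip_sub_left, irr_ip hX hX, irr_ip hX.dual hX, if_pos rfl, if_neg hne.symm]; simp
  have := loc_cut (vg_res hX.vg (c.P i)) (c.m (c.X l) l) (c.q i) (c.orb l) (c.orb l⁻¹)
    (by rw [c.orb_card hl]) (by rw [c.orb_card (linv_ne hl)])
    (fun t ht => (c.m_orb hX.vg hl ht).ge) (fun t ht => by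
      have h2 := c.m_orb hX.vg (linv_ne hl) ht
      have h3 : ipZ (fun x : c.P i => c.X l x) (lin t) = c.m (c.X l) t := rfl
      omega)
  simpa [L] using this

lemma loc_in {i r : c.ι} (hir : i ≠ r) {l : c.P i →* ℂˣ} (hl : l ≠ 1) {a : c.P r →* ℂˣ} (ha : a ≠ 1)
    (hc : ipZ (c.df 1 a) (c.X l) ≠ 0) : 1 - (Nat.card (c.P r) : ℝ)⁻¹ ≤ loc (fun x : c.P r => c.X l x) := by
  have hX := c.X_irr hl
  have hr := vg_res hX.vg (c.P r)
  obtain ⟨d, hd⟩ := vg_one hX.vg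
  by_cases hpd : (c.p r : ℤ) ∣ d
  · have hle : 1 - (Nat.card (c.P r) : ℝ)⁻¹ ≤ 1 := by
      have : (0 : ℝ) ≤ (Nat.card (c.P r) : ℝ)⁻¹ := by positivity
      linarith
    refine hle.trans ?_
    rw [← c.m_sub hX.vg] at hc
    refine loc_in_dvd hr (c.m (c.X l) (1 : c.P r →* ℂˣ)) (c.m (c.X l) a) rfl (fun ψ hψ => c.m_const hir hl hψ ha) ?_ (c.L_ge r)
    obtain ⟨n, hn⟩ := modp (c.hp r) (c.hP r) hr
    have hn1 : c.X l ((1 : c.P r) : G) = d := hd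
    rw [hn1] at hn
    have hn2 : d = ∑ ψ : c.P r →* ℂˣ, c.m (c.X l) ψ + c.p r * n := by exact_mod_cast hn
    have hs : ∑ ψ : c.P r →* ℂˣ, c.m (c.X l) ψ = c.m (c.X l) (1 : c.P r →* ℂˣ) + (c.L r - 1) * c.m (c.X l) a := by
      rw [← Finset.add_sum_erase _ _ (Finset.mem_univ (1 : c.P r →* ℂˣ))]
      rw [Finset.sum_congr rfl (fun ψ hψ => c.m_const hir hl (Finset.mem_erase.1 hψ).1 ha), Finset.sum_const,
        Finset.card_erase_of_mem (Finset.mem_univ _), Finset.card_univ, nsmul_eq_mul]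
      congr 2
      have := c.L_ge r
      unfold L at this ⊢
      push_cast [show 1 ≤ Fintype.card (c.P r →* ℂˣ) by omega]
      ring
    have h3 : (c.p r : ℤ) ∣ c.m (c.X l) (1 : c.P r →* ℂˣ) - c.m (c.X l) a := by
      obtain ⟨k, hk⟩ := c.p_dvd_L r
      obtain ⟨e, he⟩ := hpd
      refine ⟨e - n - k * c.m (c.X l) a, ?_⟩
      have hk' : (c.L r : ℤ) = c.p r * k := by exact_mod_cast hk
      rw [hs, he, hk'] at hn2
      linear_combination -hn2
    have h4 := Int.le_of_dvd (abs_pos.2 hc) ((dvd_abs _ _).2 h3)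
    have h5 := c.p_ge r
    have : (3 : ℤ) ≤ c.p r := by exact_mod_cast h5
    exact this.trans h4
  · exact loc_in_cop (c.hp r) (fun x => Subtype.ext (c.epo.pow_p (c.hp r) (c.hP r) x.2)) hr hd hpd

end Cfg
end D
end EPOA5

namespace EPOA5
open scoped Classical BigOperators
section D
variable {G : Type} [Group G]
namespace Cfg
variable (c : Cfg G) [Fintype G]

lemma out_sum {i : c.ι} {l : c.P i →* ℂˣ} (hl : l ≠ 1) (O : Finset c.ι) (hO : ∀ r ∈ O, r ≠ i)
    (h0 : ∀ r ∈ O, ∀ a : c.P r →* ℂˣ, a ≠ 1 → ipZ (c.df 1 a) (c.X l) = 0) :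
    ∑ r ∈ O, ((c.L r : ℝ) - 1) / c.q r ≤ c.q i - 1 := by
  let S : Finset (Σ r, c.P r →* ℂˣ) := O.sigma (fun r => Finset.univ.erase 1)
  let Xf : (Σ r, c.P r →* ℂˣ) → (G → ℂ) := fun s => c.X s.2
  let F := S.image Xf
  have hS : ∀ s ∈ S, s.1 ∈ O ∧ s.2 ≠ 1 := by
    intro s hs
    have := Finset.mem_sigma.1 hs
    exact ⟨this.1, (Finset.mem_erase.1 this.2).1⟩
  have hqpos : ∀ r, (0 : ℝ) < c.q r := fun r => by exact_mod_cast (c.hq r).pos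
  have e1 : ∑ r ∈ O, ((c.L r : ℝ) - 1) / c.q r = ∑ s ∈ S, (1 : ℝ) / c.q s.1 := by
    rw [Finset.sum_sigma]
    refine Finset.sum_congr rfl fun r _ => ?_
    simp only [Finset.sum_const, nsmul_eq_mul]
    rw [Finset.card_erase_of_mem (Finset.mem_univ _), Finset.card_univ]
    have := c.L_ge r
    unfold L at this ⊢
    push_cast [show 1 ≤ Fintype.card (c.P r →* ℂˣ) by omega]
    ring
  have e2 : ∑ s ∈ S, (1 : ℝ) / c.q s.1 ≤ F.card := by
    rw [← Finset.sum_fiberwise_of_maps_to (s := S) (t := F) (g := Xf) (fun s hs => Finset.mem_image_of_mem _ hs)]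
    rw [Finset.card_eq_sum_ones]
    push_cast
    refine Finset.sum_le_sum fun χ hχ => ?_
    obtain ⟨⟨r0, a0⟩, hs0, rfl⟩ := Finset.mem_image.1 hχ
    have ha0 : a0 ≠ 1 := (hS _ hs0).2
    calc ∑ s ∈ S.filter (fun s => Xf s = Xf ⟨r0, a0⟩), (1 : ℝ) / c.q s.1
        ≤ ∑ s ∈ (c.orb a0).image (fun a => (⟨r0, a⟩ : Σ r, c.P r →* ℂˣ)), (1 : ℝ) / c.q s.1 := by
          refine Finset.sum_le_sum_of_subset_of_nonneg ?_ (fun s _ _ => by have := hqpos s.1; positivity)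
          rintro ⟨r, a⟩ hs
          obtain ⟨hs1, hs2⟩ := Finset.mem_filter.1 hs
          have ha : a ≠ 1 := (hS _ hs1).2
          have hr : r = r0 := by
            by_contra hne
            exact (c.X_other (Ne.symm hne) ha0 ha).1 hs2
          subst hr
          exact Finset.mem_image.2 ⟨a, c.mem_orb.2 (c.X_orbit ha0 ha hs2.symm), rfl⟩
      _ = 1 := by
          rw [Finset.sum_image (fun a _ b _ h => by simpa using h)]
          simp only [Finset.sum_const, nsmul_eq_mul]
          rw [c.orb_card ha0, mul_one_div_cancel (hqpos r0).ne']
  rw [e1]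
  refine e2.trans ?_
  have hX := c.X_irr hl
  have hnz : ∃ Y, IsIrr Y ∧ (Y = c.X l ∨ Y = dl (c.X l)) ∧ ipZ (c.df 1 l) Y ≠ 0 := by
    by_contra hno
    push Not at hno
    have h1 := hno _ hX (Or.inl rfl)
    have h2 := hno _ hX.dual (Or.inr rfl)
    have := c.alpha_D hl
    rw [ipZ_spec (c.df_vg _ _) hX.vg, ipZ_spec (c.df_vg _ _) hX.dual.vg, h1, h2] at this
    norm_num at this
  obtain ⟨Y, hY, hYe, hY0⟩ := hnz
  have hF : ∀ χ ∈ F, IsIrr χ ∧ χ ≠ lin 1 ∧ χ ≠ Y ∧ ipZ (c.df 1 l) χ ≠ 0 := by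
    intro χ hχ
    obtain ⟨⟨r, a⟩, hs, rfl⟩ := Finset.mem_image.1 hχ
    obtain ⟨hr, ha⟩ := hS _ hs
    have hri := hO r hr
    refine ⟨c.X_irr ha, c.X_triv ha, ?_, ?_⟩
    · rcases hYe with rfl | rfl
      · exact (c.X_other hri.symm hl ha).1
      · exact (c.X_other hri.symm hl ha).2
    · have := c.cross hri.symm hl ha
      rw [h0 r hr a ha, add_zero] at this
      intro h
      simp only [Xf] at h
      rw [h] at this
      exact absurd this (by decide)
  have hYt : Y ≠ lin 1 := by
    rcases hYe with rfl | rfl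
    · exact c.X_triv hl
    · exact c.dX_triv hl
  have hb := bessel (c.df_vg 1 l) (insert (lin 1) (insert Y F)) (by
    intro χ hχ
    rcases Finset.mem_insert.1 hχ with rfl | hχ
    · exact lin_isIrr 1
    rcases Finset.mem_insert.1 hχ with rfl | hχ
    · exact hY
    · exact (hF χ hχ).1)
  rw [Finset.sum_insert (by
    intro h
    rcases Finset.mem_insert.1 h with h | h
    · exact hYt h.symm
    · exact (hF _ h).2.1 rfl), Finset.sum_insert (fun h => (hF _ h).2.2.1 rfl)] at hb
  have hn : ipZ (c.df 1 l) (c.df 1 l) = c.q i + 1 := ipZ_of (c.df_vg _ _) (c.df_vg _ _) (by rw [c.alpha_norm hl]; push_cast; rfl)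
  have ht : ipZ (c.df 1 l) (lin 1) = 1 := ipZ_of (c.df_vg _ _) (lin_isIrr _).vg (by rw [c.df_triv hl]; simp)
  have hsq : ∀ z : ℤ, z ≠ 0 → 1 ≤ z ^ 2 := fun z hz => by
    have := sq_nonneg z; have : z ^ 2 ≠ 0 := pow_ne_zero _ hz; omega
  have hFs : (F.card : ℤ) ≤ ∑ χ ∈ F, ipZ (c.df 1 l) χ ^ 2 := by
    rw [Finset.card_eq_sum_ones]
    push_cast
    exact Finset.sum_le_sum fun χ hχ => hsq _ (hF χ hχ).2.2.2
  have := hsq _ hY0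
  rw [hn, ht] at hb
  have : (F.card : ℤ) ≤ c.q i - 1 := by linarith
  have : ((F.card : ℤ) : ℝ) ≤ ((c.q i - 1 : ℤ) : ℝ) := by exact_mod_cast this
  push_cast at this
  exact this

noncomputable def y (i : c.ι) : ℝ := (1 - (Nat.card (c.P i) : ℝ)⁻¹) / c.q i

lemma y_nonneg (i : c.ι) : 0 ≤ c.y i := by
  have h : (1 : ℝ) ≤ Nat.card (c.P i) := by exact_mod_cast Nat.card_pos
  have : (Nat.card (c.P i) : ℝ)⁻¹ ≤ 1 := inv_le_one_of_one_le₀ h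
  unfold y
  exact div_nonneg (by linarith) (by positivity)

lemma y_lt (i : c.ι) : c.y i < 1 / c.q i := by
  have hq : (0 : ℝ) < c.q i := by exact_mod_cast (c.hq i).pos
  have h : (0 : ℝ) < Nat.card (c.P i) := by exact_mod_cast Nat.card_pos
  have : (0 : ℝ) < (Nat.card (c.P i) : ℝ)⁻¹ := by positivity
  unfold y
  exact div_lt_div_of_pos_right (by linarith) hq

lemma y_sum : (1 : ℝ) = 1 / Nat.card G + ∑ i, c.y i := by
  have h := c.norm_formula (lin_isIrr (1 : G →* ℂˣ)).vg
  rw [ipZ_irr (lin_isIrr _) (lin_isIrr _), if_pos rfl] at h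
  have e : ∀ i, loc (fun x : c.P i => lin (1 : G →* ℂˣ) x) = 1 - (Nat.card (c.P i) : ℝ)⁻¹ := by
    intro i
    have hP0 : (Nat.card (c.P i) : ℝ) ≠ 0 := by exact_mod_cast Nat.card_pos.ne'
    unfold loc
    simp [lin]
    field_simp
  simp only [e] at h
  rw [show ‖lin (1 : G →* ℂˣ) 1‖ = 1 by simp [lin]] at h
  simpa [y] using h

lemma main_ineq {i : c.ι} {l : c.P i →* ℂˣ} (hl : l ≠ 1) : ∃ O : Finset c.ι, (∀ r ∈ O, r ≠ i) ∧
    ∑ r ∈ O, ((c.L r : ℝ) - 1) / c.q r ≤ c.q i - 1 ∧ 1 ≤ c.y i + c.q i / c.L i + ∑ r ∈ O, c.y r := by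
  have hex : ∀ r, ∃ a : c.P r →* ℂˣ, a ≠ 1 := by
    intro r
    have h := c.L_ge r
    have : Nontrivial (c.P r →* ℂˣ) := Fintype.one_lt_card_iff_nontrivial.1 (by unfold L at h; omega)
    exact exists_ne 1
  choose a ha using hex
  have hX := c.X_irr hl
  let O := Finset.univ.filter (fun r => r ≠ i ∧ ipZ (c.df 1 (a r)) (c.X l) = 0)
  let I := Finset.univ.filter (fun r => r ≠ i ∧ ¬ ipZ (c.df 1 (a r)) (c.X l) = 0)
  have hO : ∀ r ∈ O, r ≠ i := fun r hr => (Finset.mem_filter.1 hr).2.1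
  refine ⟨O, hO, c.out_sum hl O hO ?_, ?_⟩
  · intro r hr b hb
    have h1 := (Finset.mem_filter.1 hr).2.2
    rw [← c.m_sub hX.vg] at h1 ⊢
    rw [c.m_const (hO r hr).symm hl hb (ha r)]
    exact h1
  have split : ∀ f : c.ι → ℝ, ∑ r, f r = f i + ∑ r ∈ I, f r + ∑ r ∈ O, f r := by
    intro f
    rw [← Finset.add_sum_erase _ _ (Finset.mem_univ i), add_assoc]
    congr 1
    rw [← Finset.sum_filter_not_add_sum_filter (Finset.univ.erase i) (fun r => ipZ (c.df 1 (a r)) (c.X l) = 0)]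
    congr 1 <;>
    · apply Finset.sum_congr _ (fun _ _ => rfl)
      ext r; simp [I, O]
  have h1 := c.norm_formula hX.vg
  rw [ipZ_irr hX hX, if_pos rfl, split] at h1
  have h2 := c.y_sum
  rw [split] at h2
  have hqpos : ∀ r, (0 : ℝ) < c.q r := fun r => by exact_mod_cast (c.hq r).pos
  have hLpos : (0 : ℝ) < c.L i := by have := c.L_ge i; exact_mod_cast (by omega : 0 < c.L i)
  have hGpos : (0 : ℝ) < Nat.card G := by exact_mod_cast Nat.card_pos
  have h3 : 1 - (c.q i : ℝ) / c.L i ≤ loc (fun x : c.P i => c.X l x) / c.q i := by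
    rw [le_div_iff₀ (hqpos i)]
    refine le_trans (le_of_eq ?_) (c.loc_self hl)
    field_simp
  have h4 : ∑ r ∈ I, c.y r ≤ ∑ r ∈ I, loc (fun x : c.P r => c.X l x) / c.q r := by
    refine Finset.sum_le_sum fun r hr => ?_
    have := (Finset.mem_filter.1 hr).2
    exact div_le_div_of_nonneg_right (c.loc_in (Ne.symm this.1) hl (ha r) this.2) (hqpos r).le
  have h5 : 0 ≤ ∑ r ∈ O, loc (fun x : c.P r => c.X l x) / c.q r := by
    refine Finset.sum_nonneg fun r _ => div_nonneg ?_ (hqpos r).le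
    rw [loc_eq]; positivity
  have h6 : 1 / (Nat.card G : ℝ) ≤ ‖c.X l 1‖ ^ 2 / Nat.card G := by
    obtain ⟨d, hd, hd1⟩ := hX.one_pos
    rw [hd1]
    apply div_le_div_of_nonneg_right _ hGpos.le
    rw [Complex.norm_natCast]
    have : (1 : ℝ) ≤ d := by exact_mod_cast hd
    nlinarith
  push_cast at h1
  linarith

theorem contra (c : Cfg G) : False := by
  have hne : Nonempty c.ι := by
    obtain ⟨x, hx⟩ := @exists_ne G c.nt 1
    obtain ⟨i, _⟩ := c.cover x hx
    exact ⟨i⟩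
  obtain ⟨i, hi⟩ := Finite.exists_min c.L
  obtain ⟨l, hl⟩ : ∃ l : c.P i →* ℂˣ, l ≠ 1 := by
    have h := c.L_ge i
    have : Nontrivial (c.P i →* ℂˣ) := Fintype.one_lt_card_iff_nontrivial.1 (by unfold L at h; omega)
    exact exists_ne 1
  obtain ⟨O, hO, hs, h1⟩ := c.main_ineq hl
  have hqpos : ∀ r, (0 : ℝ) < c.q r := fun r => by exact_mod_cast (c.hq r).pos
  have hLr : ∀ r ∈ O, c.L i + 2 ≤ c.L r := by
    intro r hr
    have h2 : c.L i ≠ c.L r := fun h => hO r hr (c.L_inj h).symm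
    have h3 := hi r
    obtain ⟨a, ha⟩ := c.L_odd i
    obtain ⟨b, hb⟩ := c.L_odd r
    omega
  obtain ⟨w, hLw, hw2, hwe⟩ := c.exists_w i
  have hyi := c.y_lt i
  have hq3 : (3 : ℝ) ≤ c.q i := by exact_mod_cast c.q_ge i
  -- generic bound
  have bound : ∀ B : ℝ, 0 < B → (∀ r ∈ O, B ≤ c.L r - 1) → ∑ r ∈ O, c.y r ≤ (c.q i - 1) / B := by
    intro B hB hB2
    rw [le_div_iff₀ hB, Finset.sum_mul]
    refine le_trans (Finset.sum_le_sum fun r hr => ?_) hs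
    have h2 := (c.y_lt r).le
    have h3 := hB2 r hr
    calc c.y r * B ≤ 1 / c.q r * (c.L r - 1) := mul_le_mul h2 h3 hB.le (by have := hqpos r; positivity)
      _ = _ := by ring
  have hLR : (c.L i : ℝ) = c.q i * w + 1 := by exact_mod_cast hLw
  have gb := bound (c.L i + 1) (by positivity) (fun r hr => by
    have := hLr r hr
    have : ((c.L i + 2 : ℕ) : ℝ) ≤ c.L r := by exact_mod_cast this
    push_cast at this; linarith)
  rw [hLR] at gb h1
  set q : ℝ := (c.q i : ℝ) with hq
  by_cases hw4 : 4 ≤ w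
  · have hw : (4 : ℝ) ≤ w := by exact_mod_cast hw4
    have a1 : 1 / q ≤ 1 / 3 := one_div_le_one_div_of_le (by norm_num) hq3
    have a2 : q / (q * w + 1) ≤ 1 / 4 := by
      rw [div_le_div_iff₀ (by positivity) (by norm_num)]; nlinarith
    have a3 : (q - 1) / (q * w + 1 + 1) ≤ 1 / 4 := by
      rw [div_le_div_iff₀ (by positivity) (by norm_num)]; nlinarith
    linarith
  have hw' : w = 2 := by
    obtain ⟨k, rfl⟩ := hwe
    omega
  subst hw'
  push_cast at gb h1
  by_cases hq5 : 5 ≤ c.q i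
  · have hq5' : (5 : ℝ) ≤ q := by rw [hq]; exact_mod_cast hq5
    have : 1 / q + q / (q * 2 + 1) + (q - 1) / (q * 2 + 1 + 1) ≤ 1 := by
      rw [div_add_div _ _ (by positivity) (by positivity), div_add_div _ _ (by positivity) (by positivity),
        div_le_one (by positivity)]
      nlinarith [mul_nonneg (by linarith : (0:ℝ) ≤ q) (by linarith : (0:ℝ) ≤ q - 5)]
    linarith
  · have hq3' : c.q i = 3 := by
      have := c.q_ge i
      obtain ⟨k, hk⟩ := c.q_odd i
      omega
    have hqq : q = 3 := by rw [hq, hq3']; norm_num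
    have b2 := bound 10 (by norm_num) (fun r hr => by
      obtain ⟨v, hv, hv2, _⟩ := c.exists_w r
      have h3 := hLr r hr
      rw [hLw, hq3', hv] at h3
      have h4 : ((c.L r : ℝ) - 1) / c.q r ≤ q - 1 := by
        refine le_trans ?_ hs
        refine Finset.single_le_sum (f := fun r => ((c.L r : ℝ) - 1) / c.q r) (fun s _ => ?_) hr
        have : (3 : ℝ) ≤ c.L s := by exact_mod_cast c.L_ge s
        have := hqpos s
        exact div_nonneg (by linarith) this.le
      have hvR : (c.L r : ℝ) = c.q r * v + 1 := by exact_mod_cast hv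
      have h5 : ((c.L r : ℝ) - 1) / c.q r = v := by
        rw [hvR]; have := hqpos r; field_simp; ring
      rw [h5, hqq] at h4
      have h6 : v ≤ 2 := by
        have : (v : ℝ) ≤ 2 := by linarith
        exact_mod_cast this
      have h7 : v = 2 := by omega
      subst h7
      obtain ⟨k, hk⟩ := c.q_odd r
      have h8 : 5 ≤ c.q r := by omega
      have : (5 : ℝ) ≤ c.q r := by exact_mod_cast h8
      rw [hvR]; push_cast; linarith)
    have hy3 : c.y i < 1 / 3 := by rw [← hqq]; exact hyi
    rw [hqq] at h1 b2
    norm_num at h1 b2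
    linarith

end Cfg
end D
end EPOA5

namespace EPOA5
open scoped Classical BigOperators

theorem ns_odd : ∀ (n : ℕ) (G : Type) [Group G] [Finite G] [Nontrivial G], Nat.card G = n → EPO G → Odd (Nat.card G) → NS G := by
  intro n
  induction n using Nat.strong_induction_on with
  | _ n ih =>
  intro G _ _ _ hn h hodd
  by_cases hno : ∀ p : ℕ, p.Prime → ∀ Q : Subgroup G, Q.Normal → IsPGroup p Q → Q = ⊥
  · have hmin : ∀ H : Subgroup G, H ≠ ⊤ → H ≠ ⊥ → NS H := by
      intro H ht hb
      have : Nontrivial H := (Subgroup.nontrivial_iff_ne_bot _).2 hb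
      have hlt : Nat.card H < n := by
        rw [← hn]
        refine lt_of_le_of_ne (Nat.le_of_dvd Nat.card_pos H.card_subgroup_dvd_card) ?_
        intro he; exact ht (Subgroup.card_eq_iff_eq_top H |>.1 he)
      exact ih _ hlt H rfl (h.sub H) (hodd.of_dvd_nat H.card_subgroup_dvd_card)
    obtain ⟨c⟩ := cfg_of_min h hodd hmin hno
    have := Fintype.ofFinite G
    exact c.contra.elim
  · push Not at hno
    obtain ⟨p, hp, Q, hQ, hQp, hQ1⟩ := hno
    by_cases htop : Q = ⊤
    · refine ⟨p, hp, Q, hQ, hQp, hQ1, ?_⟩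
      rw [htop]; simp
    · have hnt : Nontrivial (G ⧸ Q) := QuotientGroup.nontrivial_iff.2 htop
      have hlt : Nat.card (G ⧸ Q) < n := by
        rw [← hn, ← Q.card_mul_index]
        have h1 : 1 < Nat.card Q := by
          have : Nontrivial Q := (Subgroup.nontrivial_iff_ne_bot _).2 hQ1
          exact Finite.one_lt_card
        have h2 : 0 < Q.index := Nat.pos_of_ne_zero Subgroup.index_ne_zero_of_finite
        show Q.index < _
        nlinarith
      refine h.ns_of_quot hp hQp hQ1 (ih _ hlt (G ⧸ Q) rfl (h.of_surj (QuotientGroup.mk' Q) (QuotientGroup.mk'_surjective Q)) ?_)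
      exact hodd.of_dvd_nat (Subgroup.card_quotient_dvd_card Q)

theorem odd_two {G : Type} [Group G] [Finite G] (h : EPO G) (hodd : Odd (Nat.card G)) : (Nat.card G).primeFactors.card ≤ 2 := by
  rcases subsingleton_or_nontrivial G with hs | hs
  · rw [Nat.card_unique]; simp
  · obtain ⟨p, hp, P, h1, h2, h3, h4⟩ := ns_odd _ G rfl h hodd
    exact h.two_primes hp h1 h2 h3 h4

end EPOA5

namespace EPOA5
open scoped Classical BigOperators
section E
variable {G : Type*} [Group G]

lemma ord_conj (g x : G) : orderOf (g * x * g⁻¹) = orderOf x := by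
  have := orderOf_injective (MulAut.conj g).toMonoidHom (MulAut.conj g).injective x
  simpa using this

lemma conj_ne_one {g x : G} (hx : x ≠ 1) : g * x * g⁻¹ ≠ 1 := fun h => hx (by
    have : x = g⁻¹ * (g * x * g⁻¹) * g := by group
    rw [this, h]; group)

lemma EPO.cent (h : EPO G) {p : ℕ} (hp : p.Prime) (R : Sylow p G) (hR : ∀ a ∈ R, ∀ b ∈ R, a * b = b * a)
    {x g : G} (hx : x ∈ R) (hx1 : x ≠ 1) (hg : g * x = x * g) : g ∈ R := by
  have hH : IsPGroup p (Subgroup.centralizer ({x} : Set G)) := by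
    rintro ⟨y, hy⟩
    by_cases hy1 : y = 1
    · exact ⟨0, by simpa using hy1⟩
    refine ⟨1, ?_⟩
    have hc : Commute x y := (Subgroup.mem_centralizer_singleton_iff.1 hy).symm
    have h2 := h.comm hx1 hy1 hc
    rw [h.order_p hp R.isPGroup' hx hx1] at h2
    apply Subtype.ext
    simp only [pow_one, Subgroup.coe_pow, Subgroup.coe_one]
    rw [h2, pow_orderOf_eq_one]
  have hle : (R : Subgroup G) ≤ Subgroup.centralizer ({x} : Set G) := by
    intro y hy
    rw [Subgroup.mem_centralizer_singleton_iff]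
    exact hR y hy x hx
  have h3 := R.is_maximal' hH hle
  have : g ∈ (R : Subgroup G) := by
    rw [← h3, Subgroup.mem_centralizer_singleton_iff]
    exact hg
  exact this

lemma EPO.ti_half (h : EPO G) {p : ℕ} (hp : p.Prime) (R : Sylow p G) (hR : ∀ a ∈ R, ∀ b ∈ R, a * b = b * a)
    {x g r : G} (hx : x ∈ R) (hx1 : x ≠ 1) (hg : g * x * g⁻¹ ∈ R) (hr : r ∈ R) : g * r * g⁻¹ ∈ R := by
  apply h.cent hp R hR hg (conj_ne_one hx1)
  have := hR r hr x hx
  have e1 : g * r * g⁻¹ * (g * x * g⁻¹) = g * (r * x) * g⁻¹ := by group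
  have e2 : (g * x * g⁻¹) * (g * r * g⁻¹) = g * (x * r) * g⁻¹ := by group
  rw [e1, e2, this]

lemma EPO.tiR (h : EPO G) {p : ℕ} (hp : p.Prime) (R : Sylow p G) (hR : ∀ a ∈ R, ∀ b ∈ R, a * b = b * a)
    {x g : G} (hx : x ∈ R) (hx1 : x ≠ 1) (hg : g * x * g⁻¹ ∈ R) : g ∈ Subgroup.normalizer (R : Set G) := by
  rw [Subgroup.mem_set_normalizer_iff]
  intro r
  refine ⟨fun hr => h.ti_half hp R hR hx hx1 hg hr, fun hr => ?_⟩
  have := h.ti_half hp R hR (x := g * x * g⁻¹) (g := g⁻¹) (r := g * r * g⁻¹) hg (conj_ne_one hx1)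
    (by have : g⁻¹ * (g * x * g⁻¹) * g⁻¹⁻¹ = x := by group
        rwa [this]) hr
  have e : g⁻¹ * (g * r * g⁻¹) * g⁻¹⁻¹ = r := by group
  rwa [e] at this

lemma exists_conj_mem [Finite G] {p : ℕ} (hp : p.Prime) (R : Sylow p G) {y : G} (hy : orderOf y = p) :
    ∃ g : G, g * y * g⁻¹ ∈ R := by
  have := Fact.mk hp
  have hz : IsPGroup p (Subgroup.zpowers y) := IsPGroup.of_card (n := 1) (by rw [Nat.card_zpowers, hy, pow_one])
  obtain ⟨Q, hQ⟩ := hz.exists_le_sylow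
  obtain ⟨g, hg⟩ := MulAction.exists_smul_eq G Q R
  refine ⟨g, ?_⟩
  rw [← hg]
  have : y ∈ Q := hQ (Subgroup.mem_zpowers y)
  have h2 : g * y * g⁻¹ ∈ (g • Q : Sylow p G).toSubgroup := by
    rw [Sylow.coe_subgroup_smul]
    have := Subgroup.smul_mem_pointwise_smul y (MulAut.conj g) Q.toSubgroup this
    simpa using this
  exact h2

lemma EPO.count_conj [Fintype G] (h : EPO G) {p : ℕ} (hp : p.Prime) (R : Sylow p G)
    (hR : ∀ a ∈ R, ∀ b ∈ R, a * b = b * a) {y : G} (hy : orderOf y = p) :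
    (Finset.univ.filter (fun g : G => g * y * g⁻¹ ∈ R)).card = Nat.card (Subgroup.normalizer (R : Set G)) := by
  obtain ⟨g0, h0⟩ := exists_conj_mem hp R hy
  have hy1 : y ≠ 1 := by rintro rfl; rw [orderOf_one] at hy; exact hp.ne_one hy.symm
  rw [Nat.card_eq_fintype_card, ← Finset.card_univ]
  symm
  refine Finset.card_bij (fun n _ => (n : G) * g0) ?_ ?_ ?_
  · intro n _
    simp only [Finset.mem_filter, Finset.mem_univ, true_and]
    have := (Subgroup.mem_set_normalizer_iff.1 n.2 (g0 * y * g0⁻¹)).1 h0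
    simpa [mul_assoc] using this
  · intro a _ b _ h
    exact Subtype.ext (mul_right_cancel h)
  · intro g hg
    simp only [Finset.mem_filter, Finset.mem_univ, true_and] at hg
    have hn : g * g0⁻¹ ∈ Subgroup.normalizer (R : Set G) := by
      apply h.tiR hp R hR h0 (conj_ne_one hy1)
      have : g * g0⁻¹ * (g0 * y * g0⁻¹) * (g * g0⁻¹)⁻¹ = g * y * g⁻¹ := by group
      rwa [this]
    exact ⟨⟨_, hn⟩, Finset.mem_univ _, by simp⟩

lemma EPO.card_ord_in [Fintype G] (h : EPO G) {p : ℕ} (hp : p.Prime) (R : Sylow p G) (g : G) :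
    (Finset.univ.filter (fun y : G => orderOf y = p ∧ g * y * g⁻¹ ∈ R)).card + 1 = Nat.card R := by
  rw [Nat.card_eq_fintype_card, ← Finset.card_univ, ← Finset.card_erase_add_one (Finset.mem_univ (1 : R))]
  congr 1
  symm
  refine Finset.card_bij (fun n _ => g⁻¹ * (n : G) * g⁻¹⁻¹) ?_ ?_ ?_
  · intro n hn
    have hn1 : (n : G) ≠ 1 := by simpa using hn
    simp only [Finset.mem_filter, Finset.mem_univ, true_and]
    rw [ord_conj]
    refine ⟨h.order_p hp R.isPGroup' n.2 hn1, ?_⟩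
    have : g * (g⁻¹ * (n : G) * g⁻¹⁻¹) * g⁻¹ = n := by group
    rw [this]; exact n.2
  · intro a _ b _ h
    exact Subtype.ext (mul_left_cancel (mul_right_cancel h))
  · intro y hy
    simp only [Finset.mem_filter, Finset.mem_univ, true_and] at hy
    refine ⟨⟨_, hy.2⟩, ?_, by group⟩
    have hy1 : y ≠ 1 := by rintro rfl; rw [orderOf_one] at hy; exact hp.ne_one hy.1.symm
    simp only [Finset.mem_erase, Finset.mem_univ, and_true]
    intro h2
    exact conj_ne_one (g := g) hy1 (congrArg Subtype.val h2)

theorem EPO.count_ord [Fintype G] (h : EPO G) {p : ℕ} (hp : p.Prime) (R : Sylow p G)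
    (hR : ∀ a ∈ R, ∀ b ∈ R, a * b = b * a) :
    (Finset.univ.filter (fun y : G => orderOf y = p)).card * Nat.card (Subgroup.normalizer (R : Set G))
      = (Nat.card R - 1) * Nat.card G := by
  have key := Finset.sum_card_bipartiteAbove_eq_sum_card_bipartiteBelow (s := Finset.univ.filter (fun y : G => orderOf y = p))
    (t := (Finset.univ : Finset G)) (fun y g => g * y * g⁻¹ ∈ R)
  rw [Finset.sum_congr rfl (g := fun _ => Nat.card (Subgroup.normalizer (R : Set G))),
    Finset.sum_congr (s₁ := Finset.univ) rfl (g := fun _ => Nat.card R - 1)] at key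
  · rw [Finset.sum_const, Finset.sum_const, smul_eq_mul, smul_eq_mul, Finset.card_univ] at key
    rw [key, Nat.card_eq_fintype_card (α := G), mul_comm]
  · intro g _
    have := h.card_ord_in hp R g
    rw [Finset.bipartiteBelow, Finset.filter_filter]
    omega
  · intro y hy
    exact h.count_conj hp R hR (by simpa using hy)

end E
end EPOA5

namespace EPOA5
open scoped Classical BigOperators
section E
variable {G : Type*} [Group G]

lemma EPO.N_index [Finite G] (h : EPO G) {p : ℕ} (hp : p.Prime) (R : Sylow p G) (hR1 : (R : Subgroup G) ≠ ⊥) :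
    ∃ d : ℕ, (d = 1 ∨ d.Prime) ∧ p.Coprime d ∧ Nat.card (Subgroup.normalizer (R : Set G)) = d * Nat.card R := by
  have := Fact.mk hp
  set N := Subgroup.normalizer (R : Set G)
  have hle : (R : Subgroup G) ≤ N := Subgroup.le_normalizer
  have hcard : Nat.card ((R : Subgroup G).subgroupOf N) = Nat.card R :=
    Nat.card_congr (Subgroup.subgroupOfEquivOfLe hle).toEquiv
  have hmul := Subgroup.index_mul_card ((R : Subgroup G).subgroupOf N)
  have hc : p.Coprime ((R : Subgroup G).subgroupOf N).index := by
    rw [Nat.Prime.coprime_iff_not_dvd hp]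
    intro hd
    have h1 : ((R : Subgroup G).subgroupOf N).index ∣ (R : Subgroup G).index := Subgroup.relIndex_dvd_index_of_le hle
    exact R.not_dvd_index (hd.trans h1)
  refine ⟨_, (h.sub N).normal_index hp ?_ ?_ ?_ hc, hc, ?_⟩
  · exact Subgroup.normal_in_normalizer
  · exact R.isPGroup'.comap_subtype
  · intro h0
    apply hR1
    rw [← Subgroup.card_eq_one, ← hcard, h0]
    simp
  · rw [← hcard, hmul]

lemma EPO.s2comm (h : EPO G) (S : Sylow 2 G) : ∀ a ∈ S, ∀ b ∈ S, a * b = b * a := by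
  intro a ha b hb
  have e : ∀ a ∈ S, a⁻¹ = a := by
    intro a ha
    have := h.pow_p Nat.prime_two S.isPGroup' ha
    rw [pow_two] at this
    exact inv_eq_of_mul_eq_one_left this
  have h1 := e _ (mul_mem ha hb)
  rw [mul_inv_rev, e a ha, e b hb] at h1
  exact h1.symm

lemma inv_of_ord2 {u : G} (hu : orderOf u = 2) : u⁻¹ = u := by
  have := pow_orderOf_eq_one u
  rw [hu, pow_two] at this
  exact inv_eq_of_mul_eq_one_left this

lemma ne_one_of_ord {p : ℕ} (hp : p.Prime) {u : G} (hu : orderOf u = p) : u ≠ 1 := by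
  rintro rfl; rw [orderOf_one] at hu; exact hp.ne_one hu.symm

lemma EPO.ctrans [Finite G] (h : EPO G) {u v w : G} (hv : orderOf v = 2)
    (h1 : u * v = v * u) (h2 : w * v = v * w) : u * w = w * u := by
  obtain ⟨S⟩ : Nonempty (Sylow 2 G) := inferInstance
  obtain ⟨g, hg⟩ := exists_conj_mem Nat.prime_two S hv
  have hv1 := ne_one_of_ord Nat.prime_two hv
  have key : ∀ u, u * v = v * u → g * u * g⁻¹ ∈ S := by
    intro u hu
    apply h.cent Nat.prime_two S (h.s2comm S) hg (conj_ne_one hv1)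
    have e1 : g * u * g⁻¹ * (g * v * g⁻¹) = g * (u * v) * g⁻¹ := by group
    have e2 : (g * v * g⁻¹) * (g * u * g⁻¹) = g * (v * u) * g⁻¹ := by group
    rw [e1, e2, hu]
  have h3 := h.s2comm S _ (key u h1) _ (key w h2)
  have e1 : g * u * g⁻¹ * (g * w * g⁻¹) = g * (u * w) * g⁻¹ := by group
  have e2 : (g * w * g⁻¹) * (g * u * g⁻¹) = g * (w * u) * g⁻¹ := by group
  rw [e1, e2] at h3
  exact mul_left_cancel (mul_right_cancel h3)

lemma inv_conj_pow {u x : G} (hu : u * x * u⁻¹ = x⁻¹) (k : ℕ) : x ^ k * u * (x ^ k)⁻¹ = x ^ (2 * k) * u := by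
  have h1 : u * (x ^ k)⁻¹ * u⁻¹ = x ^ k := by
    have : (u * x * u⁻¹) ^ k = u * x ^ k * u⁻¹ := conj_pow
    rw [hu] at this
    have e : u * (x ^ k)⁻¹ * u⁻¹ = (u * x ^ k * u⁻¹)⁻¹ := by group
    rw [e, ← this, inv_pow, inv_inv]
  calc x ^ k * u * (x ^ k)⁻¹ = x ^ k * (u * (x ^ k)⁻¹ * u⁻¹) * u := by group
    _ = _ := by rw [h1, two_mul, pow_add]

lemma EPO.conj_of_nc (h : EPO G) {u v : G} (hu : orderOf u = 2) (hv : orderOf v = 2) (hn : u * v ≠ v * u) :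
    ∃ g : G, g * u * g⁻¹ = v := by
  have hui := inv_of_ord2 hu
  have hvi := inv_of_ord2 hv
  have huu : u * u = 1 := by nth_rewrite 1 [← hui]; simp
  have hvv : v * v = 1 := by nth_rewrite 1 [← hvi]; simp
  have hx1 : u * v ≠ 1 := by
    intro h1
    apply hn
    have : v = u := by rw [← hui]; exact eq_inv_of_mul_eq_one_right h1
    rw [this]
  have hpr := h _ hx1
  have hinv : u * (u * v) * u⁻¹ = (u * v)⁻¹ := by
    rw [mul_inv_rev, hui, hvi, ← mul_assoc, huu, one_mul]
  rcases hpr.eq_two_or_odd' with h2 | ⟨n, hnn⟩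
  · exfalso
    have := inv_of_ord2 h2
    rw [mul_inv_rev, hui, hvi] at this
    exact hn this.symm
  · refine ⟨(u * v) ^ n, ?_⟩
    rw [inv_conj_pow hinv]
    have h1 : (u * v) ^ (2 * n) * (u * v) = 1 := by
      rw [← pow_succ, ← hnn, pow_orderOf_eq_one]
    rw [eq_inv_of_mul_eq_one_left h1, mul_inv_rev, hui, hvi, mul_assoc, huu, mul_one]

lemma EPO.exists_nc [Finite G] (h : EPO G) (S : Sylow 2 G) (hS : ¬ (S : Subgroup G).Normal) {u : G} (hu : orderOf u = 2) :
    ∃ w : G, orderOf w = 2 ∧ u * w ≠ w * u := by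
  by_contra hcon
  push Not at hcon
  apply hS
  obtain ⟨g0, hg⟩ := exists_conj_mem Nat.prime_two S hu
  have hu1 := ne_one_of_ord Nat.prime_two hu
  constructor
  intro s hs g
  by_cases hs1 : s = 1
  · subst hs1; simp
  have hs2 := h.order_p Nat.prime_two S.isPGroup' hs hs1
  apply h.cent Nat.prime_two S (h.s2comm S) hg (conj_ne_one hu1)
  have := hcon (g0⁻¹ * (g * s * g⁻¹) * g0⁻¹⁻¹) (by rw [ord_conj, ord_conj]; exact hs2)
  have e1 : g * s * g⁻¹ * (g0 * u * g0⁻¹) = g0 * ((g0⁻¹ * (g * s * g⁻¹) * g0⁻¹⁻¹) * u) * g0⁻¹ := by group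
  have e2 : (g0 * u * g0⁻¹) * (g * s * g⁻¹) = g0 * (u * (g0⁻¹ * (g * s * g⁻¹) * g0⁻¹⁻¹)) * g0⁻¹ := by group
  rw [e1, e2, this]

theorem EPO.inv_conj [Finite G] (h : EPO G) (S : Sylow 2 G) (hS : ¬ (S : Subgroup G).Normal) {u v : G}
    (hu : orderOf u = 2) (hv : orderOf v = 2) : ∃ g : G, g * u * g⁻¹ = v := by
  by_cases hc : u * v = v * u
  · obtain ⟨w, hw, hn⟩ := h.exists_nc S hS hu
    obtain ⟨g1, hg1⟩ := h.conj_of_nc hu hw hn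
    obtain ⟨g2, hg2⟩ := h.conj_of_nc hw hv (fun h2 => hn (h.ctrans hv hc h2))
    exact ⟨g2 * g1, by rw [← hg2, ← hg1]; group⟩
  · exact h.conj_of_nc hu hv hc

lemma card_transporter [Fintype G] {u t : G} {g0 : G} (h0 : g0 * u * g0⁻¹ = t) (H : Subgroup G)
    (hH : ∀ g, g ∈ H ↔ g * t = t * g) :
    (Finset.univ.filter (fun g : G => g * u * g⁻¹ = t)).card = Nat.card H := by
  rw [Nat.card_eq_fintype_card, ← Finset.card_univ]
  symm
  refine Finset.card_bij (fun n _ => (n : G) * g0) ?_ ?_ ?_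
  · intro n _
    simp only [Finset.mem_filter, Finset.mem_univ, true_and]
    have := (hH n).1 n.2
    have e : (n : G) * g0 * u * ((n : G) * g0)⁻¹ = n * (g0 * u * g0⁻¹) * (n : G)⁻¹ := by group
    rw [e, h0, this]; group
  · intro a _ b _ h
    exact Subtype.ext (mul_right_cancel h)
  · intro g hg
    simp only [Finset.mem_filter, Finset.mem_univ, true_and] at hg
    have hn : g * g0⁻¹ ∈ H := by
      rw [hH]
      nth_rewrite 1 [← h0]
      rw [← hg]; group
    exact ⟨⟨_, hn⟩, Finset.mem_univ _, by simp⟩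

lemma EPO.cent_iff (h : EPO G) {p : ℕ} (hp : p.Prime) (R : Sylow p G) (hR : ∀ a ∈ R, ∀ b ∈ R, a * b = b * a)
    {x : G} (hx : x ∈ R) (hx1 : x ≠ 1) (g : G) : g ∈ (R : Subgroup G) ↔ g * x = x * g :=
  ⟨fun hg => hR g hg x hx, fun hg => h.cent hp R hR hx hx1 hg⟩

theorem EPO.J_card [Fintype G] (h : EPO G) (S : Sylow 2 G) (hS : ¬ (S : Subgroup G).Normal) {t : G} (htS : t ∈ S) (ht1 : t ≠ 1) :
    (Finset.univ.filter (fun y : G => orderOf y = 2)).card * Nat.card S = Nat.card G := by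
  have ht := h.order_p Nat.prime_two S.isPGroup' htS ht1
  have key := Finset.sum_card_bipartiteAbove_eq_sum_card_bipartiteBelow (s := Finset.univ.filter (fun y : G => orderOf y = 2))
    (t := (Finset.univ : Finset G)) (fun y g => g * y * g⁻¹ = t)
  rw [Finset.sum_congr rfl (g := fun _ => Nat.card S),
    Finset.sum_congr (s₁ := Finset.univ) rfl (g := fun _ => 1)] at key
  · rw [Finset.sum_const, Finset.sum_const, smul_eq_mul, smul_eq_mul, Finset.card_univ] at key
    rw [key, Nat.card_eq_fintype_card (α := G), mul_one]
  · intro g _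
    rw [Finset.bipartiteBelow, Finset.filter_filter, Finset.card_eq_one]
    refine ⟨g⁻¹ * t * g⁻¹⁻¹, ?_⟩
    ext y
    simp only [Finset.mem_filter, Finset.mem_univ, true_and, Finset.mem_singleton]
    constructor
    · rintro ⟨-, rfl⟩; group
    · rintro rfl
      rw [ord_conj]
      exact ⟨ht, by group⟩
  · intro y hy
    obtain ⟨g0, h0⟩ := h.inv_conj S hS (by simpa using hy) ht
    exact card_transporter h0 S (h.cent_iff Nat.prime_two S (h.s2comm S) htS ht1)

theorem EPO.N_card [Fintype G] (h : EPO G) (S : Sylow 2 G) (hS : ¬ (S : Subgroup G).Normal) {t : G} (htS : t ∈ S) (ht1 : t ≠ 1) :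
    Nat.card (Subgroup.normalizer (S : Set G)) = (Nat.card S - 1) * Nat.card S := by
  have ht := h.order_p Nat.prime_two S.isPGroup' htS ht1
  have h1 := h.J_card S hS htS ht1
  have h2 := h.count_ord Nat.prime_two S (h.s2comm S)
  have hJ : 0 < (Finset.univ.filter (fun y : G => orderOf y = 2)).card := Finset.card_pos.2 ⟨t, by simpa using ht⟩
  rw [← h1] at h2
  apply Nat.eq_of_mul_eq_mul_left hJ
  rw [h2]; ring

theorem EPO.q_cases [Fintype G] (h : EPO G) (S : Sylow 2 G) (hS : ¬ (S : Subgroup G).Normal) {t : G} (htS : t ∈ S) (ht1 : t ≠ 1) :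
    Nat.card S = 2 ∨ (Nat.card S - 1).Prime := by
  have hb : (S : Subgroup G) ≠ ⊥ := fun h0 => ht1 (by
    have : t ∈ (S : Subgroup G) := htS
    rw [h0] at this; simpa using this)
  obtain ⟨d, hd, -, hN⟩ := h.N_index Nat.prime_two S hb
  rw [h.N_card S hS htS ht1] at hN
  have := Nat.eq_of_mul_eq_mul_right Nat.card_pos hN
  rcases hd with hd | hd
  · left; omega
  · right; rwa [this]

end E
end EPOA5

namespace EPOA5
open scoped Classical BigOperators
section E
variable {G : Type*} [Group G]

lemma invert_of_fpf [Finite G] {t : G} (ht : orderOf t = 2) (H : Subgroup G) (hn : ∀ x ∈ H, t * x * t⁻¹ ∈ H)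
    (hf : ∀ x ∈ H, t * x = x * t → x = 1) : ∀ x ∈ H, t * x * t⁻¹ = x⁻¹ := by
  let φ : H →* H := MonoidHom.mk' (fun x => ⟨t * x * t⁻¹, hn x x.2⟩) (by
    intro a b; apply Subtype.ext; simp)
  have h1 : MonoidHom.FixedPointFree φ := by
    intro x hx
    have h2 : t * (x : G) * t⁻¹ = x := congrArg Subtype.val hx
    apply Subtype.ext
    exact hf x x.2 (mul_inv_eq_iff_eq_mul.1 h2)
  have h2 : Function.Involutive φ := by
    intro x
    apply Subtype.ext
    change t * (t * (x : G) * t⁻¹) * t⁻¹ = x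
    have ht2 := inv_of_ord2 ht
    have e : t * (t * (x : G) * t⁻¹) * t⁻¹ = (t * t) * x * (t⁻¹ * t⁻¹) := by group
    have e2 : t * t = 1 := by nth_rewrite 1 [← ht2]; simp
    rw [e, ht2, e2]; simp
  intro x hx
  have h3 := congrFun (h1.coe_eq_inv_of_involutive h2) ⟨x, hx⟩
  exact congrArg Subtype.val h3

lemma comm_of_invert {t : G} (H : Subgroup G) (hi : ∀ x ∈ H, t * x * t⁻¹ = x⁻¹) :
    ∀ a ∈ H, ∀ b ∈ H, a * b = b * a := by
  intro a ha b hb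
  have h1 := hi _ (H.mul_mem ha hb)
  have e : t * (a * b) * t⁻¹ = (t * a * t⁻¹) * (t * b * t⁻¹) := by group
  rw [e, hi a ha, hi b hb, ← mul_inv_rev, inv_inj] at h1
  exact h1.symm

theorem EPO.q_two [Finite G] (h : EPO G) (S : Sylow 2 G) {t : G} (htS : t ∈ S) (ht1 : t ≠ 1)
    (hq : Nat.card S = 2) (hN : Nat.card (Subgroup.normalizer (S : Set G)) = 2) :
    (Nat.card G).primeFactors.card ≤ 2 := by
  have ht := h.order_p Nat.prime_two S.isPGroup' htS ht1
  have hNS : (S : Subgroup G) = Subgroup.normalizer (S : Set G) :=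
    Subgroup.eq_of_le_of_card_ge Subgroup.le_normalizer (by rw [hN]; exact hq.ge)
  have hP : Subgroup.normalizer (S : Set G) ≤ Subgroup.centralizer (S : Set G) := by
    rw [← hNS]
    intro a ha
    rw [Subgroup.mem_centralizer_iff]
    intro b hb
    exact h.s2comm S b hb a ha
  have hc := MonoidHom.ker_transferSylow_isComplement' S hP
  have hnd := MonoidHom.not_dvd_card_ker_transferSylow S hP
  have hmul := hc.card_mul_card
  set K := (MonoidHom.transferSylow S hP).ker with hK
  have hKn : K.Normal := MonoidHom.normal_ker _
  have hi := invert_of_fpf ht K (fun x hx => hKn.conj_mem x hx t) (by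
    intro x hx hc
    by_contra hx1
    have h2 := h.comm ht1 hx1 hc
    have h3 : orderOf x ∣ Nat.card K := Subgroup.orderOf_dvd_natCard K hx
    rw [← h2, ht] at h3
    exact hnd h3)
  have hcomm := comm_of_invert K hi
  have hpk : ∃ p : ℕ, p.Prime ∧ IsPGroup p K := by
    by_cases hb : K = ⊥
    · refine ⟨2, Nat.prime_two, ?_⟩
      rw [hb]; exact IsPGroup.of_bot
    · obtain ⟨x, hx⟩ := (Subgroup.ne_bot_iff_exists_ne_one).1 hb
      have hx1 : (x : G) ≠ 1 := by simpa using hx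
      refine ⟨_, h x hx1, ?_⟩
      intro y
      by_cases hy1 : (y : G) = 1
      · exact ⟨0, by simpa using hy1⟩
      refine ⟨1, Subtype.ext ?_⟩
      have h2 := h.comm hx1 hy1 (hcomm x x.2 y y.2)
      simp only [pow_one, Subgroup.coe_pow, Subgroup.coe_one]
      rw [h2, pow_orderOf_eq_one]
  obtain ⟨p, hp, hpK⟩ := hpk
  have := Fact.mk hp
  obtain ⟨n, hn⟩ := IsPGroup.iff_card.1 hpK
  rw [hn] at hmul
  have : (Nat.card G).primeFactors ⊆ {p, 2} := by
    intro r hr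
    have hrp := Nat.prime_of_mem_primeFactors hr
    have hrd := Nat.dvd_of_mem_primeFactors hr
    rw [← hmul, hq] at hrd
    rcases (Nat.Prime.dvd_mul hrp).1 hrd with h1 | h1
    · have := (Nat.prime_dvd_prime_iff_eq hrp hp).1 (hrp.dvd_of_dvd_pow h1)
      simp [this]
    · have := (Nat.prime_dvd_prime_iff_eq hrp Nat.prime_two).1 h1
      simp [this]
  exact (Finset.card_le_card this).trans Finset.card_le_two

/-- real prime analysis -/
theorem EPO.real_sylow [Finite G] (h : EPO G) {r : ℕ} (hr : r.Prime) (hr2 : r ≠ 2) {x t : G} (hx : orderOf x = r)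
    (ht : orderOf t = 2) (hi : t * x * t⁻¹ = x⁻¹) (R : Sylow r G) :
    (∀ a ∈ R, ∀ b ∈ R, a * b = b * a) ∧ Nat.card (Subgroup.normalizer (R : Set G)) = 2 * Nat.card R ∧
     3 ≤ Nat.card R ∧ ∀ y : G, orderOf y = r → ∃ u : G, orderOf u = 2 ∧ u * y * u⁻¹ = y⁻¹ := by
  have := Fact.mk hr
  have ht1 := ne_one_of_ord Nat.prime_two ht
  have main : ∃ (R : Sylow r G) (t : G), orderOf t = 2 ∧ ∀ y ∈ R, t * y * t⁻¹ = y⁻¹ := by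
    have hx1 := ne_one_of_ord hr hx
    have hnofix : ∀ y : G, orderOf y = r → t * y ≠ y * t := by
      intro y hy hc
      have := h.comm ht1 (ne_one_of_ord hr hy) hc
      rw [ht, hy] at this
      exact hr2 this.symm
    -- centralizer of x inverted
    have hC := invert_of_fpf ht (Subgroup.centralizer ({x} : Set G)) (by
        intro y hy
        rw [Subgroup.mem_centralizer_singleton_iff] at hy ⊢
        have h1 : y * x⁻¹ = x⁻¹ * y := by
          have : Commute y x := hy
          exact this.inv_right
        have e1 : t * y * t⁻¹ * x = t * (y * (t⁻¹ * x * t)) * t⁻¹ := by group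
        have e2 : x * (t * y * t⁻¹) = t * ((t⁻¹ * x * t) * y) * t⁻¹ := by group
        have e3 : t⁻¹ * x * t = x⁻¹ := by
          have := inv_of_ord2 ht
          rw [← hi]; rw [this]
        rw [e1, e2, e3, h1]) (by
        intro y hy hc
        by_contra hy1
        rw [Subgroup.mem_centralizer_singleton_iff] at hy
        have := h.comm hy1 hx1 hy
        exact hnofix y (by rw [this, hx]) hc)
    have hz : IsPGroup r (Subgroup.zpowers x) := IsPGroup.of_card (n := 1) (by rw [Nat.card_zpowers, hx, pow_one])
    obtain ⟨R, hR⟩ := hz.exists_le_sylow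
    have hxR : x ∈ R := hR (Subgroup.mem_zpowers x)
    have : Nontrivial R := ⟨⟨⟨x, hxR⟩, 1, fun h => hx1 (congrArg Subtype.val h)⟩⟩
    have hcn := IsPGroup.center_nontrivial R.isPGroup'
    obtain ⟨z, hz1⟩ := exists_ne (1 : Subgroup.center R)
    have hzR : ((z : R) : G) ∈ R := (z : R).2
    set z' : G := ((z : R) : G) with hz'
    have hz1' : z' ≠ 1 := by
      intro h0; apply hz1; apply Subtype.ext; apply Subtype.ext; exact h0
    have hzc : ∀ y ∈ R, y * z' = z' * y := by
      intro y hy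
      have := Subgroup.mem_center_iff.1 z.2 ⟨y, hy⟩
      exact congrArg Subtype.val this
    have hzi := hC z' (by rw [Subgroup.mem_centralizer_singleton_iff]; exact (hzc x hxR).symm)
    -- C(z') = R
    have hH : IsPGroup r (Subgroup.centralizer ({z'} : Set G)) := by
      rintro ⟨y, hy⟩
      by_cases hy1 : y = 1
      · exact ⟨0, by simpa using hy1⟩
      refine ⟨1, ?_⟩
      have hc : Commute z' y := (Subgroup.mem_centralizer_singleton_iff.1 hy).symm
      have h2 := h.comm hz1' hy1 hc
      rw [h.order_p hr R.isPGroup' hzR hz1'] at h2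
      apply Subtype.ext
      simp only [pow_one, Subgroup.coe_pow, Subgroup.coe_one]
      rw [h2, pow_orderOf_eq_one]
    have hle : (R : Subgroup G) ≤ Subgroup.centralizer ({z'} : Set G) := by
      intro y hy
      rw [Subgroup.mem_centralizer_singleton_iff]
      exact hzc y hy
    have h3 := R.is_maximal' hH hle
    refine ⟨R, t, ht, invert_of_fpf ht R ?_ ?_⟩
    · intro y hy
      rw [← h3, Subgroup.mem_centralizer_singleton_iff]
      have h1 : y * z'⁻¹ = z'⁻¹ * y := by
        have : Commute y z' := hzc y hy
        exact this.inv_right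
      have e1 : t * y * t⁻¹ * z' = t * (y * (t⁻¹ * z' * t)) * t⁻¹ := by group
      have e2 : z' * (t * y * t⁻¹) = t * ((t⁻¹ * z' * t) * y) * t⁻¹ := by group
      have e3 : t⁻¹ * z' * t = z'⁻¹ := by
        have := inv_of_ord2 ht
        rw [← hzi]; rw [this]
      rw [e1, e2, e3, h1]
    · intro y hy hc
      by_contra hy1
      exact hnofix y (h.order_p hr R.isPGroup' hy hy1) hc
  clear hi ht ht1
  obtain ⟨R0, t, ht, hi0⟩ := main
  -- transfer to R
  obtain ⟨g, hg⟩ := MulAction.exists_smul_eq G R R0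
  have hgR : ∀ y ∈ R, g * y * g⁻¹ ∈ R0 := by
    intro y hy
    rw [← hg]
    have h2 : g * y * g⁻¹ ∈ (g • R : Sylow r G).toSubgroup := by
      rw [Sylow.coe_subgroup_smul]
      have := Subgroup.smul_mem_pointwise_smul y (MulAut.conj g) R.toSubgroup hy
      simpa using this
    exact h2
  have hi : ∀ y ∈ R, (g⁻¹ * t * g⁻¹⁻¹) * y * (g⁻¹ * t * g⁻¹⁻¹)⁻¹ = y⁻¹ := by
    intro y hy
    have h1 := hi0 _ (hgR y hy)
    have e : (g⁻¹ * t * g⁻¹⁻¹) * y * (g⁻¹ * t * g⁻¹⁻¹)⁻¹ = g⁻¹ * (t * (g * y * g⁻¹) * t⁻¹) * g := by group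
    rw [e, h1]; group
  have hs : orderOf (g⁻¹ * t * g⁻¹⁻¹) = 2 := by rw [ord_conj, ht]
  set s := g⁻¹ * t * g⁻¹⁻¹
  have hs1 := ne_one_of_ord Nat.prime_two hs
  obtain ⟨g1, hg1⟩ := exists_conj_mem hr R hx
  have hb : (R : Subgroup G) ≠ ⊥ := fun h0 => conj_ne_one (g := g1) (ne_one_of_ord hr hx) (by
    have : g1 * x * g1⁻¹ ∈ (R : Subgroup G) := hg1
    rw [h0] at this; simpa using this)
  obtain ⟨d, hd, hcd, hN⟩ := h.N_index hr R hb
  have hsN : s ∈ Subgroup.normalizer (R : Set G) := by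
    rw [Subgroup.mem_set_normalizer_iff]
    intro y
    constructor
    · intro hy
      rw [hi y hy]; exact inv_mem hy
    · intro hy
      have h1 := hi _ hy
      have e : s * (s * y * s⁻¹) * s⁻¹ = y := by
        have ht2 := inv_of_ord2 hs
        have e : s * (s * y * s⁻¹) * s⁻¹ = (s * s) * y * (s⁻¹ * s⁻¹) := by group
        have e2 : s * s = 1 := by nth_rewrite 1 [← ht2]; simp
        rw [e, ht2, e2]; simp
      rw [e] at h1
      rw [h1]; exact inv_mem hy
  obtain ⟨n, hn⟩ := IsPGroup.iff_card.1 R.isPGroup'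
  have hn' : Nat.card R = r ^ n := hn
  have hd2 : d = 2 := by
    have h1 : orderOf s ∣ Nat.card (Subgroup.normalizer (R : Set G)) := Subgroup.orderOf_dvd_natCard _ hsN
    rw [hs, hN, Nat.Prime.dvd_mul Nat.prime_two, hn'] at h1
    rcases h1 with h1 | h1
    · rcases hd with hd | hd
      · rw [hd] at h1; norm_num at h1
      · exact ((Nat.prime_dvd_prime_iff_eq Nat.prime_two hd).1 h1).symm
    · exact absurd ((Nat.prime_dvd_prime_iff_eq Nat.prime_two hr).1 (Nat.prime_two.dvd_of_dvd_pow h1)).symm hr2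
  refine ⟨comm_of_invert (R : Subgroup G) hi, by rw [hN, hd2], ?_, ?_⟩
  · have h1 : r ∣ Nat.card R := by
      have := Subgroup.orderOf_dvd_natCard (R : Subgroup G) hg1
      rw [ord_conj, hx] at this
      exact this
    have := Nat.le_of_dvd Nat.card_pos h1
    have := hr.two_le
    omega
  · intro y hy
    obtain ⟨g2, hg2⟩ := exists_conj_mem hr R hy
    refine ⟨g2⁻¹ * s * g2⁻¹⁻¹, by rw [ord_conj, hs], ?_⟩
    have h1 := hi _ hg2
    have e : (g2⁻¹ * s * g2⁻¹⁻¹) * y * (g2⁻¹ * s * g2⁻¹⁻¹)⁻¹ = g2⁻¹ * (s * (g2 * y * g2⁻¹) * s⁻¹) * g2 := by group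
    rw [e, h1]; group

end E
end EPOA5

namespace EPOA5
open scoped Classical BigOperators
section E
variable {G : Type*} [Group G]

lemma sq_of_ord2 {u : G} (hu : orderOf u = 2) : u * u = 1 := by
  have := pow_orderOf_eq_one u
  rwa [hu, pow_two] at this

lemma invert_iff {t x : G} (ht : orderOf t = 2) : t * x * t⁻¹ = x⁻¹ ↔ (t * x) * (t * x) = 1 := by
  rw [inv_of_ord2 ht, eq_inv_iff_mul_eq_one]
  simp only [mul_assoc]

lemma inv_total [Fintype G] {t : G} (ht : orderOf t = 2) :
    (Finset.univ.filter (fun x : G => t * x * t⁻¹ = x⁻¹)).card = 1 + (Finset.univ.filter (fun y : G => orderOf y = 2)).card := by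
  have h1 : (Finset.univ.filter (fun x : G => t * x * t⁻¹ = x⁻¹)).card = (Finset.univ.filter (fun y : G => y * y = 1)).card := by
    refine Finset.card_bij (fun x _ => t * x) ?_ ?_ ?_
    · intro x hx
      simpa using (invert_iff ht).1 (by simpa using hx)
    · intro a _ b _ hab
      exact mul_left_cancel hab
    · intro y hy
      have hy : y * y = 1 := by simpa using hy
      refine ⟨t⁻¹ * y, ?_, by group⟩
      simp only [Finset.mem_filter, Finset.mem_univ, true_and]
      rw [invert_iff ht, mul_inv_cancel_left, hy]
  have h2 : (Finset.univ.filter (fun y : G => y * y = 1)) = insert 1 (Finset.univ.filter (fun y : G => orderOf y = 2)) := by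
    ext y
    simp only [Finset.mem_filter, Finset.mem_univ, true_and, Finset.mem_insert]
    constructor
    · intro hy
      by_cases hy1 : y = 1
      · exact Or.inl hy1
      · right
        exact orderOf_eq_prime (by rw [pow_two, hy]) hy1
    · rintro (rfl | hy)
      · simp
      · exact sq_of_ord2 hy
  rw [h1, h2, Finset.card_insert_of_notMem (by simp), add_comm]

lemma EPO.invert_low [Fintype G] (h : EPO G) (S : Sylow 2 G) {t : G} (htS : t ∈ S) (ht1 : t ≠ 1) :
    (Finset.univ.filter (fun x : G => t * x * t⁻¹ = x⁻¹ ∧ (x = 1 ∨ orderOf x = 2))).card = Nat.card S := by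
  have ht := h.order_p Nat.prime_two S.isPGroup' htS ht1
  rw [Nat.card_eq_fintype_card, Fintype.card_subtype]
  congr 1
  ext x
  simp only [Finset.mem_filter, Finset.mem_univ, true_and]
  have hinv : (x = 1 ∨ orderOf x = 2) → x⁻¹ = x := by
    rintro (rfl | hx)
    · simp
    · exact inv_of_ord2 hx
  constructor
  · rintro ⟨h1, h2⟩
    rw [hinv h2] at h1
    exact h.cent Nat.prime_two S (h.s2comm S) htS ht1 (mul_inv_eq_iff_eq_mul.1 h1).symm
  · intro hx
    have h2 : x = 1 ∨ orderOf x = 2 := by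
      by_cases hx1 : x = 1
      · exact Or.inl hx1
      · exact Or.inr (h.order_p Nat.prime_two S.isPGroup' hx hx1)
    refine ⟨?_, h2⟩
    rw [hinv h2, h.s2comm S t htS x hx]; group

/-- number of elements of order `r` inverted by `t` -/
noncomputable def nI [Fintype G] (t : G) (r : ℕ) : ℕ :=
  (Finset.univ.filter (fun x : G => t * x * t⁻¹ = x⁻¹ ∧ orderOf x = r)).card

/-- number of elements of order `r` -/
noncomputable def nO (G : Type*) [Group G] [Fintype G] (r : ℕ) : ℕ := (Finset.univ.filter (fun y : G => orderOf y = r)).card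

lemma nI_conj [Fintype G] (t g : G) (r : ℕ) : nI (g * t * g⁻¹) r = nI t r := by
  symm
  refine Finset.card_bij (fun x _ => g * x * g⁻¹) ?_ ?_ ?_
  · intro x hx
    simp only [Finset.mem_filter, Finset.mem_univ, true_and] at hx ⊢
    rw [ord_conj]
    refine ⟨?_, hx.2⟩
    have e : g * t * g⁻¹ * (g * x * g⁻¹) * (g * t * g⁻¹)⁻¹ = g * (t * x * t⁻¹) * g⁻¹ := by group
    rw [e, hx.1]; group
  · intro a _ b _ hab
    exact mul_left_cancel (mul_right_cancel hab)
  · intro x hx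
    simp only [Finset.mem_filter, Finset.mem_univ, true_and] at hx
    refine ⟨g⁻¹ * x * g⁻¹⁻¹, ?_, by group⟩
    simp only [Finset.mem_filter, Finset.mem_univ, true_and]
    rw [ord_conj]
    refine ⟨?_, hx.2⟩
    have e : t * (g⁻¹ * x * g⁻¹⁻¹) * t⁻¹ = g⁻¹ * (g * t * g⁻¹ * x * (g * t * g⁻¹)⁻¹) * g := by group
    rw [e, hx.1]; group

lemma EPO.inverter_ord (h : EPO G) {r : ℕ} (hr : r.Prime) (hr2 : r ≠ 2) {x g : G} (hx : orderOf x = r)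
    (hg : g * x * g⁻¹ = x⁻¹) : orderOf g = 2 := by
  have hx1 := ne_one_of_ord hr hx
  have hxi : x⁻¹ ≠ x := by
    intro h1
    have : x * x = 1 := by nth_rewrite 1 [← h1]; simp
    have := orderOf_eq_prime (p := 2) (by rw [pow_two, this]) hx1
    exact hr2 (hx.symm.trans this)
  have hg1 : g ≠ 1 := by
    rintro rfl
    exact hxi (by rw [← hg]; simp)
  rcases (h g hg1).eq_two_or_odd' with h2 | ⟨n, hn⟩
  · exact h2
  · exfalso
    have hc : Commute (g ^ 2) x := by
      have h1 : g ^ 2 * x * (g ^ 2)⁻¹ = x := by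
        have e : g ^ 2 * x * (g ^ 2)⁻¹ = g * (g * x * g⁻¹) * g⁻¹ := by rw [pow_two]; group
        have e2 : g * x⁻¹ * g⁻¹ = (g * x * g⁻¹)⁻¹ := by group
        rw [e, hg, e2, hg, inv_inv]
      exact mul_inv_eq_iff_eq_mul.1 h1
    have hg' : g = ((g ^ 2) ^ n)⁻¹ := by
      apply eq_inv_of_mul_eq_one_right
      rw [← pow_mul, ← pow_succ, ← hn, pow_orderOf_eq_one]
    have hc2 : Commute g x := by
      rw [hg']; exact (hc.pow_left n).inv_left
    apply hxi
    rw [← hg, hc2.eq]; group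

lemma EPO.pairs [Fintype G] (h : EPO G) (S : Sylow 2 G) (hS : ¬ (S : Subgroup G).Normal) {t : G} (ht : orderOf t = 2)
    {r : ℕ} (hr : r.Prime) (hr2 : r ≠ 2) (R : Sylow r G) (hRc : ∀ a ∈ R, ∀ b ∈ R, a * b = b * a)
    (hex : ∀ y : G, orderOf y = r → ∃ u : G, orderOf u = 2 ∧ u * y * u⁻¹ = y⁻¹) :
    nO G 2 * nI t r = nO G r * Nat.card R := by
  have := Fact.mk hr
  have key := Finset.sum_card_bipartiteAbove_eq_sum_card_bipartiteBelow (s := Finset.univ.filter (fun y : G => orderOf y = 2))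
    (t := Finset.univ.filter (fun y : G => orderOf y = r)) (fun u x => u * x * u⁻¹ = x⁻¹)
  rw [Finset.sum_congr rfl (g := fun _ => nI t r),
    Finset.sum_congr (s₁ := Finset.univ.filter (fun y : G => orderOf y = r)) rfl (g := fun _ => Nat.card R)] at key
  · rw [Finset.sum_const, Finset.sum_const, smul_eq_mul, smul_eq_mul] at key
    exact key
  · intro x hx
    have hx : orderOf x = r := by simpa using hx
    rw [Finset.bipartiteBelow, Finset.filter_filter]
    obtain ⟨g0, hg0⟩ := exists_conj_mem hr R hx
    obtain ⟨u0, hu0, hu0i⟩ := hex x hx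
    have hx1 := ne_one_of_ord hr hx
    -- move into R
    have hxi : orderOf x⁻¹ = r := by rw [orderOf_inv, hx]
    have e : (Finset.univ.filter (fun u : G => orderOf u = 2 ∧ u * x * u⁻¹ = x⁻¹)).card
      = (Finset.univ.filter (fun g : G => g * x * g⁻¹ = (g0 * x * g0⁻¹)⁻¹)).card := by
      refine Finset.card_bij (fun u _ => g0 * u) ?_ ?_ ?_
      · intro u hu
        simp only [Finset.mem_filter, Finset.mem_univ, true_and] at hu ⊢
        have e : g0 * u * x * (g0 * u)⁻¹ = g0 * (u * x * u⁻¹) * g0⁻¹ := by group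
        rw [e, hu.2]; group
      · intro a _ b _ hab
        exact mul_left_cancel hab
      · intro g hg
        simp only [Finset.mem_filter, Finset.mem_univ, true_and] at hg
        refine ⟨g0⁻¹ * g, ?_, by group⟩
        simp only [Finset.mem_filter, Finset.mem_univ, true_and]
        have h1 : g0⁻¹ * g * x * (g0⁻¹ * g)⁻¹ = x⁻¹ := by
          have e : g0⁻¹ * g * x * (g0⁻¹ * g)⁻¹ = g0⁻¹ * (g * x * g⁻¹) * g0 := by group
          rw [e, hg]; group
        exact ⟨h.inverter_ord hr hr2 hx h1, h1⟩
    rw [e]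
    exact card_transporter (g0 := g0 * u0) (by
      have e : g0 * u0 * x * (g0 * u0)⁻¹ = g0 * (u0 * x * u0⁻¹) * g0⁻¹ := by group
      rw [e, hu0i]; group) R (h.cent_iff hr R hRc (inv_mem hg0) (inv_ne_one.2 (conj_ne_one hx1)))
  · intro u hu
    have hu : orderOf u = 2 := by simpa using hu
    obtain ⟨g, rfl⟩ := h.inv_conj S hS ht hu
    rw [← nI_conj t g, nI, Finset.bipartiteAbove, Finset.filter_filter]
    congr 1
    ext x
    simp [and_comm]

/-- the real odd primes -/
noncomputable def RR [Fintype G] (t : G) : Finset ℕ :=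
  ((Nat.card G).primeFactors.erase 2).filter (fun r => ∃ x : G, t * x * t⁻¹ = x⁻¹ ∧ orderOf x = r)

theorem EPO.sum_I [Fintype G] (h : EPO G) (S : Sylow 2 G) {t : G} (htS : t ∈ S) (ht1 : t ≠ 1) :
    ∑ r ∈ RR t, nI t r + Nat.card S = 1 + nO G 2 := by
  have ht := h.order_p Nat.prime_two S.isPGroup' htS ht1
  rw [nO, ← inv_total ht, ← h.invert_low S htS ht1]
  rw [← Finset.card_filter_add_card_filter_not (s := Finset.univ.filter (fun x : G => t * x * t⁻¹ = x⁻¹))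
    (fun x => x = 1 ∨ orderOf x = 2), Finset.filter_filter, add_comm]
  congr 1
  rw [Finset.card_eq_sum_card_fiberwise (f := orderOf) (t := RR t)]
  · refine Finset.sum_congr rfl fun r hr => ?_
    rw [nI, Finset.filter_filter, Finset.filter_filter]
    congr 1
    ext x
    simp only [RR, Finset.mem_filter, Finset.mem_erase] at hr
    have hrp := Nat.prime_of_mem_primeFactors hr.1.2
    simp only [Finset.mem_filter, Finset.mem_univ, true_and]
    constructor
    · rintro ⟨h1, h2⟩
      refine ⟨h1, ?_, h2⟩
      rintro (h3 | h3)
      · exact ne_one_of_ord hrp h2 h3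
      · exact hr.1.1 (h2.symm.trans h3)
    · rintro ⟨h1, -, h2⟩
      exact ⟨h1, h2⟩
  · intro x hx
    simp only [Finset.coe_filter, Finset.mem_filter, Finset.mem_univ, true_and, Set.mem_ofPred_eq] at hx
    push Not at hx
    simp only [RR, Finset.coe_filter, Finset.mem_erase, Set.mem_ofPred_eq]
    exact ⟨⟨hx.2.2, Nat.mem_primeFactors.2 ⟨h x hx.2.1, orderOf_dvd_natCard x, Nat.card_pos.ne'⟩⟩, x, hx.1, rfl⟩

theorem EPO.real_facts [Fintype G] (h : EPO G) (S : Sylow 2 G) (hS : ¬ (S : Subgroup G).Normal) {t : G}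
    (htS : t ∈ S) (ht1 : t ≠ 1) {r : ℕ} (hrr : r ∈ RR t) :
    r.Prime ∧ r ≠ 2 ∧ ∃ c : ℕ, 3 ≤ c ∧ c = r ^ (Nat.card G).factorization r ∧ 2 * nI t r = (c - 1) * Nat.card S ∧
      nO G r * (2 * c) = (c - 1) * Nat.card G := by
  have ht := h.order_p Nat.prime_two S.isPGroup' htS ht1
  simp only [RR, Finset.mem_filter, Finset.mem_erase] at hrr
  have hr := Nat.prime_of_mem_primeFactors hrr.1.2
  have hr2 := hrr.1.1
  have := Fact.mk hr
  obtain ⟨x, hxi, hx⟩ := hrr.2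
  obtain ⟨R⟩ : Nonempty (Sylow r G) := inferInstance
  obtain ⟨hRc, hN, hc3, hex⟩ := h.real_sylow hr hr2 hx ht hxi R
  have h1 := h.pairs S hS ht hr hr2 R hRc hex
  have h2 := h.count_ord hr R hRc
  rw [hN] at h2
  have h3 := h.J_card S hS htS ht1
  refine ⟨hr, hr2, Nat.card R, hc3, R.card_eq_multiplicity, ?_, h2⟩
  change nO G r * (2 * Nat.card R) = (Nat.card R - 1) * Nat.card G at h2
  change nO G 2 * Nat.card S = Nat.card G at h3
  have hJ : 0 < nO G 2 := Finset.card_pos.2 ⟨t, by simpa using ht⟩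
  apply Nat.eq_of_mul_eq_mul_left hJ
  calc nO G 2 * (2 * nI t r) = 2 * (nO G 2 * nI t r) := by ring
    _ = nO G r * (2 * Nat.card R) := by rw [h1]; ring
    _ = _ := by rw [h2, ← h3]; ring

end E
end EPOA5

namespace EPOA5
open scoped Classical BigOperators
section E

lemma arith_aux {m d e s : ℕ} (hm : 3 ≤ m) (hd : 1 ≤ d) (he : 1 ≤ e) (hs : 2 * s = d + e)
    (hle : d * (2 + m * e) ≤ 1 + s * (m + 1)) : d = 1 ∧ e = 1 := by
  have h1 : 2 * (d * (2 + m * e)) ≤ 2 + (d + e) * (m + 1) := by rw [← hs]; nlinarith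
  obtain ⟨d, rfl⟩ := Nat.exists_eq_add_of_le hd
  obtain ⟨e, rfl⟩ := Nat.exists_eq_add_of_le he
  have h2 : m * (2 * d * e + d + e) + 3 * d ≤ e := by nlinarith
  have h3 : e ≤ m * e := Nat.le_mul_of_pos_left e (by omega)
  have h4 : m * (2 * d * e + d + e) = m * (2 * d * e) + m * d + m * e := by ring
  have h6 : 3 * e ≤ m * e := Nat.mul_le_mul_right e hm
  have h5 : e = 0 := by
    have : 0 ≤ m * (2 * d * e) := Nat.zero_le _
    omega
  have : d = 0 := by omega
  omega

lemma arith_main {m k N : ℕ} (hm : m.Prime) (hm3 : 3 ≤ m) {a : ℕ} (hq : m + 1 = 2 ^ a) (hk : 1 < k) (hN : N = (m + 1) * m * k)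
    (RR : Finset ℕ) (I O : ℕ → ℕ) (hprime : ∀ r ∈ RR, r.Prime) (h2 : ∀ r ∈ RR, r ≠ 2)
    (hc3 : ∀ r ∈ RR, 3 ≤ r ^ N.factorization r)
    (hI : ∀ r ∈ RR, 2 * I r = (r ^ N.factorization r - 1) * (m + 1))
    (hO : ∀ r ∈ RR, O r * (2 * r ^ N.factorization r) = (r ^ N.factorization r - 1) * N)
    (hs : ∑ r ∈ RR, I r + (m + 1) = 1 + m * k) (hOs : ∑ r ∈ RR, O r < N) :
    k = m + 2 ∧ ∃ r ∈ RR, r ^ N.factorization r = m + 2 := by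
  set c : ℕ → ℕ := fun r => r ^ N.factorization r with hc
  change ∀ r ∈ RR, 3 ≤ c r at hc3
  change ∀ r ∈ RR, 2 * I r = (c r - 1) * (m + 1) at hI
  change ∀ r ∈ RR, O r * (2 * c r) = (c r - 1) * N at hO
  change k = m + 2 ∧ ∃ r ∈ RR, c r = m + 2
  have hN0 : N ≠ 0 := by rw [hN]; positivity
  have hodd : ∀ r ∈ RR, Odd (c r) := fun r hr => ((hprime r hr).odd_of_ne_two (h2 r hr)).pow
  have hcN : ∀ r, c r ∣ N := fun r => Nat.ordProj_dvd N r
  have hcop2 : ∀ r ∈ RR, (c r).Coprime (m + 1) := by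
    intro r hr
    rw [hq]
    exact (Nat.coprime_two_right.2 (hodd r hr)).pow_right a
  have hcmk : ∀ r ∈ RR, c r ∣ m * k := by
    intro r hr
    apply (hcop2 r hr).dvd_of_dvd_mul_left
    rw [← mul_assoc, ← hN]; exact hcN r
  have hck : ∀ r ∈ RR, r ≠ m → c r ∣ k := by
    intro r hr hrm
    exact (((Nat.coprime_primes (hprime r hr) hm).2 hrm).pow_left _).dvd_of_dvd_mul_left (hcmk r hr)
  -- b
  have hb : ∃ b : ℕ → ℕ, ∀ r ∈ RR, c r = 1 + 2 * b r := by
    refine ⟨fun r => c r / 2, fun r hr => ?_⟩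
    have := Nat.odd_iff.1 (hodd r hr)
    change c r = 1 + 2 * (c r / 2)
    omega
  obtain ⟨b, hb⟩ := hb
  have hIb : ∀ r ∈ RR, I r = b r * (m + 1) := by
    intro r hr
    have := hI r hr
    rw [hb r hr, Nat.add_sub_cancel_left] at this
    nlinarith
  have hsum : (∑ r ∈ RR, b r) * (m + 1) = m * (k - 1) := by
    rw [Finset.sum_mul, ← Finset.sum_congr rfl hIb]
    obtain ⟨k, rfl⟩ := Nat.exists_eq_add_of_lt hk
    have : 1 + k + 1 - 1 = k + 1 := by omega
    rw [this]; nlinarith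
  have hqk : (m + 1) ∣ k - 1 := by
    apply Nat.Coprime.dvd_of_dvd_mul_left (m := m)
    · simp
    · rw [← hsum]; exact dvd_mul_left _ _
  obtain ⟨s, hsk⟩ := hqk
  have hk' : k = 1 + s * (m + 1) := by rw [mul_comm]; omega
  have hs1 : 1 ≤ s := by
    rcases Nat.eq_zero_or_pos s with h0 | h0
    · rw [h0] at hk'; omega
    · exact h0
  have hbs : ∑ r ∈ RR, b r = s * m := by
    rw [hsk] at hsum
    apply Nat.eq_of_mul_eq_mul_right (show 0 < m + 1 from Nat.succ_pos m)
    rw [hsum]; ring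
  -- card ≤ 2
  have hO3 : ∀ r ∈ RR, N ≤ 3 * O r := by
    intro r hr
    have h1 := hO r hr
    have h3 := hc3 r hr
    obtain ⟨x, hx⟩ := Nat.exists_eq_add_of_le h3
    rw [hx] at h1
    have : 3 + x - 1 = 2 + x := by omega
    rw [this] at h1
    by_contra hlt
    push Not at hlt
    have : 3 * (O r * (2 * (3 + x))) < 3 * ((2 + x) * N) := by
      calc 3 * (O r * (2 * (3 + x))) = (3 * O r) * (2 * (3 + x)) := by ring
        _ < N * (2 * (3 + x)) := Nat.mul_lt_mul_of_pos_right hlt (by omega)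
        _ ≤ 3 * ((2 + x) * N) := by nlinarith
    omega
  have hcard : RR.card ≤ 2 := by
    by_contra hlt
    push Not at hlt
    have h1 : RR.card * N ≤ 3 * ∑ r ∈ RR, O r := by
      rw [Finset.mul_sum, ← smul_eq_mul]
      exact Finset.card_nsmul_le_sum _ _ _ hO3
    have h3 : 3 * N ≤ RR.card * N := Nat.mul_le_mul_right N hlt
    omega
  have hsm : s * (m + 1) = s * m + s := by ring
  have hsm3 : s * 3 ≤ s * m := Nat.mul_le_mul_left s hm3
  -- neither-m pair
  have pair1 : ∀ r1 r2 : ℕ, r1 ≠ r2 → r1 ∈ RR → r2 ∈ RR → b r1 + b r2 = s * m → r1 ≠ m → r2 ≠ m → False := by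
    intro r1 r2 hne hr1 hr2 hbb h1 h2
    have hcc : (c r1).Coprime (c r2) := Nat.Coprime.pow _ _ ((Nat.coprime_primes (hprime r1 hr1) (hprime r2 hr2)).2 hne)
    have h3 := Nat.le_of_dvd (by omega) (hcc.mul_dvd_of_dvd_of_dvd (hck r1 hr1 h1) (hck r2 hr2 h2))
    rw [hb r1 hr1, hb r2 hr2] at h3
    have : (1 + 2 * b r1) * (1 + 2 * b r2) = 1 + 2 * (b r1 + b r2) + 4 * (b r1 * b r2) := by ring
    rw [this, hbb, hk'] at h3
    omega
  have pair2 : ∀ r2 : ℕ, m ≠ r2 → m ∈ RR → r2 ∈ RR → b m + b r2 = s * m → k = m + 2 ∧ c r2 = m + 2 := by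
    intro r2 hne hmR hr2 hbb
    have hdm : m ∣ c m := by
      apply dvd_pow_self
      intro h0
      have := hc3 m hmR
      simp [hc, h0] at this
    obtain ⟨d, hd⟩ := hdm
    have hdk : d ∣ k := by
      have := hcmk m hmR
      rw [hd] at this
      exact Nat.dvd_of_mul_dvd_mul_left hm.pos this
    have hcc : d.Coprime (c r2) := by
      have : (c m).Coprime (c r2) := Nat.Coprime.pow _ _ ((Nat.coprime_primes hm (hprime r2 hr2)).2 hne)
      exact this.coprime_dvd_left ⟨m, by rw [hd]; ring⟩
    have h3 := Nat.le_of_dvd (by omega) (hcc.mul_dvd_of_dvd_of_dvd hdk (hck r2 hr2 hne.symm))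
    have h4 : m * d + c r2 = 2 + 2 * (s * m) := by
      rw [← hd, hb m hmR, hb r2 hr2, ← hbb]; ring
    have hd1 : 1 ≤ d := by
      rcases Nat.eq_zero_or_pos d with h0 | h0
      · have := hc3 m hmR
        rw [hd, h0] at this; omega
      · exact h0
    have h5 := hc3 r2 hr2
    have hlt : d < 2 * s := by
      by_contra hge
      push Not at hge
      have : m * (2 * s) ≤ m * d := Nat.mul_le_mul_left m hge
      have e : m * (2 * s) = 2 * (s * m) := by ring
      omega
    obtain ⟨e, he⟩ := Nat.exists_eq_add_of_lt hlt
    have hc2 : c r2 = 2 + m * (e + 1) := by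
      have e2 : 2 * (s * m) = m * d + m * (e + 1) := by
        calc 2 * (s * m) = m * (2 * s) := by ring
          _ = _ := by rw [he]; ring
      omega
    rw [hc2, hk'] at h3
    obtain ⟨hd1', he1⟩ := arith_aux hm3 hd1 (by omega) (by rw [he]; ring) h3
    have he0 : e = 0 := by omega
    have hs' : s = 1 := by omega
    rw [hs'] at hk'
    rw [he0] at hc2
    exact ⟨by omega, by omega⟩
  interval_cases hR : RR.card
  · rw [Finset.card_eq_zero] at hR
    rw [hR, Finset.sum_empty] at hbs
    have : 0 < s * m := Nat.mul_pos hs1 hm.pos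
    omega
  · obtain ⟨r, hr⟩ := Finset.card_eq_one.1 hR
    have hrR : r ∈ RR := by rw [hr]; simp
    rw [hr, Finset.sum_singleton] at hbs
    exfalso
    have h1 := hb r hrR
    rw [hbs] at h1
    by_cases hrm : r = m
    · have hdm : m ∣ c r := by
        rw [← hrm]
        apply dvd_pow_self
        intro h0
        have := hc3 r hrR
        simp [hc, h0] at this
      rw [h1] at hdm
      have : m ∣ 1 := (Nat.dvd_add_left ⟨2 * s, by ring⟩).1 hdm
      exact hm.one_lt.ne' (Nat.dvd_one.1 this)
    · have := Nat.le_of_dvd (by omega) (hck r hrR hrm)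
      rw [h1, hk'] at this
      omega
  · obtain ⟨r1, r2, hne, hr⟩ := Finset.card_eq_two.1 hR
    have hr1 : r1 ∈ RR := by rw [hr]; simp
    have hr2 : r2 ∈ RR := by rw [hr]; simp
    rw [hr, Finset.sum_pair hne] at hbs
    by_cases h1 : r1 = m
    · subst h1
      obtain ⟨h3, h4⟩ := pair2 r2 hne hr1 hr2 hbs
      exact ⟨h3, r2, hr2, h4⟩
    · by_cases h2 : r2 = m
      · subst h2
        obtain ⟨h3, h4⟩ := pair2 r1 hne.symm hr2 hr1 (by rw [add_comm]; exact hbs)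
        exact ⟨h3, r1, hr1, h4⟩
      · exact (pair1 r1 r2 hne hr1 hr2 hbs h1 h2).elim

variable {G : Type*} [Group G]

theorem EPO.numerics [Fintype G] (h : EPO G) (S : Sylow 2 G) (hS : ¬ (S : Subgroup G).Normal) {t : G}
    (htS : t ∈ S) (ht1 : t ≠ 1) {m : ℕ} (hm : m.Prime) (hm3 : 3 ≤ m) (hq : Nat.card S = m + 1) :
    Nat.card G = (m + 1) * m * (m + 2) ∧ Nat.card (Sylow 2 G) = m + 2 ∧
    ∃ r v : ℕ, r.Prime ∧ r ^ v = m + 2 ∧ nO G r * (2 * (m + 2)) = (m + 1) * Nat.card G := by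
  have ht := h.order_p Nat.prime_two S.isPGroup' htS ht1
  obtain ⟨a, ha⟩ := IsPGroup.iff_card.1 S.isPGroup'
  have ha : Nat.card S = 2 ^ a := ha
  have hN := h.N_card S hS htS ht1
  have hk := S.card_eq_index_normalizer
  have hmul := Subgroup.index_mul_card (Subgroup.normalizer (S : Set G))
  rw [← hk, hN, hq] at hmul
  have hJ := h.J_card S hS htS ht1
  change nO G 2 * _ = _ at hJ
  set k := Nat.card (Sylow 2 G) with hkdef
  have hNN : Nat.card G = (m + 1) * m * k := by rw [← hmul, Nat.add_sub_cancel]; ring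
  have hk1 : 1 < k := by
    have h0 : 0 < k := Nat.card_pos
    by_contra hle
    have hk1 : k = 1 := by omega
    apply hS
    rw [← Subgroup.normalizer_eq_top_iff, ← Subgroup.index_eq_one]
    exact hk.symm.trans hk1
  have hJ' : nO G 2 = m * k := by
    rw [hq, hNN] at hJ
    apply Nat.eq_of_mul_eq_mul_right (show 0 < m + 1 from Nat.succ_pos m)
    rw [hJ]; ring
  have F := fun r (hr : r ∈ RR t) => h.real_facts S hS htS ht1 hr
  have hsI := h.sum_I S htS ht1
  rw [hq, hJ'] at hsI
  have hmain := arith_main (N := Nat.card G) hm hm3 (hq.symm.trans ha) hk1 hNN (RR t) (nI t) (nO G) (fun r hr => (F r hr).1)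
    (fun r hr => (F r hr).2.1) ?_ ?_ ?_ hsI ?_
  · obtain ⟨h1, r, hr, hc⟩ := hmain
    rw [h1] at hNN
    obtain ⟨h3, h4, c, h5, h6, h7, h8⟩ := F r hr
    rw [hc] at h6
    subst h6
    exact ⟨hNN, h1, r, _, h3, hc, h8⟩
  · intro r hr
    obtain ⟨h3, h4, c, h5, h6, h7, h8⟩ := F r hr
    rw [← h6]; exact h5
  · intro r hr
    obtain ⟨h3, h4, c, h5, h6, h7, h8⟩ := F r hr
    rw [← h6, ← hq]; exact h7
  · intro r hr
    obtain ⟨h3, h4, c, h5, h6, h7, h8⟩ := F r hr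
    rw [← h6]; exact h8
  · have h1 : ∑ r ∈ RR t, nO G r = (Finset.univ.filter (fun x : G => orderOf x ∈ RR t)).card := by
      rw [Finset.card_eq_sum_card_fiberwise (f := orderOf) (t := RR t)]
      · refine Finset.sum_congr rfl fun r hr => ?_
        rw [nO, Finset.filter_filter]
        congr 1
        ext x
        simp only [Finset.mem_filter, Finset.mem_univ, true_and]
        constructor
        · intro h; exact ⟨h ▸ hr, h⟩
        · exact fun h => h.2
      · intro x hx; simpa using hx
    rw [h1, Nat.card_eq_fintype_card, ← Finset.card_univ]
    apply Finset.card_lt_card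
    rw [Finset.filter_ssubset]
    refine ⟨1, Finset.mem_univ _, ?_⟩
    intro h1
    rw [orderOf_one] at h1
    exact (F 1 h1).1.ne_one rfl

end E
end EPOA5

namespace EPOA5
open scoped Classical BigOperators
section E
variable {G : Type*} [Group G]

lemma EPO.fixone [Finite G] (h : EPO G) {S P : Sylow 2 G} {x : G} (hx : x ∈ S) (hx1 : x ≠ 1)
    (hP : x • P = P) : P = S := by
  have hxN := Sylow.smul_eq_iff_mem_normalizer.1 hP
  have ho := h.order_p Nat.prime_two S.isPGroup' hx hx1
  have hz : IsPGroup 2 (Subgroup.zpowers x) := IsPGroup.of_card (n := 1) (by rw [Nat.card_zpowers, ho, pow_one])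
  have h1 : x ∈ Subgroup.zpowers x ⊓ Subgroup.normalizer (P : Set G) := ⟨Subgroup.mem_zpowers x, hxN⟩
  rw [hz.inf_normalizer_sylow P] at h1
  have hxP : x ∈ P := h1.2
  have hle : (P : Subgroup G) ≤ S := by
    intro y hy
    exact h.cent Nat.prime_two S (h.s2comm S) hx hx1 (h.s2comm P y hy x hxP)
  exact (Sylow.ext (P.is_maximal' S.isPGroup' hle)).symm

lemma EPO.faithful [Finite G] (h : EPO G) {S P : Sylow 2 G} (hne : P ≠ S) {t : G} (htS : t ∈ S) (ht1 : t ≠ 1)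
    {g : G} (hg : ∀ Q : Sylow 2 G, g • Q = Q) : g = 1 := by
  have hgi : ∀ Q : Sylow 2 G, g⁻¹ • Q = Q := fun Q => by rw [inv_smul_eq_iff, hg]
  have hgN := Sylow.smul_eq_iff_mem_normalizer.1 (hg S)
  have hc : g * t * g⁻¹ * t⁻¹ ∈ S :=
    mul_mem ((Subgroup.mem_set_normalizer_iff.1 hgN t).1 htS) (inv_mem htS)
  have hfix : (g * t * g⁻¹ * t⁻¹) • P = P := by
    rw [mul_smul, mul_smul, mul_smul, hgi, smul_inv_smul, hg]
  have hc1 : g * t * g⁻¹ * t⁻¹ = 1 := by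
    by_contra h1
    exact hne (h.fixone hc h1 hfix)
  have hgS : g ∈ S := by
    apply h.cent Nat.prime_two S (h.s2comm S) htS ht1
    have := mul_inv_eq_one.1 hc1
    exact mul_inv_eq_iff_eq_mul.1 this
  by_contra h1
  exact hne (h.fixone hgS h1 (hg P))

lemma EPO.three_fix [Finite G] (h : EPO G) {m a : ℕ} (hm : m.Prime) (hm3 : 3 ≤ m) (ha : m + 1 = 2 ^ a)
    (hk : Nat.card (Sylow 2 G) = m + 2) (hN : ∀ P : Sylow 2 G, Nat.card (Subgroup.normalizer (P : Set G)) = m * (m + 1))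
    (hne : ∀ S : Sylow 2 G, ∃ t ∈ S, t ≠ 1)
    {g : G} {P : Fin 3 → Sylow 2 G} (hP : Function.Injective P) (hf : ∀ i, g • P i = P i) : g = 1 := by
  by_contra hg1
  have hp := h g hg1
  have hd : orderOf g ∣ m * (m + 1) := by
    rw [← hN (P 0)]
    exact Subgroup.orderOf_dvd_natCard _ (Sylow.smul_eq_iff_mem_normalizer.1 (hf 0))
  by_cases h2 : orderOf g = 2
  · have hz : IsPGroup 2 (Subgroup.zpowers g) := IsPGroup.of_card (n := 1) (by rw [Nat.card_zpowers, h2, pow_one])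
    obtain ⟨Q, hQ⟩ := hz.exists_le_sylow
    have hgQ : g ∈ Q := hQ (Subgroup.mem_zpowers g)
    have := (h.fixone hgQ hg1 (hf 0)).trans (h.fixone hgQ hg1 (hf 1)).symm
    exact absurd (hP this) (by decide)
  have hom : orderOf g = m := by
    rcases (Nat.Prime.dvd_mul hp).1 hd with h1 | h1
    · exact (Nat.prime_dvd_prime_iff_eq hp hm).1 h1
    · rw [ha] at h1
      exact absurd ((Nat.prime_dvd_prime_iff_eq hp Nat.prime_two).1 (hp.dvd_of_dvd_pow h1)) h2
  have := Fact.mk hm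
  have hz : IsPGroup m (Subgroup.zpowers g) := IsPGroup.of_card (n := 1) (by rw [Nat.card_zpowers, hom, pow_one])
  have hmod := hz.card_modEq_card_fixedPoints (Sylow 2 G)
  set F := MulAction.fixedPoints (Subgroup.zpowers g) (Sylow 2 G) with hF
  have hmemF : ∀ Q : Sylow 2 G, Q ∈ F ↔ g • Q = Q := by
    intro Q
    rw [hF, Subgroup.sylow_mem_fixedPoints_iff, Subgroup.zpowers_le, Sylow.smul_eq_iff_mem_normalizer]
  have h3 : 3 ≤ Nat.card F := by
    have : Function.Injective (fun i : Fin 3 => (⟨P i, (hmemF _).2 (hf i)⟩ : F)) := by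
      intro i j hij
      exact hP (congrArg Subtype.val hij)
    have := Nat.card_le_card_of_injective _ this
    simpa using this
  have hle : Nat.card F ≤ m + 2 := by
    rw [← hk]
    exact Nat.card_le_card_of_injective _ Subtype.val_injective
  have hFc : Nat.card F = m + 2 := by
    rw [hk] at hmod
    have h4 : m + 2 ≡ 2 [MOD m] := by simp [Nat.ModEq]
    have h5 := (h4.symm.trans hmod)
    have h6 := (Nat.modEq_iff_dvd' (by omega)).1 h5
    have := Nat.le_of_dvd (by omega) h6
    omega
  have hall : ∀ Q : Sylow 2 G, g • Q = Q := by
    intro Q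
    rw [← hmemF]
    have : F = Set.univ := by
      apply Set.eq_of_subset_of_ncard_le (Set.subset_univ _)
      rw [Set.ncard_univ, hk, ← Nat.card_coe_set_eq, hFc]
    rw [this]; trivial
  obtain ⟨t, ht, ht1⟩ := hne (P 0)
  exact hg1 (h.faithful (P := P 1) (S := P 0) (fun h => absurd (hP h) (by decide)) ht ht1 hall)

lemma EPO.three_bound [Fintype G] (h : EPO G) {m a : ℕ} (hm : m.Prime) (hm3 : 3 ≤ m) (ha : m + 1 = 2 ^ a)
    (hk : Nat.card (Sylow 2 G) = m + 2) (hN : ∀ P : Sylow 2 G, Nat.card (Subgroup.normalizer (P : Set G)) = m * (m + 1))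
    (hne : ∀ S : Sylow 2 G, ∃ t ∈ S, t ≠ 1) (h3 : 3 ∣ m + 2) :
    nO G 3 * (m + 2) ≤ (m + 2) * ((m + 1) * m) := by
  have := Fintype.ofFinite (Sylow 2 G)
  have hnofix : ∀ x : G, orderOf x = 3 → ∀ P : Sylow 2 G, x • P ≠ P := by
    intro x hx P hP
    have hd : orderOf x ∣ m * (m + 1) := by
      rw [← hN P]
      exact Subgroup.orderOf_dvd_natCard _ (Sylow.smul_eq_iff_mem_normalizer.1 hP)
    rw [hx] at hd
    rcases (Nat.Prime.dvd_mul Nat.prime_three).1 hd with h1 | h1 <;> omega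
  have hx3 : ∀ x : G, orderOf x = 3 → ∀ P : Sylow 2 G, x • x • x • P = P := by
    intro x hx P
    have := pow_orderOf_eq_one x
    rw [hx] at this
    rw [← mul_smul, ← mul_smul, ← pow_three', this, one_smul]
  let f : {x : G // orderOf x = 3} × Sylow 2 G → Fin 3 → Sylow 2 G := fun y => ![y.2, y.1.1 • y.2, y.1.1 • y.1.1 • y.2]
  have hf : ∀ y, Function.Injective (f y) := by
    rintro ⟨⟨x, hx⟩, P⟩
    have a1 := hnofix x hx P
    have a2 := hnofix x hx (x • P)
    have a3 := hnofix x hx (x • x • P)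
    rw [hx3 x hx P] at a3
    intro i j hij
    fin_cases i <;> fin_cases j <;> simp [f] at hij ⊢
    · exact a1 hij.symm
    · exact a3 hij
    · exact a1 hij
    · exact a2 (by simp [← hij])
    · exact a3 hij.symm
    · exact a2 (by simp [hij])
  let F : {x : G // orderOf x = 3} × Sylow 2 G → (Fin 3 ↪ Sylow 2 G) := fun y => ⟨f y, hf y⟩
  have hFinj : Function.Injective F := by
    rintro ⟨⟨x, hx⟩, P⟩ ⟨⟨y, hy⟩, Q⟩ hxy
    have e : ∀ i, f (⟨x, hx⟩, P) i = f (⟨y, hy⟩, Q) i := fun i => DFunLike.congr_fun hxy i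
    have e0 : P = Q := e 0
    subst e0
    have e1 : x • P = y • P := e 1
    have e2 : x • x • P = y • y • P := e 2
    have hg := h.three_fix hm hm3 ha hk hN hne (hf (⟨x, hx⟩, P)) (g := y⁻¹ * x) (by
      intro i
      rw [mul_smul, inv_smul_eq_iff]
      fin_cases i
      · exact e1
      · change x • x • P = y • x • P
        rw [e2, e1]
      · change x • x • x • P = y • x • x • P
        rw [e2, hx3 y hy, ← e2, hx3 x hx])
    have : y = x := inv_mul_eq_one.1 hg
    subst this
    rfl
  have hc := Fintype.card_le_of_injective F hFinj
  rw [Fintype.card_embedding_eq, Fintype.card_prod, Fintype.card_subtype, ← Nat.card_eq_fintype_card (α := Sylow 2 G), hk,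
    Fintype.card_fin] at hc
  simpa [Nat.descFactorial_succ, nO, mul_comm, mul_left_comm, mul_assoc] using hc

lemma sixty_iso [Finite G] (hG : Nat.card G = 60) {Ω : Type*} [Finite Ω] [MulAction G Ω] (hΩ : Nat.card Ω = 5)
    (hf : ∀ g : G, (∀ a : Ω, g • a = a) → g = 1) : Nonempty (G ≃* alternatingGroup (Fin 5)) := by
  have := Fintype.ofFinite Ω
  let φ : G →* Equiv.Perm Ω := MulAction.toPermHom G Ω
  have hφ : Function.Injective φ := by
    rw [injective_iff_map_eq_one]
    intro g hg
    apply hf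
    intro a
    exact DFunLike.congr_fun hg a
  have e1 : G ≃* φ.range := MonoidHom.ofInjective hφ
  have hi : φ.range.index = 2 := by
    have h1 := Subgroup.index_mul_card φ.range
    rw [← Nat.card_congr e1.toEquiv, hG, Nat.card_perm, hΩ] at h1
    have : Nat.factorial 5 = 120 := by decide
    omega
  have h2 := Equiv.Perm.eq_alternatingGroup_of_index_eq_two hi
  have e : Ω ≃ Fin 5 := Finite.equivFinOfCardEq hΩ
  exact ⟨e1.trans ((MulEquiv.subgroupCongr h2).trans (Equiv.altCongrHom e))⟩

theorem even_case [Finite G] (h : EPO G) (h2 : 2 ∣ Nat.card G) (h3 : 3 ≤ (Nat.card G).primeFactors.card) :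
    Nonempty (G ≃* alternatingGroup (Fin 5)) := by
  have := Fintype.ofFinite G
  obtain ⟨S⟩ : Nonempty (Sylow 2 G) := inferInstance
  have hSb : ∀ S : Sylow 2 G, (S : Subgroup G) ≠ ⊥ := by
    intro S hb
    exact S.ne_bot_of_dvd_card h2 hb
  have hne : ∀ S : Sylow 2 G, ∃ t ∈ S, t ≠ 1 := by
    intro S
    obtain ⟨x, hx⟩ := (Subgroup.ne_bot_iff_exists_ne_one).1 (hSb S)
    exact ⟨x, x.2, by simpa using hx⟩
  have hS : ¬ (S : Subgroup G).Normal := by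
    intro hn
    have := h.two_primes Nat.prime_two hn S.isPGroup' (hSb S) ((Nat.Prime.coprime_iff_not_dvd Nat.prime_two).2 S.not_dvd_index)
    omega
  obtain ⟨t, htS, ht1⟩ := hne S
  have hNc := h.N_card S hS htS ht1
  obtain ⟨a, ha⟩ := IsPGroup.iff_card.1 S.isPGroup'
  have ha : Nat.card S = 2 ^ a := ha
  by_cases hq2 : Nat.card S = 2
  · have := h.q_two S htS ht1 hq2 (by rw [hNc, hq2])
    omega
  have hm := (h.q_cases S hS htS ht1).resolve_left hq2
  obtain ⟨m, hqm⟩ : ∃ m, Nat.card S = m + 1 := ⟨Nat.card S - 1, by have := hm.two_le; omega⟩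
  rw [hqm, Nat.add_sub_cancel] at hm
  have hpow : m + 1 = 2 ^ a := hqm.symm.trans ha
  have hm3 : 3 ≤ m := by
    have := hm.two_le
    have : m ≠ 2 := by
      rintro rfl
      have h1 : Odd (2 ^ a) := by rw [← hpow]; decide
      rw [Nat.odd_pow_iff] at h1
      · exact absurd h1 (by decide)
      · rintro rfl; norm_num at hpow
    omega
  obtain ⟨hG, hk, r, v, hr, hrv, hO⟩ := h.numerics S hS htS ht1 hm hm3 hqm
  have hfaith : ∀ g : G, (∀ Q : Sylow 2 G, g • Q = Q) → g = 1 := by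
    intro g hg
    have : Nontrivial (Sylow 2 G) := by
      rw [← Finite.one_lt_card_iff_nontrivial, hk]; omega
    obtain ⟨P, hP⟩ := exists_ne S
    exact h.faithful hP htS ht1 hg
  have hmod : (m + 1) % 3 ≠ 0 := by
    intro h0
    have := Nat.dvd_of_mod_eq_zero h0
    rw [hpow] at this
    have := (Nat.prime_dvd_prime_iff_eq Nat.prime_three Nat.prime_two).1 (Nat.prime_three.dvd_of_dvd_pow this)
    omega
  by_cases hm0 : m % 3 = 0
  · have hm3' : m = 3 := ((Nat.prime_dvd_prime_iff_eq Nat.prime_three hm).1 (Nat.dvd_of_mod_eq_zero hm0)).symm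
    subst hm3'
    exact sixty_iso (by rw [hG]) hk hfaith
  · exfalso
    have h3d : 3 ∣ m + 2 := by omega
    have hr3 : r = 3 := by
      have h4 := h3d
      rw [← hrv] at h4
      exact ((Nat.prime_dvd_prime_iff_eq Nat.prime_three hr).1 (Nat.prime_three.dvd_of_dvd_pow h4)).symm
    subst hr3
    have hN : ∀ P : Sylow 2 G, Nat.card (Subgroup.normalizer (P : Set G)) = m * (m + 1) := by
      intro P
      have h1 := Subgroup.index_mul_card (Subgroup.normalizer (P : Set G))
      rw [← P.card_eq_index_normalizer, hk, hG] at h1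
      apply Nat.eq_of_mul_eq_mul_left (show 0 < m + 2 by omega)
      rw [h1]; ring
    have hb := h.three_bound hm hm3 hpow hk hN hne h3d
    rw [hG] at hO
    have hpos : 0 < (m + 1) * m * (m + 2) := by positivity
    have : (m + 1) * ((m + 1) * m * (m + 2)) ≤ 2 * ((m + 1) * m * (m + 2)) := by
      rw [← hO]; nlinarith
    have := Nat.le_of_mul_le_mul_right this hpos
    omega

end E
end EPOA5

namespace EPOA5
open scoped Classical BigOperators
section F

lemma perm5_pow : ∀ g : Equiv.Perm (Fin 5), Equiv.Perm.sign g = 1 → g ^ 2 = 1 ∨ g ^ 3 = 1 ∨ g ^ 5 = 1 := by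
  decide +kernel

lemma A5_epo : EPO (alternatingGroup (Fin 5)) := by
  intro g hg
  have h1 := perm5_pow g (Equiv.Perm.mem_alternatingGroup.1 g.2)
  have key : ∀ n : ℕ, n.Prime → (g : Equiv.Perm (Fin 5)) ^ n = 1 → (orderOf g).Prime := by
    intro n hn h2
    have h3 : g ^ n = 1 := Subtype.ext (by simpa using h2)
    have := Fact.mk hn
    rw [orderOf_eq_prime h3 hg]
    exact hn
  rcases h1 with h1 | h1 | h1
  · exact key 2 Nat.prime_two h1
  · exact key 3 Nat.prime_three h1
  · exact key 5 Nat.prime_five h1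

lemma A5_card : Nat.card (alternatingGroup (Fin 5)) = 60 := by
  rw [nat_card_alternatingGroup]
  simp [Nat.factorial]

lemma pf60 : (60 : ℕ).primeFactors.card = 3 := by
  have : (60 : ℕ).primeFactors = {2, 3, 5} := by
    have : (60 : ℕ) = 2 ^ 2 * (3 * 5) := by norm_num
    rw [this, Nat.primeFactors_mul (by norm_num) (by norm_num), Nat.primeFactors_mul (by norm_num) (by norm_num),
      Nat.primeFactors_prime_pow (by norm_num) Nat.prime_two, Nat.prime_three.primeFactors, Nat.prime_five.primeFactors]
    rfl
  rw [this]; rfl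

theorem forward {G : Type*} [Group G] [Finite G] (e : G ≃* alternatingGroup (Fin 5)) :
    3 ≤ (Nat.card G).primeFactors.card ∧ EPO G := by
  refine ⟨?_, A5_epo.of_surj e.symm.toMonoidHom e.symm.surjective⟩
  rw [Nat.card_congr e.toEquiv, A5_card, pf60]

theorem backward {G : Type*} [Group G] [Finite G] (h3 : 3 ≤ (Nat.card G).primeFactors.card) (h : EPO G) :
    Nonempty (G ≃* alternatingGroup (Fin 5)) := by
  rcases Nat.even_or_odd (Nat.card G) with he | ho
  · exact even_case h he.two_dvd h3
  · exfalso
    let e : G ≃* Shrink.{0} G := Shrink.mulEquiv.symm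
    have hc : Nat.card (Shrink.{0} G) = Nat.card G := (Nat.card_congr e.toEquiv).symm
    have : Finite (Shrink.{0} G) := Finite.of_equiv G e.toEquiv
    have := odd_two (h.of_surj e.toMonoidHom e.surjective) (by rwa [hc])
    rw [hc] at this
    omega

end F
end EPOA5

theorem isoA5_iff_three_primes_and_prime_element_orders {G : Type*} [Group G] [Finite G] :
    Nonempty (G ≃* alternatingGroup (Fin 5)) ↔
      3 ≤ (Nat.card G).primeFactors.card ∧
        ∀ g : G, g ≠ 1 → (orderOf g).Prime := by
  constructor
  · rintro ⟨e⟩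
    exact EPOA5.forward e
  · rintro ⟨h3, h⟩
    exact EPOA5.backward h3 h
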